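/- arXiv:1907.02914 — 2 statements merged into one kernel-verified Lean document; each statement's English description precedes it below -/
import Mathlib

section
/- Let K be a number field and S a set of prime ideals of K possessing a natural density δ(S). If Σ_{2 ≤ N(a) ≤ X} Q_S(a) = c_K·δ(S)·X + o(X), then the limit lim_{X→∞} Σ_{2 ≤ N(a) ≤ X, a ∈ D(K,S)} μ_K(a)/N(a) exists and equals −δ(S). -/
open NumberField Ideal Filter

noncomputable section

namespace AlladiGen

variable (K : Type*) [Field K] [NumberField K]

open Classical in
/-- The generalized Möbius function on integral ideals. -/
def muK (a : Ideal (𝓞 K)) : ℤ :=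
  if Squarefree a then (-1) ^ (Nat.card {p : Ideal (𝓞 K) // p.IsPrime ∧ a ≤ p}) else 0

/-- `p` is a prime ideal of minimal norm among those containing `a`. -/
def MinimalPrime (a p : Ideal (𝓞 K)) : Prop :=
  p.IsPrime ∧ a ≤ p ∧ ∀ q : Ideal (𝓞 K), q.IsPrime → a ≤ q → absNorm p ≤ absNorm q

/-- `a ∈ D(K,S)`: `a` is distinguishable with minimal prime in `S`. -/
def InD (S : Set (Ideal (𝓞 K))) (a : Ideal (𝓞 K)) : Prop :=
  ∃ p : Ideal (𝓞 K), MinimalPrime K a p ∧ p ∈ S ∧ ∀ q : Ideal (𝓞 K), MinimalPrime K a q → q = p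

/-- `π_S(K; X)`: number of prime ideals in `S` of norm at most `X`. -/
def primeCount (S : Set (Ideal (𝓞 K))) (X : ℝ) : ℕ :=
  Nat.card {p : Ideal (𝓞 K) // p.IsPrime ∧ p ∈ S ∧ (absNorm p : ℝ) ≤ X}

/-- `S` has natural density `δ` within the prime ideals of `K`. -/
def HasPrimeDensity (S : Set (Ideal (𝓞 K))) (δ : ℝ) : Prop :=
  Tendsto (fun X : ℝ => (primeCount K S X : ℝ) / (primeCount K Set.univ X : ℝ))
    atTop (nhds δ)

/-- `M(a)`: the maximal norm of a prime ideal containing `a`. -/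
def maxNorm (a : Ideal (𝓞 K)) : ℕ :=
  sSup (absNorm '' {p : Ideal (𝓞 K) | p.IsPrime ∧ a ≤ p})

/-- `Q_S(a)`: number of primes in `S` containing `a` of maximal norm. -/
def QS (S : Set (Ideal (𝓞 K))) (a : Ideal (𝓞 K)) : ℕ :=
  Nat.card {p : Ideal (𝓞 K) // p.IsPrime ∧ a ≤ p ∧ p ∈ S ∧ absNorm p = maxNorm K a}

/-- `c_K`: residue of the Dedekind zeta function at 1, via the analytic class number formula. -/
def cK : ℝ :=
  (2 ^ (InfinitePlace.nrRealPlaces K) * (2 * Real.pi) ^ (InfinitePlace.nrComplexPlaces K) *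
    NumberField.Units.regulator K * (NumberField.classNumber K)) /
  ((NumberField.Units.torsionOrder K : ℝ) * Real.sqrt |(NumberField.discr K : ℝ)|)

/-- `Ψ(X,Y)`: number of `Y`-smooth nonzero integral ideals of norm at most `X`. -/
def Psi (X Y : ℝ) : ℕ :=
  Nat.card {a : Ideal (𝓞 K) // a ≠ ⊥ ∧ (absNorm a : ℝ) ≤ X ∧
    ∀ p : Ideal (𝓞 K), p.IsPrime → a ≤ p → (absNorm p : ℝ) ≤ Y}

/-- `[X]_K`: number of nonzero integral ideals of norm at most `X`. -/
def idealCount (X : ℝ) : ℕ := Nat.card {a : Ideal (𝓞 K) // a ≠ ⊥ ∧ (absNorm a : ℝ) ≤ X}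

/-- The logarithmic integral `Li(X) = ∫_2^X dt / log t`. -/
def Li (X : ℝ) : ℝ := ∫ t in (2:ℝ)..X, 1 / Real.log t

section LatticeSum
open MeasureTheory Module

theorem span_vaddInv {E : Type*} [NormedAddCommGroup E] [NormedSpace ℝ E]
    [MeasurableSpace E] [BorelSpace E]
    (μ : Measure E) [μ.IsAddHaarMeasure] (L : Submodule ℤ E) : VAddInvariantMeasure L E μ :=
  ⟨fun c s _ => measure_preimage_add μ (c : E) s⟩

theorem lattice_count {E : Type*} [NormedAddCommGroup E] [NormedSpace ℝ E]
    [FiniteDimensional ℝ E] [MeasurableSpace E] [BorelSpace E] {ι : Type*} [Fintype ι]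
    (b : Basis ι ℝ E) (μ : Measure E) [μ.IsAddHaarMeasure] (d : ℝ)
    (hd : ∀ x ∈ ZSpan.fundamentalDomain b, ‖x‖ ≤ d) (hd0 : 0 ≤ d) (r : ℝ) (hr : 0 ≤ r)
    (s : Finset (Submodule.span ℤ (Set.range b))) (hs : ∀ l ∈ s, ‖(l : E)‖ ≤ r) :
    (s.card : ℝ) * μ.real (ZSpan.fundamentalDomain b) ≤
      (r + d) ^ (finrank ℝ E) * μ.real (Metric.closedBall 0 1) := by
  haveI := span_vaddInv μ (Submodule.span ℤ (Set.range b))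
  have hF := ZSpan.isAddFundamentalDomain b μ
  have h1 : (s.card : ENNReal) * μ (ZSpan.fundamentalDomain b) ≤ μ (Metric.closedBall 0 (r + d)) := by
    rw [hF.measure_eq_tsum' (Metric.closedBall 0 (r + d))]
    refine le_trans ?_ (ENNReal.sum_le_tsum s)
    rw [← nsmul_eq_mul, ← Finset.sum_const]
    refine Finset.sum_le_sum fun l hl => ?_
    rw [Set.inter_eq_right.mpr]
    · rw [measure_vadd]
    · rintro _ ⟨x, hx, rfl⟩
      simp only [Metric.mem_closedBall, dist_zero_right]
      refine (norm_add_le _ _).trans (add_le_add (hs l hl) (hd x hx))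
  rw [Measure.addHaar_closedBall' μ _ (by positivity)] at h1
  have hb : μ (Metric.closedBall (0:E) 1) ≠ ⊤ := measure_closedBall_lt_top.ne
  have h2 := ENNReal.toReal_mono (ENNReal.mul_ne_top ENNReal.ofReal_ne_top hb) h1
  rwa [ENNReal.toReal_mul, ENNReal.toReal_mul, ENNReal.toReal_natCast,
    ENNReal.toReal_ofReal (by positivity)] at h2

theorem lattice_sum {E : Type*} [NormedAddCommGroup E] [NormedSpace ℝ E]
    [FiniteDimensional ℝ E] [MeasurableSpace E] [BorelSpace E] {ι : Type*} [Fintype ι]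
    (b : Basis ι ℝ E) (μ : Measure E) [μ.IsAddHaarMeasure] (R : ℝ) (hR : 0 ≤ R) :
    ∃ C : ℝ, 0 ≤ C ∧ ∀ (φ : E → ℝ) (M : ℝ), 0 ≤ M → (∀ x y, |φ x - φ y| ≤ M * ‖x - y‖) →
      (∀ x, R < ‖x‖ → φ x = 0) → ∃ I : ℝ, ∀ t : ℝ, 1 ≤ t →
      |(∑' l : Submodule.span ℤ (Set.range b), φ (t⁻¹ • (l : E))) - I * t ^ (finrank ℝ E)| ≤
        C * M * (t ^ (finrank ℝ E) / t) := by
  classical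
  set F := ZSpan.fundamentalDomain b with hFdef
  set n := finrank ℝ E with hn
  haveI := span_vaddInv μ (Submodule.span ℤ (Set.range b))
  have hF := ZSpan.isAddFundamentalDomain b μ
  have hFb : Bornology.IsBounded F := ZSpan.fundamentalDomain_isBounded b
  obtain ⟨d, hd0, hd⟩ := hFb.exists_pos_norm_le
  have hFfin : μ F ≠ ⊤ := hFb.measure_lt_top.ne
  have hFm : MeasurableSet F := ZSpan.fundamentalDomain_measurableSet b
  set v := μ.real F with hv
  have hvpos : 0 < v := ENNReal.toReal_pos (ZSpan.measure_fundamentalDomain_ne_zero b) hFfin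
  set β := μ.real (Metric.closedBall (0:E) 1)
  have hβ : 0 ≤ β := measureReal_nonneg
  refine ⟨d * ((R + 2 * d) ^ n * β) / v, by positivity, fun φ M hM hφ hsupp => ?_⟩
  have hlip : LipschitzWith (Real.toNNReal M) φ := LipschitzWith.of_dist_le_mul fun x y => by
    rw [Real.dist_eq, dist_eq_norm, Real.coe_toNNReal _ hM]; exact hφ x y
  have hcont := hlip.continuous
  have hcs : HasCompactSupport φ := by
    refine HasCompactSupport.intro (isCompact_closedBall (0:E) R) fun x hx => hsupp x ?_
    simpa using hx
  refine ⟨(∫ x, φ x ∂μ) / v, fun t ht => ?_⟩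
  have ht0 : 0 < t := by linarith
  set φt : E → ℝ := fun x => φ (t⁻¹ • x) with hφt
  have hφt_lip : ∀ x y, |φt x - φt y| ≤ M / t * ‖x - y‖ := fun x y => by
    refine (hφ _ _).trans (le_of_eq ?_)
    rw [← smul_sub, norm_smul, norm_inv, Real.norm_of_nonneg ht0.le]; ring
  have hφt_supp : ∀ x, R * t < ‖x‖ → φt x = 0 := fun x hx => by
    apply hsupp
    rw [norm_smul, norm_inv, Real.norm_of_nonneg ht0.le, inv_mul_eq_div, lt_div_iff₀ ht0]
    exact hx
  have hφt_cont : Continuous φt := hcont.comp (continuous_const_smul _)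
  have hφt_cs : HasCompactSupport φt := by
    refine HasCompactSupport.intro (isCompact_closedBall (0:E) (R * t)) fun x hx => hφt_supp x ?_
    simpa using hx
  have hIntg : Integrable φt μ := hφt_cont.integrable_of_hasCompactSupport hφt_cs
  have hI : ∫ x, φt x ∂μ = t ^ n * ∫ x, φ x ∂μ := by
    rw [hφt, Measure.integral_comp_inv_smul_of_nonneg μ φ ht0.le]; rfl
  set r := R * t + d with hr
  have hfin : {l : Submodule.span ℤ (Set.range b) | ‖(l : E)‖ ≤ r}.Finite := by
    have h := ZSpan.setFinite_inter b (s := Metric.closedBall (0:E) r) Metric.isBounded_closedBall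
    refine Set.Finite.of_finite_image (f := Subtype.val) (h.subset ?_) Subtype.val_injective.injOn
    rintro _ ⟨l, hl, rfl⟩
    exact ⟨by simpa using hl, l.2⟩
  set s := hfin.toFinset with hs
  have hs_mem : ∀ l, l ∈ s ↔ ‖(l : E)‖ ≤ r := fun l => by simp [hs]
  have hA : (∑' l : Submodule.span ℤ (Set.range b), φt (l : E)) = ∑ l ∈ s, φt l := by
    refine tsum_eq_sum fun l hl => hφt_supp _ ?_
    rw [hs_mem, not_le] at hl
    linarith
  have hB : ∫ x, φt x ∂μ = ∑ l ∈ s, ∫ x in F, φt (l + x) ∂μ := by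
    rw [hF.integral_eq_tsum'' φt hIntg]
    refine tsum_eq_sum fun l hl => ?_
    rw [hs_mem, not_le] at hl
    refine setIntegral_eq_zero_of_forall_eq_zero fun x hx => hφt_supp _ ?_
    have h1 := hd x hx
    have h2 : ‖(l : E)‖ ≤ ‖(l : E) + x‖ + ‖x‖ := by
      simpa using norm_sub_le ((l : E) + x) x
    change R * t < ‖(l : E) + x‖
    linarith
  have hC : |v * (∑ l ∈ s, φt l) - ∫ x, φt x ∂μ| ≤ s.card * v * (M / t * d) := by
    rw [hB, Finset.mul_sum, ← Finset.sum_sub_distrib]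
    refine (Finset.abs_sum_le_sum_abs _ _).trans ?_
    rw [mul_assoc, ← nsmul_eq_mul, ← Finset.sum_const]
    refine Finset.sum_le_sum fun l _ => ?_
    have e1 : v * φt l = ∫ x in F, φt l ∂μ := by
      rw [setIntegral_const, smul_eq_mul]
    have hIntg2 : IntegrableOn (fun x => φt (l + x)) F μ := (hIntg.comp_add_left (l : E)).integrableOn
    have hc : IntegrableOn (fun _ : E => φt l) F μ := integrableOn_const hFfin
    rw [e1, ← integral_sub hc hIntg2]
    have := norm_setIntegral_le_of_norm_le_const (μ := μ) (s := F) (C := M / t * d)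
      (f := fun x => φt l - φt (l + x)) hFfin.lt_top (fun x hx => ?_)
    · rw [Real.norm_eq_abs] at this
      rw [mul_comm]; exact this
    · rw [Real.norm_eq_abs]
      refine (hφt_lip _ _).trans ?_
      have : ‖(l : E) - (l + x)‖ = ‖x‖ := by simp
      rw [this]
      exact mul_le_mul_of_nonneg_left (hd x hx) (by positivity)
  have hD : (s.card : ℝ) * v ≤ (r + d) ^ n * β :=
    lattice_count b μ d hd hd0.le r (by positivity) s fun l hl => (hs_mem l).1 hl
  have hE : (r + d) ^ n ≤ (R + 2 * d) ^ n * t ^ n := by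
    rw [← mul_pow]
    refine pow_le_pow_left₀ (by positivity) ?_ _
    nlinarith
  rw [hA]
  have e3 : (∑ l ∈ s, φt l) - (∫ x, φ x ∂μ) / v * t ^ n =
      (v * (∑ l ∈ s, φt l) - ∫ x, φt x ∂μ) / v := by
    rw [hI]; field_simp
  rw [e3, abs_div, abs_of_pos hvpos, div_le_iff₀ hvpos]
  refine hC.trans ?_
  calc s.card * v * (M / t * d) ≤ ((R + 2 * d) ^ n * t ^ n * β) * (M / t * d) := by
        refine mul_le_mul_of_nonneg_right (hD.trans ?_) (by positivity)
        exact mul_le_mul_of_nonneg_right hE hβ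
    _ = d * ((R + 2 * d) ^ n * β) / v * M * (t ^ n / t) * v := by field_simp

end LatticeSum

section Phi
open NumberField.Units NumberField.Units.dirichletUnitTheorem Module NumberField.mixedEmbedding
open NumberField.InfinitePlace

def tent (c : ℝ) : ℝ := max 0 (1 - |c|)

theorem tent_nonneg (c : ℝ) : 0 ≤ tent c := le_max_left _ _
theorem tent_le_one (c : ℝ) : tent c ≤ 1 := max_le zero_le_one (by linarith [abs_nonneg c])
theorem tent_eq_zero {c : ℝ} (h : 1 ≤ |c|) : tent c = 0 := max_eq_left (by linarith)
theorem tent_lip (c d : ℝ) : |tent c - tent d| ≤ |c - d| := by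
  unfold tent
  rw [max_comm 0, max_comm 0]
  refine (abs_max_sub_max_le_abs _ _ _).trans ?_
  rw [show 1 - |c| - (1 - |d|) = |d| - |c| by ring, abs_sub_comm c d]
  exact abs_abs_sub_abs_le _ _

theorem prod_tent_nonneg {ι : Type*} (s : Finset ι) (c : ι → ℝ) : 0 ≤ ∏ i ∈ s, tent (c i) :=
  Finset.prod_nonneg fun _ _ => tent_nonneg _
theorem prod_tent_le_one {ι : Type*} (s : Finset ι) (c : ι → ℝ) : ∏ i ∈ s, tent (c i) ≤ 1 :=
  Finset.prod_le_one (fun _ _ => tent_nonneg _) fun _ _ => tent_le_one _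

theorem prod_tent_lip {ι : Type*} (s : Finset ι) (c d : ι → ℝ) (D : ℝ)
    (h : ∀ i, |c i - d i| ≤ D) :
    |∏ i ∈ s, tent (c i) - ∏ i ∈ s, tent (d i)| ≤ s.card * D := by
  classical
  induction s using Finset.induction_on with
  | empty => simp
  | insert a s ha ih =>
    rw [Finset.prod_insert ha, Finset.prod_insert ha, Finset.card_insert_of_notMem ha]
    have e : tent (c a) * ∏ i ∈ s, tent (c i) - tent (d a) * ∏ i ∈ s, tent (d i) =
      (tent (c a) - tent (d a)) * ∏ i ∈ s, tent (c i) +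
        tent (d a) * (∏ i ∈ s, tent (c i) - ∏ i ∈ s, tent (d i)) := by ring
    rw [e]
    refine (abs_add_le _ _).trans ?_
    rw [abs_mul, abs_mul, abs_of_nonneg (prod_tent_nonneg s c), abs_of_nonneg (tent_nonneg _)]
    have h1 := (tent_lip (c a) (d a)).trans (h a)
    have h2 := prod_tent_le_one s c
    have h3 := prod_tent_nonneg s c
    have h4 := tent_le_one (d a)
    have h5 := tent_nonneg (d a)
    have h6 := abs_nonneg (tent (c a) - tent (d a))
    have h7 := abs_nonneg (∏ i ∈ s, tent (c i) - ∏ i ∈ s, tent (d i))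
    push_cast
    nlinarith

theorem log_max_lip {δ : ℝ} (hδ : 0 < δ) (a b : ℝ) :
    |Real.log (max a δ) - Real.log (max b δ)| ≤ δ⁻¹ * |a - b| := by
  wlog hab : a ≤ b generalizing a b
  · rw [abs_sub_comm, abs_sub_comm a b]; exact this b a (le_of_not_ge hab)
  have ha : 0 < max a δ := lt_max_of_lt_right hδ
  have hb : 0 < max b δ := lt_max_of_lt_right hδ
  have hle : max a δ ≤ max b δ := max_le_max hab le_rfl
  rw [abs_sub_comm, abs_of_nonneg (sub_nonneg.2 (Real.log_le_log ha hle)),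
    ← Real.log_div hb.ne' ha.ne']
  refine (Real.log_le_sub_one_of_pos (div_pos hb ha)).trans ?_
  have h1 : max b δ - max a δ ≤ |a - b| := by
    rw [abs_sub_comm]
    exact (le_abs_self _).trans (abs_max_sub_max_le_abs _ _ _)
  have h2 : δ ≤ max a δ := le_max_right _ _
  rw [div_sub_one ha.ne', inv_mul_eq_div]
  exact div_le_div₀ (abs_nonneg _) h1 hδ h2

variable {K}

/-- The log map at linear level. -/
def logLin (K : Type*) [Field K] [NumberField K] : (InfinitePlace K → ℝ) →ₗ[ℝ] ℝ × logSpace K where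
  toFun l := (∑ w, (mult w : ℝ) * l w, fun w => mult w.1 * (l w.1 -
    (∑ w, (mult w : ℝ) * l w) * (finrank ℚ K : ℝ)⁻¹))
  map_add' x y := by
    simp only [Pi.add_apply, mul_add, Finset.sum_add_distrib, Prod.mk_add_mk, Prod.mk.injEq,
      true_and]
    ext w; simp; ring
  map_smul' c x := by
    have : ∑ w, (mult w : ℝ) * (c * x w) = c * ∑ w, (mult w : ℝ) * x w := by
      rw [Finset.mul_sum]; refine Finset.sum_congr rfl fun w _ => by ring
    simp only [Pi.smul_apply, smul_eq_mul, RingHom.id_apply, Prod.smul_mk, Prod.mk.injEq, this,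
      true_and]
    ext w; simp; ring

theorem logLin_inj : Function.Injective (logLin K) := by
  rw [injective_iff_map_eq_zero]
  intro l hl
  have h1 : ∑ w, (mult w : ℝ) * l w = 0 := congrArg Prod.fst hl
  have h2 : ∀ w : {w : InfinitePlace K // w ≠ w₀}, l w.1 = 0 := fun w => by
    have := congrFun (congrArg Prod.snd hl) w
    simp only [logLin, LinearMap.coe_mk, AddHom.coe_mk, h1] at this
    simpa [mult_coe_ne_zero] using this
  ext w
  by_cases hw : w = w₀
  · have h3 : ∑ w, (mult w : ℝ) * l w = mult w * l w := by
      refine Finset.sum_eq_single _ (fun v _ hv => ?_) (by simp)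
      rw [h2 ⟨v, hw ▸ hv⟩, mul_zero]
    rw [h1] at h3
    simpa [mult_coe_ne_zero] using h3.symm
  · exact h2 ⟨w, hw⟩

theorem logLin_log {x : mixedSpace K} (hx : mixedEmbedding.norm x ≠ 0) :
    logLin K (fun w => Real.log (normAtPlace w x)) = (Real.log (mixedEmbedding.norm x), logMap x) := by
  have h1 : ∑ w : InfinitePlace K, (mult w : ℝ) * Real.log (normAtPlace w x) =
      Real.log (mixedEmbedding.norm x) := by
    rw [mixedEmbedding.norm_apply, Real.log_prod]
    · simp [Real.log_pow]
    · intro w _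
      exact pow_ne_zero _ (mixedEmbedding.norm_ne_zero_iff.1 hx w)
  simp only [logLin, LinearMap.coe_mk, AddHom.coe_mk, h1]
  rfl

open scoped Classical in
theorem phi_exists {ι : Type*} [Fintype ι] (B : Basis ι ℝ (logSpace K)) :
    ∃ C0 R : ℝ, 0 ≤ C0 ∧ 0 ≤ R ∧ ∀ (h : ℝ → ℝ) (L : ℝ), 0 ≤ L → (∀ u, 0 ≤ h u) → (∀ u, h u ≤ 1) →
      (∀ u v, |h u - h v| ≤ L * |u - v|) → (∀ u, 3 < |u| → h u = 0) →
      ∃ φ : mixedSpace K → ℝ, (∀ x y, |φ x - φ y| ≤ C0 * (L + 1) * ‖x - y‖) ∧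
        (∀ x, R < ‖x‖ → φ x = 0) ∧ (∀ x, mixedEmbedding.norm x = 0 → φ x = 0) ∧
        (∀ x, mixedEmbedding.norm x ≠ 0 → φ x = h (Real.log (mixedEmbedding.norm x)) *
          ∏ i, tent (B.repr (logMap x) i)) := by

  let T : (InfinitePlace K → ℝ) →ₗ[ℝ] ℝ × (ι → ℝ) :=
    (LinearMap.prodMap LinearMap.id B.equivFun.toLinearMap) ∘ₗ (logLin K)
  have hT : Function.Injective T := by
    have : Function.Injective (LinearMap.prodMap (LinearMap.id : ℝ →ₗ[ℝ] ℝ) B.equivFun.toLinearMap) := by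
      rintro ⟨a, b⟩ ⟨c, d⟩ h
      simpa using h
    exact this.comp logLin_inj
  obtain ⟨k, hk0, hk⟩ := LinearMap.exists_antilipschitzWith T (LinearMap.ker_eq_bot.2 hT)
  have hk' : ∀ l, ‖l‖ ≤ k * ‖T l‖ := fun l => by
    have := hk.le_mul_dist l 0
    simpa using this
  let T' := LinearMap.toContinuousLinearMap T
  have hT' : ∀ l, ‖T l‖ ≤ ‖T'‖ * ‖l‖ := T'.le_opNorm
  have hk0' : (0:ℝ) < k := hk0
  set R : ℝ := 3 * k + 1 with hR
  refine ⟨(1 + Fintype.card ι) * (‖T'‖ * Real.exp R), Real.exp R, by positivity, by positivity, ?_⟩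
  intro h L hL h0 h1 hlip hsupp
  set H : ℝ × (ι → ℝ) → ℝ := fun p => h p.1 * ∏ i, tent (p.2 i) with hH
  have Hsupp : ∀ p, 3 < ‖p‖ → H p = 0 := fun p hp => by
    by_contra hne
    obtain ⟨hne1, hne2⟩ := mul_ne_zero_iff.1 hne
    have a1 : |p.1| ≤ 3 := by
      by_contra hc; exact hne1 (hsupp _ (not_le.1 hc))
    have a2 : ∀ i, |p.2 i| ≤ 3 := fun i => by
      by_contra hc
      exact Finset.prod_ne_zero_iff.1 hne2 i (Finset.mem_univ _) (tent_eq_zero (by linarith))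
    have : ‖p‖ ≤ 3 := by
      rw [Prod.norm_def]
      exact max_le a1 ((pi_norm_le_iff_of_nonneg (by norm_num)).2 a2)
    linarith
  have Hlip : ∀ p q, |H p - H q| ≤ (1 + Fintype.card ι) * (L + 1) * ‖p - q‖ := fun p q => by
    have e : H p - H q = (h p.1 - h q.1) * ∏ i, tent (p.2 i) +
        h q.1 * (∏ i, tent (p.2 i) - ∏ i, tent (q.2 i)) := by simp only [hH]; ring
    have b1 : |p.1 - q.1| ≤ ‖p - q‖ := norm_fst_le (p - q)
    have b2 : ∀ i, |p.2 i - q.2 i| ≤ ‖p - q‖ := fun i =>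
      (norm_le_pi_norm (p - q).2 i).trans (norm_snd_le (p - q))
    have b3 := prod_tent_lip Finset.univ p.2 q.2 _ b2
    have b4 := (hlip p.1 q.1).trans (mul_le_mul_of_nonneg_left b1 hL)
    rw [e]
    refine (abs_add_le _ _).trans ?_
    rw [abs_mul, abs_mul, abs_of_nonneg (prod_tent_nonneg _ _), abs_of_nonneg (h0 _)]
    have c1 := mul_le_mul b4 (prod_tent_le_one Finset.univ p.2) (prod_tent_nonneg _ _)
      (by positivity)
    have c2 := mul_le_mul (h1 q.1) b3 (abs_nonneg _) zero_le_one
    rw [Finset.card_univ] at c2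
    have : 0 ≤ (Fintype.card ι : ℝ) * L * ‖p - q‖ := by positivity
    have := norm_nonneg (p - q)
    nlinarith
  set δ := Real.exp (-R) with hδ
  have hδ0 : 0 < δ := Real.exp_pos _
  set l' : mixedSpace K → InfinitePlace K → ℝ := fun x w => Real.log (max (normAtPlace w x) δ) with hl'
  have hl'R : ∀ x w, -R ≤ l' x w := fun x w => by
    rw [← Real.log_exp (-R)]
    exact Real.log_le_log (Real.exp_pos _) (le_max_right _ _)
  have key : ∀ l : InfinitePlace K → ℝ, H (T l) ≠ 0 → ∀ w, |l w| < R := fun l hl w => by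
    have h3 : ‖T l‖ ≤ 3 := by
      by_contra hc; exact hl (Hsupp _ (not_le.1 hc))
    have := (norm_le_pi_norm l w).trans (hk' l)
    rw [Real.norm_eq_abs] at this
    nlinarith
  have key2 : ∀ x, H (T (l' x)) ≠ 0 → ∀ w, δ < normAtPlace w x ∧ normAtPlace w x < Real.exp R := by
    intro x hx w
    have h3 := key _ hx w
    rw [abs_lt] at h3
    constructor
    · by_contra hc
      have : l' x w = -R := by
        simp only [hl']; rw [max_eq_right (not_lt.1 hc), hδ, Real.log_exp]
      linarith
    · have h4 : max (normAtPlace w x) δ < Real.exp R :=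
        (Real.log_lt_iff_lt_exp (lt_max_of_lt_right hδ0)).1 h3.2
      exact (le_max_left _ _).trans_lt h4
  refine ⟨fun x => H (T (l' x)), fun x y => ?_, fun x hx => ?_, fun x hx => ?_, fun x hx => ?_⟩
  · refine (Hlip _ _).trans ?_
    have a1 : ‖l' x - l' y‖ ≤ Real.exp R * ‖x - y‖ := by
      refine (pi_norm_le_iff_of_nonneg (by positivity)).2 fun w => ?_
      refine (log_max_lip hδ0 _ _).trans ?_
      rw [hδ, Real.exp_neg, inv_inv]
      refine mul_le_mul_of_nonneg_left ?_ (Real.exp_pos _).le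
      have b1 := normAtPlace_add_le w (x - y) y
      have b2 := normAtPlace_add_le w (y - x) x
      rw [sub_add_cancel] at b1 b2
      have b3 : normAtPlace w (y - x) = normAtPlace w (x - y) := by
        rw [← normAtPlace_neg, neg_sub]
      have b4 : normAtPlace w (x - y) ≤ ‖x - y‖ := by
        rw [norm_eq_sup'_normAtPlace]
        exact Finset.le_sup' (fun w => normAtPlace w (x - y)) (Finset.mem_univ w)
      rw [abs_le]; constructor <;> linarith
    rw [← map_sub]
    have a2 := (hT' (l' x - l' y)).trans (mul_le_mul_of_nonneg_left a1 (norm_nonneg _))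
    calc _ ≤ (1 + (Fintype.card ι : ℝ)) * (L + 1) * (‖T'‖ * (Real.exp R * ‖x - y‖)) :=
          mul_le_mul_of_nonneg_left a2 (by positivity)
      _ = _ := by ring
  · by_contra hne
    have h3 := key2 x hne
    have : ‖x‖ ≤ Real.exp R := by
      rw [norm_eq_sup'_normAtPlace]
      exact Finset.sup'_le _ _ fun w _ => (h3 w).2.le
    linarith
  · by_contra hne
    have h3 := key2 x hne
    obtain ⟨w, hw⟩ := mixedEmbedding.norm_eq_zero_iff.1 hx
    have := (h3 w).1
    linarith
  · have e1 : h (Real.log (mixedEmbedding.norm x)) * ∏ i, tent (B.repr (logMap x) i) =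
        H (T (fun w => Real.log (normAtPlace w x))) := by
      simp only [T, LinearMap.comp_apply, logLin_log hx, hH]
      simp
    rw [e1]
    show H (T (l' x)) = _
    by_cases hc : H (T (fun w => Real.log (normAtPlace w x))) = 0
    · by_contra hne
      have h3 := key2 x (by rwa [hc] at hne)
      refine hne ?_
      congr 2
      ext w
      simp only [hl']; rw [max_eq_left (h3 w).1.le]
    · have h3 := key _ hc
      congr 2
      ext w
      simp only [hl']
      rw [max_eq_left]
      have h4 := (abs_lt.1 (h3 w)).1
      have h5 : 0 < normAtPlace w x := lt_of_le_of_ne (normAtPlace_nonneg w x)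
        (mixedEmbedding.norm_ne_zero_iff.1 hx w).symm
      exact ((Real.lt_log_iff_exp_lt h5).1 h4).le

end Phi

section Unfold
open NumberField.Units NumberField.Units.dirichletUnitTheorem Module NumberField.mixedEmbedding
open NumberField.InfinitePlace NumberField.mixedEmbedding.fundamentalCone
open scoped nonZeroDivisors

variable (K : Type*) [Field K] [NumberField K]

open scoped Classical in
/-- the basis of log space -/
def logBasis : Basis (Fin (rank K)) ℝ (logSpace K) := (basisUnitLattice K).ofZLatticeBasis ℝ _

def unitPow (k : Fin (rank K) → ℤ) : (𝓞 K)ˣ := ∏ i, fundSystem K i ^ k i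

theorem logBasis_repr_unitPow (k : Fin (rank K) → ℤ) (i : Fin (rank K)) :
    (logBasis K).repr (logEmbedding K (Additive.ofMul (unitPow K k))) i = k i := by
  have : logEmbedding K (Additive.ofMul (unitPow K k)) = ∑ j, (k j : ℝ) • logBasis K j := by
    rw [unitPow, ofMul_prod, map_sum]
    refine Finset.sum_congr rfl fun j _ => ?_
    rw [ofMul_zpow, map_zsmul, logEmbedding_fundSystem, logBasis, Basis.ofZLatticeBasis_apply]
    exact (Int.cast_smul_eq_zsmul ℝ _ _).symm
  rw [this, map_sum]
  simp [Finsupp.single_apply]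

variable {K}

theorem tent_sum {c : ℝ} (h0 : 0 ≤ c) (h1 : c < 1) :
    ∑ k ∈ ({-1, 0} : Finset ℤ), tent (k + c) = 1 := by
  rw [Finset.sum_pair (by decide)]
  unfold tent
  push_cast
  rw [zero_add, abs_of_nonneg h0, abs_of_nonpos (by linarith), max_eq_right (by linarith),
    max_eq_right (by linarith)]
  ring

theorem tent_tsum {ι : Type*} [Fintype ι] (c : ι → ℝ) (h0 : ∀ i, 0 ≤ c i) (h1 : ∀ i, c i < 1) :
    ∑' k : ι → ℤ, ∏ i, tent (k i + c i) = 1 := by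
  classical
  rw [tsum_eq_sum (s := Fintype.piFinset fun _ => ({-1, 0} : Finset ℤ))]
  · rw [← Finset.prod_univ_sum (t := fun _ => ({-1, 0} : Finset ℤ))
      (f := fun i k => tent ((k : ℤ) + c i))]
    exact Finset.prod_eq_one fun i _ => tent_sum (h0 i) (h1 i)
  · intro k hk
    rw [Fintype.mem_piFinset, not_forall] at hk
    obtain ⟨i, hi⟩ := hk
    refine Finset.prod_eq_zero (Finset.mem_univ i) (tent_eq_zero ?_)
    simp only [Finset.mem_insert, Finset.mem_singleton, not_or] at hi
    have a1 := h0 i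
    have a2 := h1 i
    have : k i ≤ -2 ∨ 1 ≤ k i := by omega
    rcases this with h | h
    · have : (k i : ℝ) ≤ -2 := by exact_mod_cast h
      rw [abs_of_nonpos (by linarith)]; linarith
    · have : (1:ℝ) ≤ k i := by exact_mod_cast h
      rw [abs_of_nonneg (by linarith)]; linarith

open scoped Classical in
theorem unfold_sum (J : (Ideal (𝓞 K))⁰) (h : ℝ → ℝ) (φ : mixedSpace K → ℝ) (R : ℝ)
    (hR : ∀ x, R < ‖x‖ → φ x = 0) (hφ0 : ∀ x, mixedEmbedding.norm x = 0 → φ x = 0)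
    (hφ : ∀ x, mixedEmbedding.norm x ≠ 0 → φ x = h (Real.log (mixedEmbedding.norm x)) *
          ∏ i, tent ((logBasis K).repr (logMap x) i)) (t : ℝ) (ht : 0 < t) :
    ∑' l : Submodule.span ℤ (Set.range (fractionalIdealLatticeBasis K (FractionalIdeal.mk0 K J))),
      φ (t⁻¹ • (l : mixedSpace K)) =
    ∑' a : idealSet K J, h (Real.log (mixedEmbedding.norm (a : mixedSpace K) / t ^ finrank ℚ K)) := by
  set Λ := Submodule.span ℤ (Set.range (fractionalIdealLatticeBasis K (FractionalIdeal.mk0 K J)))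
    with hΛ
  have hmem : ∀ x : mixedSpace K, x ∈ Λ ↔ ∃ a : 𝓞 K, a ∈ (J : Ideal (𝓞 K)) ∧
      mixedEmbedding K (a : K) = x := by
    intro x
    rw [hΛ, mem_span_fractionalIdealLatticeBasis]
    simp only [FractionalIdeal.coe_mk0, Set.mem_image]
    constructor
    · rintro ⟨y, hy, rfl⟩
      have hy' : y ∈ (((J : Ideal (𝓞 K)) : FractionalIdeal (𝓞 K)⁰ K)) := hy
      rw [FractionalIdeal.mem_coeIdeal] at hy'
      obtain ⟨a, ha, rfl⟩ := hy'
      exact ⟨a, ha, rfl⟩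
    · rintro ⟨a, ha, rfl⟩
      refine ⟨_, ?_, rfl⟩
      show (a : K) ∈ (((J : Ideal (𝓞 K)) : FractionalIdeal (𝓞 K)⁰ K))
      rw [FractionalIdeal.mem_coeIdeal]
      exact ⟨a, ha, rfl⟩
  have hsm : ∀ (u : (𝓞 K)ˣ) (x : mixedSpace K), x ∈ Λ → u • x ∈ Λ := by
    intro u x hx
    rw [hmem] at hx ⊢
    obtain ⟨a, ha, rfl⟩ := hx
    refine ⟨u * a, Ideal.mul_mem_left _ _ ha, ?_⟩
    rw [unitSMul_smul, ← map_mul]; rfl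
  have hsub : ∀ a : idealSet K J, (a : mixedSpace K) ∈ Λ := fun a => (hmem _).2 (mem_idealSet.1 a.2).2
  let g : idealSet K J × (Fin (rank K) → ℤ) → Λ := fun p => ⟨unitPow K p.2 • p.1.1, hsm _ _ (hsub _)⟩
  have hgnorm : ∀ p, mixedEmbedding.norm (g p : mixedSpace K) = mixedEmbedding.norm p.1.1 :=
    fun p => norm_unit_smul _ _
  have hnz : ∀ a : idealSet K J, mixedEmbedding.norm (a : mixedSpace K) ≠ 0 :=
    fun a => (norm_pos_of_mem a.2.1).ne'
  have hlogg : ∀ p i, (logBasis K).repr (logMap (g p : mixedSpace K)) i =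
      p.2 i + (logBasis K).repr (logMap (p.1 : mixedSpace K)) i := by
    intro p i
    show (logBasis K).repr (logMap (unitPow K p.2 • (p.1 : mixedSpace K))) i = _
    rw [logMap_unit_smul _ (hnz _), map_add, Finsupp.add_apply, logBasis_repr_unitPow]
  have hfd : ∀ a : idealSet K J, ∀ i, 0 ≤ (logBasis K).repr (logMap (a : mixedSpace K)) i ∧
      (logBasis K).repr (logMap (a : mixedSpace K)) i < 1 := by
    intro a i
    have := (ZSpan.mem_fundamentalDomain _).1 a.2.1.1 i
    exact this
  have hinj : Function.Injective g := by
    rintro ⟨a, k⟩ ⟨b, l⟩ hab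
    have hk : k = l := by
      ext i
      have h1 := hlogg (a, k) i
      have h2 := hlogg (b, l) i
      rw [hab, h2] at h1
      have f1 := hfd a i
      have f2 := hfd b i
      simp only at h1
      have c1 : (k i : ℝ) < l i + 1 := by linarith
      have c2 : (l i : ℝ) < k i + 1 := by linarith
      have c1' : k i < l i + 1 := by exact_mod_cast c1
      have c2' : l i < k i + 1 := by exact_mod_cast c2
      omega
    subst hk
    have : unitPow K k • (a : mixedSpace K) = unitPow K k • (b : mixedSpace K) :=
      congrArg Subtype.val hab
    have := MulAction.injective (unitPow K k) this
    rw [Subtype.ext this]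
  have hrange : ∀ l : Λ, mixedEmbedding.norm (l : mixedSpace K) ≠ 0 → l ∈ Set.range g := by
    intro l hl
    obtain ⟨u, hu⟩ := exists_unit_smul_mem hl
    obtain ⟨⟨ζ, e⟩, he, -⟩ := exist_unique_eq_mul_prod K u⁻¹
    have ha : u • (l : mixedSpace K) ∈ idealSet K J :=
      mem_idealSet.2 ⟨hu, (hmem _).1 (hsm u _ l.2)⟩
    have hb : (ζ : (𝓞 K)ˣ) • u • (l : mixedSpace K) ∈ idealSet K J :=
      mem_idealSet.2 ⟨torsion_smul_mem_of_mem hu ζ.2, (hmem _).1 (hsm _ _ (hsm u _ l.2))⟩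
    refine ⟨(⟨_, hb⟩, e), ?_⟩
    apply Subtype.ext
    show unitPow K e • ((ζ : (𝓞 K)ˣ) • u • (l : mixedSpace K)) = l
    rw [← mul_smul, mul_comm, ← mul_smul]
    have : (ζ : (𝓞 K)ˣ) * unitPow K e * u = 1 := by
      have he' : u⁻¹ = (ζ : (𝓞 K)ˣ) * unitPow K e := he
      rw [← he', inv_mul_cancel]
    rw [this, one_smul]
  have htn : t⁻¹ ≠ 0 := inv_ne_zero ht.ne'
  have hnorm : ∀ x : mixedSpace K, mixedEmbedding.norm (t⁻¹ • x) =
      mixedEmbedding.norm x / t ^ finrank ℚ K := by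
    intro x
    rw [mixedEmbedding.norm_smul, abs_of_pos (inv_pos.2 ht), inv_pow, div_eq_inv_mul]
  have hnorm0 : ∀ x : mixedSpace K, mixedEmbedding.norm (t⁻¹ • x) = 0 ↔ mixedEmbedding.norm x = 0 := by
    intro x
    rw [hnorm, div_eq_zero_iff]
    simp [ht.ne']
  have hfin : {l : Λ | φ (t⁻¹ • (l : mixedSpace K)) ≠ 0}.Finite := by
    have h := ZSpan.setFinite_inter (fractionalIdealLatticeBasis K (FractionalIdeal.mk0 K J))
      (s := Metric.closedBall (0 : mixedSpace K) (R * t)) Metric.isBounded_closedBall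
    refine Set.Finite.of_finite_image (f := Subtype.val) (h.subset ?_) Subtype.val_injective.injOn
    rintro _ ⟨l, hl, rfl⟩
    refine ⟨?_, l.2⟩
    have : ‖t⁻¹ • (l : mixedSpace K)‖ ≤ R := by
      by_contra hc; exact hl (hR _ (not_le.1 hc))
    rw [_root_.norm_smul, norm_inv, Real.norm_of_nonneg ht.le, inv_mul_eq_div, div_le_iff₀ ht] at this
    simpa using this
  have e1 : ∑' l : Λ, φ (t⁻¹ • (l : mixedSpace K)) = ∑' p, φ (t⁻¹ • (g p : mixedSpace K)) := by
    symm
    refine hinj.tsum_eq (f := fun l : Λ => φ (t⁻¹ • (l : mixedSpace K))) ?_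
    intro l hl
    refine hrange l fun h0 => hl (hφ0 _ ((hnorm0 _).2 h0))
  have hsum : Summable fun p => φ (t⁻¹ • (g p : mixedSpace K)) := by
    refine summable_of_hasFiniteSupport ?_
    exact (hfin.preimage hinj.injOn)
  rw [e1, hsum.tsum_prod]
  refine tsum_congr fun a => ?_
  have e2 : ∀ k, φ (t⁻¹ • (g (a, k) : mixedSpace K)) =
      h (Real.log (mixedEmbedding.norm (a : mixedSpace K) / t ^ finrank ℚ K)) *
        ∏ i, tent (k i + (logBasis K).repr (logMap (a : mixedSpace K)) i) := by
    intro k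
    have hg0 : mixedEmbedding.norm (g (a, k) : mixedSpace K) ≠ 0 := by
      rw [hgnorm]; exact hnz a
    rw [hφ _ (by rw [Ne, hnorm0]; exact hg0), hnorm, hgnorm, logMap_real_smul hg0 htn]
    simp_rw [hlogg]
  simp_rw [e2]
  rw [tsum_mul_left, tent_tsum _ (fun i => (hfd a i).1) (fun i => (hfd a i).2), mul_one]

end Unfold

section PowerSaving
open Topology

theorem telescoping {D : ℝ → ℝ} {C κ θ : ℝ} (hθ : 0 < θ) (hC : 0 ≤ C)
    (h1 : ∀ s, 0 < s → s < 1 → |D s| ≤ κ)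
    (h2 : ∀ s, 1 ≤ s → |D s - D (s * Real.exp (-1))| ≤ C * s ^ θ) (s : ℝ) (hs : 0 < s) :
    |D s| ≤ κ + C / (1 - Real.exp (-θ)) * s ^ θ := by
  have hq : Real.exp (-θ) < 1 := by rw [Real.exp_lt_one_iff]; linarith
  have hq' : 0 < 1 - Real.exp (-θ) := by linarith
  have key : ∀ m : ℕ, ∀ s, 0 < s → s < Real.exp m → |D s| ≤ κ + C / (1 - Real.exp (-θ)) * s ^ θ := by
    intro m
    induction m with
    | zero =>
      intro s hs hs1
      have := h1 s hs (by simpa using hs1)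
      have : 0 ≤ C / (1 - Real.exp (-θ)) * s ^ θ := by positivity
      linarith
    | succ m ih =>
      intro s hs hsm
      by_cases hs1 : s < 1
      · have := h1 s hs hs1
        have : 0 ≤ C / (1 - Real.exp (-θ)) * s ^ θ := by positivity
        linarith
      have a1 := ih (s * Real.exp (-1)) (by positivity) (by
        push_cast at hsm
        rw [Real.exp_neg, ← div_eq_mul_inv, div_lt_iff₀ (Real.exp_pos _), ← Real.exp_add]
        exact hsm)
      have a2 := h2 s (not_lt.1 hs1)
      rw [Real.mul_rpow hs.le (Real.exp_pos _).le, ← Real.exp_mul, neg_one_mul] at a1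
      have a3 : |D s| ≤ |D s - D (s * Real.exp (-1))| + |D (s * Real.exp (-1))| := by
        simpa using abs_add_le (D s - D (s * Real.exp (-1))) (D (s * Real.exp (-1)))
      have a4 : C / (1 - Real.exp (-θ)) * s ^ θ =
          C / (1 - Real.exp (-θ)) * (s ^ θ * Real.exp (-θ)) + C * s ^ θ := by
        field_simp; ring
      linarith
  obtain ⟨m, hm⟩ := exists_nat_gt (Real.log s)
  exact key m s hs ((Real.log_lt_iff_lt_exp hs).1 hm)

/-- trapezoid -/
def trap (c ε u : ℝ) : ℝ := max 0 (min 1 (c + min (-u) (u + 1) / ε))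

theorem trap_lip {c ε : ℝ} (hε : 0 < ε) (u v : ℝ) : |trap c ε u - trap c ε v| ≤ 1 / ε * |u - v| := by
  unfold trap
  have h1 : |min (-u) (u + 1) - min (-v) (v + 1)| ≤ |u - v| := by
    refine (abs_min_sub_min_le_max _ _ _ _).trans (max_le ?_ ?_)
    · rw [show -u - -v = -(u - v) by ring, abs_neg]
    · rw [show u + 1 - (v + 1) = u - v by ring]
  have h2 := abs_max_sub_max_le_max 0 (min 1 (c + min (-u) (u + 1) / ε)) 0 (min 1 (c + min (-v) (v + 1) / ε))
  have h3 := abs_min_sub_min_le_max 1 (c + min (-u) (u + 1) / ε) 1 (c + min (-v) (v + 1) / ε)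
  rw [sub_self, abs_zero] at h2 h3
  refine h2.trans (max_le (by positivity) (h3.trans (max_le (by positivity) ?_)))
  rw [add_sub_add_left_eq_sub, ← sub_div, abs_div, abs_of_pos hε, div_mul_eq_mul_div, one_mul]
  exact div_le_div_of_nonneg_right h1 hε.le

theorem trap_nonneg (c ε u : ℝ) : 0 ≤ trap c ε u := le_max_left _ _
theorem trap_le_one (c ε u : ℝ) : trap c ε u ≤ 1 := max_le zero_le_one (min_le_left _ _)
theorem trap_ne_zero {c ε u : ℝ} (hε : 0 < ε) (h : trap c ε u ≠ 0) : -(c * ε) < min (-u) (u + 1) := by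
  by_contra hc
  apply h
  have : min (-u) (u + 1) / ε ≤ -c := by
    rw [div_le_iff₀ hε]; linarith
  refine max_eq_left ((min_le_right _ _).trans (by linarith))
theorem trap_eq_one {c ε u : ℝ} (hε : 0 < ε) (h : (1 - c) * ε ≤ min (-u) (u + 1)) : trap c ε u = 1 := by
  have : 1 - c ≤ min (-u) (u + 1) / ε := by
    rwa [le_div_iff₀ hε]
  unfold trap
  rw [min_eq_left (by linarith), max_eq_right zero_le_one]

theorem exp_le_lin {ε : ℝ} (h0 : 0 ≤ ε) (h1 : ε ≤ 1) : Real.exp ε ≤ 1 + 3 * ε := by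
  have h := Real.exp_bound' h0 h1 (n := 1) (by norm_num)
  simp at h
  linarith

set_option maxHeartbeats 1000000 in
theorem count_saving {X : Type*} (ν : X → ℝ) (hν : ∀ a, 1 ≤ ν a)
    (hfin : ∀ s, {a | ν a ≤ s}.Finite) (κ θ C : ℝ) (hC : 0 ≤ C)
    (hκ : Tendsto (fun s : ℝ => ((Nat.card {a // ν a ≤ s} : ℕ) : ℝ) / s) atTop (𝓝 κ))
    (hθ : 0 < θ) (hθ1 : θ ≤ 1)
    (H : ∀ (h : ℝ → ℝ) (L : ℝ), 0 ≤ L → (∀ u, 0 ≤ h u) → (∀ u, h u ≤ 1) →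
      (∀ u v, |h u - h v| ≤ L * |u - v|) → (∀ u, 3 < |u| → h u = 0) →
      ∃ I : ℝ, ∀ s : ℝ, 1 ≤ s → |(∑' a, h (Real.log (ν a / s))) - I * s| ≤ C * (L + 1) * s ^ (1 - θ)) :
    ∃ C' : ℝ, ∀ s, 1 ≤ s → |((Nat.card {a // ν a ≤ s} : ℕ) : ℝ) - κ * s| ≤ C' * s ^ (1 - θ / 2) := by
  classical
  set F : ℝ → Finset X := fun s => (hfin s).toFinset with hF
  have memF : ∀ s a, a ∈ F s ↔ ν a ≤ s := fun s a => by simp [hF]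
  set P : ℝ → ℝ := fun s => (F s).card with hP
  have hcard : ∀ s, ((Nat.card {a // ν a ≤ s} : ℕ) : ℝ) = P s := fun s => by
    have : Nat.card {a // ν a ≤ s} = (F s).card := Nat.subtype_card _ (fun a => memF s a)
    rw [this]
  simp_rw [hcard] at hκ ⊢
  have hκ0 : 0 ≤ κ := by
    refine ge_of_tendsto hκ ?_
    filter_upwards [eventually_ge_atTop 0] with s hs
    exact div_nonneg (Nat.cast_nonneg _) hs
  have hP0 : ∀ s, s < 1 → P s = 0 := fun s hs => by
    have : F s = ∅ := by
      ext a; simp only [memF, Finset.notMem_empty, iff_false, not_le]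
      linarith [hν a]
    simp [hP, this]
  have upper : ∀ (h : ℝ → ℝ) (s α β : ℝ), 0 < s → (∀ u, h u ≤ 1) → α ≤ β →
      (∀ u, h u ≠ 0 → Real.exp u ≤ β ∧ α < Real.exp u) →
      ∑' a, h (Real.log (ν a / s)) ≤ P (β * s) - P (α * s) := by
    intro h s α β hs h1 hαβ hh
    have hsub : F (α * s) ⊆ F (β * s) := fun a ha => by
      rw [memF] at ha ⊢
      exact ha.trans (mul_le_mul_of_nonneg_right hαβ hs.le)
    rw [tsum_eq_sum (s := F (β * s) \ F (α * s))]
    · refine (Finset.sum_le_card_nsmul _ _ 1 fun a _ => h1 _).trans ?_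
      rw [Finset.card_sdiff_of_subset hsub, nsmul_eq_mul, mul_one,
        Nat.cast_sub (Finset.card_le_card hsub)]
    · intro a ha
      by_contra hne
      have h3 := hh _ hne
      have hpos : 0 < ν a / s := div_pos (by linarith [hν a]) hs
      rw [Real.exp_log hpos, div_le_iff₀ hs, lt_div_iff₀ hs] at h3
      apply ha
      rw [Finset.mem_sdiff, memF, memF]
      exact ⟨h3.1, not_le.2 h3.2⟩
  have lower : ∀ (h : ℝ → ℝ) (s α β : ℝ), 0 < s → (∀ u, 0 ≤ h u) → (∀ u, 3 < |u| → h u = 0) →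
      (∀ u, Real.exp u ≤ β → α < Real.exp u → h u = 1) →
      P (β * s) - P (α * s) ≤ ∑' a, h (Real.log (ν a / s)) := by
    intro h s α β hs h0 hsupp hh
    have hsum : Summable fun a => h (Real.log (ν a / s)) := by
      refine summable_of_hasFiniteSupport ((hfin (Real.exp 3 * s)).subset ?_)
      intro a ha
      have hpos : 0 < ν a / s := div_pos (by linarith [hν a]) hs
      have : |Real.log (ν a / s)| ≤ 3 := by
        by_contra hc; exact ha (hsupp _ (not_le.1 hc))
      have := (Real.log_le_iff_le_exp hpos).1 (abs_le.1 this).2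
      rwa [div_le_iff₀ hs] at this
    have h3 := hsum.sum_le_tsum (F (β * s) \ F (α * s)) fun a _ => h0 _
    refine le_trans ?_ h3
    have h4 : ∑ a ∈ F (β * s) \ F (α * s), h (Real.log (ν a / s)) = (F (β * s) \ F (α * s)).card := by
      rw [Finset.sum_congr rfl (g := fun _ => (1:ℝ))]
      · simp
      · intro a ha
        rw [Finset.mem_sdiff, memF, memF, not_le] at ha
        have hpos : 0 < ν a / s := div_pos (by linarith [hν a]) hs
        apply hh
        · rw [Real.exp_log hpos, div_le_iff₀ hs]; exact ha.1
        · rw [Real.exp_log hpos, lt_div_iff₀ hs]; exact ha.2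
    rw [h4, sub_le_iff_le_add]
    have := Finset.card_le_card_sdiff_add_card (s := F (β * s)) (t := F (α * s))
    simp only [hP]
    exact_mod_cast this
  have limP : ∀ α, 0 < α → Tendsto (fun s => P (α * s) / s) atTop (𝓝 (κ * α)) := by
    intro α hα
    have := (hκ.comp (tendsto_id.const_mul_atTop hα)).mul_const α
    refine this.congr' ?_
    filter_upwards [eventually_gt_atTop 0] with s hs
    simp only [Function.comp, id]
    field_simp
  have limI : ∀ (h : ℝ → ℝ) (I L : ℝ), (∀ s : ℝ, 1 ≤ s →
      |(∑' a, h (Real.log (ν a / s))) - I * s| ≤ C * (L + 1) * s ^ (1 - θ)) →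
      Tendsto (fun s => (∑' a, h (Real.log (ν a / s))) / s) atTop (𝓝 I) := by
    intro h I L hI
    rw [tendsto_iff_norm_sub_tendsto_zero]
    have h5 : Tendsto (fun s : ℝ => C * (L + 1) * s ^ (-θ)) atTop (𝓝 0) := by
      simpa using (tendsto_rpow_neg_atTop hθ).const_mul (C * (L + 1))
    refine squeeze_zero' (Eventually.of_forall fun _ => norm_nonneg _) ?_ h5
    filter_upwards [eventually_ge_atTop 1] with s hs
    have hs0 : 0 < s := by linarith
    have e : (∑' a, h (Real.log (ν a / s))) / s - I = ((∑' a, h (Real.log (ν a / s))) - I * s) / s := by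
      field_simp
    rw [e, Real.norm_eq_abs, abs_div, abs_of_pos hs0, div_le_iff₀ hs0]
    refine (hI s hs).trans (le_of_eq ?_)
    rw [mul_assoc _ _ s, ← Real.rpow_add_one hs0.ne', neg_add_eq_sub]
  set e := Real.exp (-1) with he
  have he0 : 0 < e := Real.exp_pos _
  have he1 : e < 1 := by rw [he, Real.exp_lt_one_iff]; norm_num
  -- window estimate
  have window : ∀ s, 1 ≤ s → |P s - P (s * e) - κ * (1 - e) * s| ≤
      (C * 2 + 6 * κ) * s ^ (1 - θ / 2) := by
    intro s hs
    have hs0 : 0 < s := by linarith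
    set ε := s ^ (-(θ / 2)) with hεd
    have hε0 : 0 < ε := Real.rpow_pos_of_pos hs0 _
    have hε1 : ε ≤ 1 := Real.rpow_le_one_of_one_le_of_nonpos hs (by linarith)
    have hL : 0 ≤ 1 / ε := by positivity
    have supp3 : ∀ c, c ≤ 1 → 0 ≤ c → ∀ u, 3 < |u| → trap c ε u = 0 := by
      intro c hc hc0 u hu
      by_contra hne
      have h6 := trap_ne_zero hε0 hne
      rw [lt_min_iff] at h6
      rw [lt_abs] at hu
      have : c * ε ≤ 1 := by nlinarith
      rcases hu with hu | hu <;> linarith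
    obtain ⟨I0, hI0⟩ := H (trap 0 ε) (1 / ε) hL (trap_nonneg _ _) (trap_le_one _ _) (trap_lip hε0)
      (supp3 0 zero_le_one le_rfl)
    obtain ⟨I1, hI1⟩ := H (trap 1 ε) (1 / ε) hL (trap_nonneg _ _) (trap_le_one _ _) (trap_lip hε0)
      (supp3 1 le_rfl zero_le_one)
    -- sandwich
    have s1 : ∑' a, trap 0 ε (Real.log (ν a / s)) ≤ P (1 * s) - P (e * s) := by
      refine upper _ s e 1 hs0 (trap_le_one _ _) he1.le fun u hu => ?_
      have h6 := trap_ne_zero hε0 hu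
      rw [lt_min_iff] at h6
      refine ⟨Real.exp_le_one_iff.2 (by linarith), Real.exp_lt_exp.2 (by linarith)⟩
    have s2 : P (1 * s) - P (e * s) ≤ ∑' a, trap 1 ε (Real.log (ν a / s)) := by
      refine lower _ s e 1 hs0 (trap_nonneg _ _) (supp3 1 le_rfl zero_le_one) fun u hu1 hu2 => ?_
      have h7 := Real.exp_le_one_iff.1 hu1
      have h8 := Real.exp_lt_exp.1 hu2
      refine trap_eq_one hε0 (le_min ?_ ?_) <;> linarith
    have b1 : I1 ≤ κ * Real.exp ε - κ * Real.exp (-1 - ε) := by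
      refine le_of_tendsto_of_tendsto (limI _ _ _ hI1)
        ((limP _ (Real.exp_pos ε)).sub (limP _ (Real.exp_pos (-1 - ε)))) ?_
      filter_upwards [eventually_gt_atTop 0] with x hx
      rw [← sub_div]
      refine div_le_div_of_nonneg_right ?_ hx.le
      refine upper _ x _ _ hx (trap_le_one _ _) (Real.exp_le_exp.2 (by linarith)) fun u hu => ?_
      have h6 := trap_ne_zero hε0 hu
      rw [lt_min_iff] at h6
      refine ⟨Real.exp_le_exp.2 (by linarith), Real.exp_lt_exp.2 (by linarith)⟩
    have b0 : κ * Real.exp (-ε) - κ * Real.exp (-1 + ε) ≤ I0 := by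
      refine le_of_tendsto_of_tendsto
        ((limP _ (Real.exp_pos (-ε))).sub (limP _ (Real.exp_pos (-1 + ε)))) (limI _ _ _ hI0) ?_
      filter_upwards [eventually_gt_atTop 0] with x hx
      rw [← sub_div]
      refine div_le_div_of_nonneg_right ?_ hx.le
      refine lower _ x _ _ hx (trap_nonneg _ _) (supp3 0 zero_le_one le_rfl) fun u hu1 hu2 => ?_
      have h7 := Real.exp_le_exp.1 hu1
      have h8 := Real.exp_lt_exp.1 hu2
      refine trap_eq_one hε0 (le_min ?_ ?_) <;> linarith
    have x1 := exp_le_lin hε0.le hε1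
    have x2 : 1 - ε ≤ Real.exp (-ε) := by linarith [Real.add_one_le_exp (-ε)]
    have x3 : Real.exp (-1 - ε) = e * Real.exp (-ε) := by rw [he, ← Real.exp_add]; ring_nf
    have x4 : Real.exp (-1 + ε) = e * Real.exp ε := by rw [he, ← Real.exp_add]
    rw [x3] at b1
    rw [x4] at b0
    have b1' : I1 ≤ κ * (1 - e) + 6 * κ * ε := by
      have y1 : κ * Real.exp ε ≤ κ * (1 + 3 * ε) := mul_le_mul_of_nonneg_left x1 hκ0
      have y2 : κ * (e * (1 - ε)) ≤ κ * (e * Real.exp (-ε)) :=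
        mul_le_mul_of_nonneg_left (mul_le_mul_of_nonneg_left x2 he0.le) hκ0
      have y3 : κ * ε * e ≤ κ * ε * 1 := mul_le_mul_of_nonneg_left he1.le (by positivity)
      nlinarith
    have b0' : κ * (1 - e) - 6 * κ * ε ≤ I0 := by
      have y1 : κ * (e * Real.exp ε) ≤ κ * (e * (1 + 3 * ε)) :=
        mul_le_mul_of_nonneg_left (mul_le_mul_of_nonneg_left x1 he0.le) hκ0
      have y2 : κ * (1 - ε) ≤ κ * (Real.exp (-ε)) := mul_le_mul_of_nonneg_left x2 hκ0
      have y3 : κ * ε * e ≤ κ * ε * 1 := mul_le_mul_of_nonneg_left he1.le (by positivity)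
      nlinarith
    have z0 := abs_le.1 (hI0 s hs)
    have z1 := abs_le.1 (hI1 s hs)
    have hεs : ε * s = s ^ (1 - θ / 2) := by
      rw [hεd, ← Real.rpow_add_one hs0.ne']; ring_nf
    have hes : 1 / ε * s ^ (1 - θ) = s ^ (1 - θ / 2) := by
      rw [hεd, one_div, ← Real.rpow_neg hs0.le, ← Real.rpow_add hs0]; ring_nf
    have hes2 : s ^ (1 - θ) ≤ s ^ (1 - θ / 2) :=
      Real.rpow_le_rpow_of_exponent_le hs (by linarith)
    have zz : C * (1 / ε + 1) * s ^ (1 - θ) ≤ C * 2 * s ^ (1 - θ / 2) := by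
      have : C * (1 / ε + 1) * s ^ (1 - θ) = C * (1 / ε * s ^ (1 - θ)) + C * s ^ (1 - θ) := by ring
      rw [this, hes]
      nlinarith
    rw [one_mul, mul_comm e s] at s1 s2
    have w1 : I1 * s ≤ κ * (1 - e) * s + 6 * κ * (ε * s) := by nlinarith
    have w0 : κ * (1 - e) * s - 6 * κ * (ε * s) ≤ I0 * s := by nlinarith
    rw [hεs] at w1 w0
    set Y := s ^ (1 - θ / 2)
    clear_value P Y
    rw [abs_le, add_mul]
    constructor <;> linarith [z0.1, z1.2, w1, w0, zz, s1, s2]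
  have htel := telescoping (D := fun s => P s - κ * s) (C := C * 2 + 6 * κ) (κ := κ) (θ := 1 - θ / 2)
    (by linarith) (by positivity) (fun s hs0 hs1 => by
      rw [hP0 s hs1, zero_sub, abs_neg, abs_of_nonneg (by positivity)]
      nlinarith) (fun s hs => by
      have := window s hs
      rwa [show P s - κ * s - (P (s * e) - κ * (s * e)) = P s - P (s * e) - κ * (1 - e) * s by ring])
  refine ⟨κ + (C * 2 + 6 * κ) / (1 - Real.exp (-(1 - θ / 2))), fun s hs => ?_⟩
  refine (htel s (by linarith)).trans ?_
  have : 1 ≤ s ^ (1 - θ / 2) := Real.one_le_rpow hs (by linarith)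
  nlinarith

end PowerSaving

section IdealCount
open NumberField.Units NumberField.Units.dirichletUnitTheorem Module NumberField.mixedEmbedding
open NumberField.InfinitePlace NumberField.mixedEmbedding.fundamentalCone
open scoped nonZeroDivisors Topology

variable {K}

theorem class_count_eq {C : ClassGroup (𝓞 K)} {J : (Ideal (𝓞 K))⁰} (s : ℝ)
    (hJ : ClassGroup.mk0 J = C⁻¹) :
    Nat.card {I : (Ideal (𝓞 K))⁰ // absNorm (I : Ideal (𝓞 K)) ≤ s ∧ ClassGroup.mk0 I = C}
      = Nat.card {I : (Ideal (𝓞 K))⁰ // (J : Ideal (𝓞 K)) ∣ I ∧ Submodule.IsPrincipal (I : Ideal (𝓞 K)) ∧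
        absNorm (I : Ideal (𝓞 K)) ≤ s * absNorm (J : Ideal (𝓞 K))} := by
  simp_rw [← nonZeroDivisors_dvd_iff_dvd_coe]
  refine Nat.card_congr ?_
  refine ((Equiv.dvd J).subtypeEquiv fun I ↦ ?_).trans
    (Equiv.subtypeSubtypeEquivSubtypeInter (fun I : (Ideal (𝓞 K))⁰ ↦ J ∣ I) _)
  rw [← ClassGroup.mk0_eq_one_iff (SetLike.coe_mem _)]
  simp_rw [Equiv.dvd_apply, Submonoid.coe_mul, ← Submonoid.mul_def, _root_.map_mul, hJ,
    inv_mul_eq_one, Nat.cast_mul, mul_comm s, eq_comm, and_comm, and_congr_left_iff]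
  exact fun _ ↦
    (mul_le_mul_iff_of_pos_left (Nat.cast_pos.mpr (absNorm_pos_of_nonZeroDivisors J))).symm

open scoped Classical in
theorem idealSet_saving (J : (Ideal (𝓞 K))⁰) (κ : ℝ)
    (hκ : Tendsto (fun s : ℝ => ((Nat.card {a : idealSet K J //
      mixedEmbedding.norm (a : mixedSpace K) ≤ s} : ℕ) : ℝ) / s) atTop (𝓝 κ)) :
    ∃ C' : ℝ, ∀ s, 1 ≤ s → |((Nat.card {a : idealSet K J //
      mixedEmbedding.norm (a : mixedSpace K) ≤ s} : ℕ) : ℝ) - κ * s| ≤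
        C' * s ^ (1 - (1 / (finrank ℚ K : ℝ)) / 2) := by
  have hn : 0 < finrank ℚ K := finrank_pos
  have hn' : (0:ℝ) < finrank ℚ K := by exact_mod_cast hn
  have hn1 : (1:ℝ) ≤ finrank ℚ K := by exact_mod_cast hn
  obtain ⟨C0, R, hC0, hR, hphi⟩ := phi_exists (logBasis K)
  obtain ⟨C1, hC1, hlat⟩ := lattice_sum (fractionalIdealLatticeBasis K (FractionalIdeal.mk0 K J))
    (MeasureTheory.volume : MeasureTheory.Measure (mixedSpace K)) R hR
  refine count_saving (fun a : idealSet K J => mixedEmbedding.norm (a : mixedSpace K)) ?_ ?_ κ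
    (1 / (finrank ℚ K : ℝ)) (C1 * C0) (by positivity) hκ (by positivity) ?_ ?_
  · intro a
    have h1 := norm_pos_of_mem a.2.1
    show 1 ≤ mixedEmbedding.norm (a : mixedSpace K)
    rw [← intNorm_idealSetEquiv_apply] at h1 ⊢
    exact_mod_cast h1
  · intro s
    have : {a : idealSet K J | mixedEmbedding.norm (a : mixedSpace K) ≤ s} ⊆
        ⋃ m ∈ Finset.range (⌊s⌋₊ + 1), {a : idealSet K J | mixedEmbedding.norm (a : mixedSpace K) = m} := by
      intro a ha
      simp only [Set.mem_iUnion, Finset.mem_range]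
      refine ⟨intNorm (idealSetEquiv K J a).1, ?_, (intNorm_idealSetEquiv_apply a).symm⟩
      rw [Nat.lt_succ_iff]
      apply Nat.le_floor
      rw [intNorm_idealSetEquiv_apply]; exact ha
    refine Set.Finite.subset (Set.Finite.biUnion (Finset.finite_toSet _) fun m _ => ?_) this
    have hf : Finite {I : (Ideal (𝓞 K))⁰ // (J : Ideal (𝓞 K)) ∣ I ∧ Submodule.IsPrincipal (I : Ideal (𝓞 K)) ∧
        absNorm (I : Ideal (𝓞 K)) = m} := by
      have hs := Ideal.finite_setOfPred_absNorm_le₀ (S := 𝓞 K) m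
      exact Set.Finite.to_subtype (s := {I : (Ideal (𝓞 K))⁰ | (J : Ideal (𝓞 K)) ∣ I ∧
        Submodule.IsPrincipal (I : Ideal (𝓞 K)) ∧ absNorm (I : Ideal (𝓞 K)) = m})
        (Set.Finite.subset hs fun I hI => hI.2.2.le)
    exact (Finite.of_equiv _ (idealSetEquivNorm K J m).symm)
  · rw [div_le_one hn']; exact hn1
  · intro h L hL h0 h1 hlip hsupp
    obtain ⟨φ, hφl, hφR, hφ0, hφ⟩ := hphi h L hL h0 h1 hlip hsupp
    obtain ⟨I, hI⟩ := hlat φ (C0 * (L + 1)) (by positivity) hφl hφR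
    refine ⟨I, fun s hs => ?_⟩
    have hs0 : 0 < s := by linarith
    set t := s ^ (1 / (finrank ℚ K : ℝ)) with ht
    have htn : t ^ finrank ℚ K = s := by
      rw [ht, ← Real.rpow_natCast, ← Real.rpow_mul hs0.le, one_div_mul_cancel hn'.ne', Real.rpow_one]
    have ht1 : 1 ≤ t := Real.one_le_rpow hs (by positivity)
    have h3 := hI t ht1
    rw [unfold_sum J h φ R hφR hφ0 hφ t (by linarith), mixedEmbedding.finrank, htn] at h3
    refine h3.trans (le_of_eq ?_)
    rw [Real.rpow_sub hs0, Real.rpow_one]; ring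

theorem class_saving (C : ClassGroup (𝓞 K)) :
    ∃ C' : ℝ, ∀ s : ℝ, 1 ≤ s → |(Nat.card {I : (Ideal (𝓞 K))⁰ //
        absNorm (I : Ideal (𝓞 K)) ≤ s ∧ ClassGroup.mk0 I = C} : ℝ) -
        (2 ^ nrRealPlaces K * (2 * Real.pi) ^ nrComplexPlaces K * regulator K) /
            (torsionOrder K * Real.sqrt |discr K|) * s| ≤ C' * s ^ (1 - (1 / (finrank ℚ K : ℝ)) / 2) := by
  have hlim := NumberField.Ideal.tendsto_norm_le_and_mk_eq_div_atTop K C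
  set κ := (2 ^ nrRealPlaces K * (2 * Real.pi) ^ nrComplexPlaces K * regulator K) /
            (torsionOrder K * Real.sqrt |discr K|)
  obtain ⟨J, hJ⟩ := ClassGroup.mk0_surjective C⁻¹
  have hw : (0:ℝ) < torsionOrder K := by exact_mod_cast (torsionOrder_pos K)
  have hNJn : 0 < absNorm (J : Ideal (𝓞 K)) := absNorm_pos_of_nonZeroDivisors J
  have hNJ : (0:ℝ) < absNorm (J : Ideal (𝓞 K)) := by exact_mod_cast hNJn
  have hNJ1 : (1:ℝ) ≤ absNorm (J : Ideal (𝓞 K)) := by exact_mod_cast hNJn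
  set NJ : ℝ := (absNorm (J : Ideal (𝓞 K)) : ℝ) with hNJd
  have hrel : ∀ s : ℝ, (Nat.card {I : (Ideal (𝓞 K))⁰ //
        absNorm (I : Ideal (𝓞 K)) ≤ s ∧ ClassGroup.mk0 I = C} : ℝ) * torsionOrder K =
      Nat.card {a : idealSet K J // mixedEmbedding.norm (a : mixedSpace K) ≤ s * NJ} := by
    intro s
    rw [class_count_eq s hJ, ← card_isPrincipal_dvd_norm_le, Nat.cast_mul]
  obtain ⟨C', hC'⟩ := idealSet_saving J (κ * torsionOrder K / NJ) (by
    have h1 := (hlim.comp (tendsto_id.atTop_div_const hNJ)).mul_const (torsionOrder K / NJ : ℝ)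
    rw [← mul_div_assoc] at h1
    refine h1.congr' ?_
    filter_upwards [eventually_gt_atTop 0] with s hs
    simp only [Function.comp, id]
    have := hrel (s / NJ)
    rw [div_mul_cancel₀ _ hNJ.ne'] at this
    rw [← this]
    generalize (Nat.card {I : (Ideal (𝓞 K))⁰ //
        absNorm (I : Ideal (𝓞 K)) ≤ s / NJ ∧ ClassGroup.mk0 I = C} : ℝ) = Q
    field_simp)
  refine ⟨C' * NJ ^ (1 - (1 / (finrank ℚ K : ℝ)) / 2) / torsionOrder K, fun s hs => ?_⟩
  have hs0 : 0 < s := by linarith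
  have h2 := hC' (s * NJ) (by nlinarith)
  rw [← hrel, Real.mul_rpow hs0.le hNJ.le] at h2
  have e : ∀ N : ℝ, N - κ * s = (N * torsionOrder K - κ * torsionOrder K / NJ * (s * NJ)) / torsionOrder K := by
    intro N; field_simp
  rw [e, abs_div, abs_of_pos hw, div_le_iff₀ hw]
  refine h2.trans (le_of_eq ?_)
  field_simp

theorem idealCount_eq (s : ℝ) : idealCount K s =
    Nat.card {I : (Ideal (𝓞 K))⁰ // absNorm (I : Ideal (𝓞 K)) ≤ s} := by
  refine Nat.card_congr ⟨fun a => ⟨⟨a.1, mem_nonZeroDivisors_of_ne_zero a.2.1⟩, a.2.2⟩,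
    fun a => ⟨a.1.1, nonZeroDivisors.coe_ne_zero a.1, a.2⟩, fun _ => rfl, fun _ => rfl⟩

variable (K) in
theorem idealCount_saving : ∃ η C : ℝ, 0 < η ∧ η < 1 ∧ 0 ≤ C ∧
    ∀ s, 1 ≤ s → |(idealCount K s : ℝ) - cK K * s| ≤ C * s ^ (1 - η) := by
  classical
  have hn : 0 < finrank ℚ K := finrank_pos
  have hn' : (0:ℝ) < finrank ℚ K := by exact_mod_cast hn
  have hn1 : (1:ℝ) ≤ finrank ℚ K := by exact_mod_cast hn
  choose C' hC' using fun C => class_saving (K := K) C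
  refine ⟨(1 / (finrank ℚ K : ℝ)) / 2, ∑ C, |C' C|, by positivity, ?_, by positivity, fun s hs => ?_⟩
  · have : 1 / (finrank ℚ K : ℝ) ≤ 1 := by rw [div_le_one hn']; exact hn1
    linarith
  have hs0 : 0 ≤ s := by linarith
  have h1 : (idealCount K s : ℝ) = ∑ C : ClassGroup (𝓞 K), (Nat.card {I : (Ideal (𝓞 K))⁰ //
        absNorm (I : Ideal (𝓞 K)) ≤ s ∧ ClassGroup.mk0 I = C} : ℝ) := by
    rw [idealCount_eq]
    have : Fintype {I : (Ideal (𝓞 K))⁰ // absNorm (I : Ideal (𝓞 K)) ≤ s} := by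
      simp_rw [← Nat.le_floor_iff hs0]
      refine @Fintype.ofFinite _ (finite_setOfPred_absNorm_le₀ ⌊s⌋₊)
    let e := fun C : ClassGroup (𝓞 K) ↦ Equiv.subtypeSubtypeEquivSubtypeInter
      (fun I : (Ideal (𝓞 K))⁰ ↦ absNorm I.1 ≤ s) (fun I ↦ ClassGroup.mk0 I = C)
    simp_rw [← Nat.card_congr (e _), Nat.card_eq_fintype_card, Fintype.subtype_card]
    rw [Fintype.card, Finset.card_eq_sum_card_fiberwise (f := fun I ↦ ClassGroup.mk0 I.1)
      (t := Finset.univ) (fun _ _ ↦ Finset.mem_univ _), Nat.cast_sum]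
  have h2 : cK K * s = ∑ _C : ClassGroup (𝓞 K), (2 ^ nrRealPlaces K * (2 * Real.pi) ^ nrComplexPlaces K * regulator K) /
            (torsionOrder K * Real.sqrt |discr K|) * s := by
    rw [Finset.sum_const, Finset.card_univ, nsmul_eq_mul, cK, classNumber]
    ring
  rw [h1, h2, ← Finset.sum_sub_distrib, Finset.sum_mul]
  refine (Finset.abs_sum_le_sum_abs _ _).trans (Finset.sum_le_sum fun C _ => ?_)
  exact (hC' C s hs).trans (mul_le_mul_of_nonneg_right (le_abs_self _) (by positivity))

end IdealCount

section Comb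
open UniqueFactorizationMonoid
variable {K}

theorem finite_BK (x : ℝ) : {a : Ideal (𝓞 K) | a ≠ ⊥ ∧ (absNorm a : ℝ) ≤ x}.Finite := by
  refine (Ideal.finite_setOfPred_absNorm_le (S := 𝓞 K) ⌊x⌋₊).subset ?_
  rintro a ⟨-, ha⟩
  exact Nat.le_floor ha

variable (K) in
/-- nonzero ideals of norm at most `x`. -/
def BK (x : ℝ) : Finset (Ideal (𝓞 K)) := (finite_BK (K := K) x).toFinset

@[simp] theorem mem_BK {x : ℝ} {a : Ideal (𝓞 K)} : a ∈ BK K x ↔ a ≠ ⊥ ∧ (absNorm a : ℝ) ≤ x := by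
  simp [BK]

theorem card_BK (x : ℝ) : (BK K x).card = idealCount K x := by
  rw [idealCount, Nat.subtype_card (BK K x) (fun a => mem_BK)]

theorem absNorm_pos' {a : Ideal (𝓞 K)} (ha : a ≠ ⊥) : 0 < absNorm a :=
  Nat.pos_of_ne_zero (by simpa [Ideal.absNorm_eq_zero_iff] using ha)

theorem absNorm_posR {a : Ideal (𝓞 K)} (ha : a ≠ ⊥) : (0:ℝ) < absNorm a := by
  exact_mod_cast absNorm_pos' ha

theorem one_le_absNormR {a : Ideal (𝓞 K)} (ha : a ≠ ⊥) : (1:ℝ) ≤ absNorm a := by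
  exact_mod_cast absNorm_pos' ha

/-- prime ideals containing `a` -/
def primesOf (a : Ideal (𝓞 K)) : Finset (Ideal (𝓞 K)) := by
  classical exact (normalizedFactors a).toFinset

theorem mem_primesOf' {a p : Ideal (𝓞 K)} (ha : a ≠ ⊥) : p ∈ primesOf a ↔ p.IsPrime ∧ a ≤ p := by
  classical
  rw [primesOf, Multiset.mem_toFinset, Ideal.mem_normalizedFactors_iff ha]

theorem mem_primesOf {a p : Ideal (𝓞 K)} (ha : a ≠ ⊥) : p ∈ primesOf a ↔ Prime p ∧ p ∣ a := by
  rw [mem_primesOf' ha, Ideal.dvd_iff_le, Ideal.isPrime_iff_bot_or_prime]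
  constructor
  · rintro ⟨h | h, h2⟩
    · subst h; exact absurd (le_bot_iff.1 h2) ha
    · exact ⟨h, h2⟩
  · rintro ⟨h, h2⟩; exact ⟨Or.inr h, h2⟩

theorem muK_eq {a : Ideal (𝓞 K)} (ha : a ≠ ⊥) [Decidable (Squarefree a)] :
    muK K a = if Squarefree a then (-1) ^ (primesOf a).card else 0 := by
  have : Nat.card {p : Ideal (𝓞 K) // p.IsPrime ∧ a ≤ p} = (primesOf a).card := by
    exact Nat.subtype_card (primesOf a) fun p => mem_primesOf' ha
  rw [muK, this]
  split_ifs <;> rfl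

theorem primesOf_prod {U : Finset (Ideal (𝓞 K))} (hU : ∀ p ∈ U, Prime p) :
    primesOf (∏ p ∈ U, p) = U := by
  classical
  rw [primesOf, Finset.prod_eq_multiset_prod, Multiset.map_id',
    normalizedFactors_prod_of_prime (m := U.val) (fun p hp => hU p hp)]
  simp

theorem squarefree_prod {U : Finset (Ideal (𝓞 K))} (hU : ∀ p ∈ U, Prime p) :
    Squarefree (∏ p ∈ U, p) := by
  classical
  have h0 : (∏ p ∈ U, p) ≠ 0 := Finset.prod_ne_zero_iff.2 fun p hp => (hU p hp).ne_zero
  rw [squarefree_iff_nodup_normalizedFactors h0, Finset.prod_eq_multiset_prod, Multiset.map_id',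
    normalizedFactors_prod_of_prime (m := U.val) (fun p hp => hU p hp)]
  exact U.nodup

theorem prod_primesOf {a : Ideal (𝓞 K)} (ha : a ≠ ⊥) (hs : Squarefree a) :
    ∏ p ∈ primesOf a, p = a := by
  classical
  rw [squarefree_iff_nodup_normalizedFactors ha] at hs
  have h : (primesOf a).val = normalizedFactors a := by
    rw [primesOf, Multiset.toFinset_val, Multiset.dedup_eq_self.2 hs]
  rw [Finset.prod_eq_multiset_prod, Multiset.map_id', h, Ideal.prod_normalizedFactors_eq_self ha]

theorem muK_prod {U : Finset (Ideal (𝓞 K))} (hU : ∀ p ∈ U, Prime p) :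
    muK K (∏ p ∈ U, p) = (-1) ^ U.card := by
  classical
  have h0 : (∏ p ∈ U, p) ≠ 0 := Finset.prod_ne_zero_iff.2 fun p hp => (hU p hp).ne_zero
  rw [muK_eq h0, if_pos (squarefree_prod hU), primesOf_prod hU]

/-- L0 -/
theorem sum_BK_dvd {d : Ideal (𝓞 K)} (hd : d ≠ ⊥) (x : ℝ) (f : Ideal (𝓞 K) → ℝ)
    [DecidablePred fun a : Ideal (𝓞 K) => d ∣ a] :
    ∑ a ∈ (BK K x).filter (fun a => d ∣ a), f a = ∑ e ∈ BK K (x / absNorm d), f (d * e) := by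
  classical
  symm
  refine Finset.sum_bij (fun e _ => d * e) ?_ ?_ ?_ ?_
  · intro e he
    rw [mem_BK] at he
    rw [Finset.mem_filter, mem_BK]
    refine ⟨⟨mul_ne_zero hd he.1, ?_⟩, dvd_mul_right _ _⟩
    have := he.2
    rw [le_div_iff₀ (absNorm_posR hd)] at this
    rw [map_mul]; push_cast; linarith
  · intro a _ b _ h
    exact mul_left_cancel₀ hd h
  · intro a ha
    rw [Finset.mem_filter, mem_BK] at ha
    obtain ⟨e, rfl⟩ := ha.2
    refine ⟨e, ?_, rfl⟩
    rw [mem_BK]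
    refine ⟨right_ne_zero_of_mul ha.1.1, ?_⟩
    rw [le_div_iff₀ (absNorm_posR hd)]
    have := ha.1.2
    rw [map_mul] at this; push_cast at this; linarith
  · intros; rfl

/-- divisors -/
def divs (a : Ideal (𝓞 K)) : Finset (Ideal (𝓞 K)) := by
  classical exact (BK K (absNorm a)).filter (fun d => d ∣ a)

theorem mem_divs {a d : Ideal (𝓞 K)} (ha : a ≠ ⊥) : d ∈ divs a ↔ d ∣ a := by
  classical
  rw [divs, Finset.mem_filter, mem_BK]
  refine ⟨fun h => h.2, fun h => ⟨⟨ne_zero_of_dvd_ne_zero ha h, ?_⟩, h⟩⟩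
  have : absNorm d ∣ absNorm a := by
    obtain ⟨e, rfl⟩ := h; rw [map_mul]; exact dvd_mul_right _ _
  exact_mod_cast Nat.le_of_dvd (absNorm_pos' ha) this

/-- L1 -/
theorem sum_sum_divs (x : ℝ) (F : Ideal (𝓞 K) → Ideal (𝓞 K) → ℝ) :
    ∑ d ∈ BK K x, ∑ e ∈ BK K (x / absNorm d), F d (d * e) = ∑ a ∈ BK K x, ∑ d ∈ divs a, F d a := by
  classical
  have : ∀ d ∈ BK K x, ∑ e ∈ BK K (x / absNorm d), F d (d * e) =
      ∑ a ∈ BK K x, if d ∣ a then F d a else 0 := by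
    intro d hd
    rw [mem_BK] at hd
    rw [← sum_BK_dvd hd.1 x (F d), Finset.sum_filter]
  rw [Finset.sum_congr rfl this, Finset.sum_comm]
  refine Finset.sum_congr rfl fun a ha => ?_
  rw [← Finset.sum_filter]
  refine Finset.sum_congr ?_ fun _ _ => rfl
  ext d
  rw [mem_BK] at ha
  rw [mem_divs ha.1, Finset.mem_filter, mem_BK]
  refine ⟨fun h => h.2, fun h => ⟨?_, h⟩⟩
  have h' := (mem_divs ha.1).2 h
  rw [divs, Finset.mem_filter, mem_BK] at h'
  exact ⟨h'.1.1, h'.1.2.trans ha.2⟩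

/-- L2 -/
theorem sum_divs_mu {a : Ideal (𝓞 K)} (ha : a ≠ ⊥) (F : Ideal (𝓞 K) → ℝ) :
    ∑ d ∈ divs a, (muK K d : ℝ) * F d =
      ∑ U ∈ (primesOf a).powerset, (-1) ^ U.card * F (∏ p ∈ U, p) := by
  classical
  have hp : ∀ U ∈ (primesOf a).powerset, ∀ p ∈ U, Prime p := fun U hU p hp =>
    ((mem_primesOf ha).1 (Finset.mem_powerset.1 hU hp)).1
  symm
  rw [← Finset.sum_filter_of_ne (s := divs a) (p := fun d => Squarefree d)]
  · refine Finset.sum_bij (fun U _ => ∏ p ∈ U, p) ?_ ?_ ?_ ?_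
    · intro U hU
      rw [Finset.mem_filter, mem_divs ha]
      refine ⟨Finset.prod_primes_dvd _ (hp U hU) fun p hpU =>
        ((mem_primesOf ha).1 (Finset.mem_powerset.1 hU hpU)).2, squarefree_prod (hp U hU)⟩
    · intro U hU V hV h
      rw [← primesOf_prod (hp U hU), ← primesOf_prod (hp V hV)]
      exact congrArg _ h
    · intro d hd
      rw [Finset.mem_filter, mem_divs ha] at hd
      have hd0 : d ≠ ⊥ := ne_zero_of_dvd_ne_zero ha hd.1
      refine ⟨primesOf d, ?_, prod_primesOf hd0 hd.2⟩
      rw [Finset.mem_powerset]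
      intro p hp
      rw [mem_primesOf hd0] at hp
      rw [mem_primesOf ha]
      exact ⟨hp.1, hp.2.trans hd.1⟩
    · intro U hU
      rw [muK_prod (hp U hU)]
      push_cast; rfl
  · intro d hd h
    by_contra hs
    apply h
    rw [muK_eq (ne_zero_of_dvd_ne_zero ha ((mem_divs ha).1 hd)), if_neg hs]
    simp

theorem powerset_aux {α : Type*} [DecidableEq α] (P R : Finset α) (p : α) (hp : p ∈ P)
    (hR : R ⊆ P.erase p) :
    ∑ U ∈ P.powerset, (if p ∈ U ∧ U.erase p ⊆ R then (-1 : ℝ) ^ U.card else 0) =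
      -(if R = ∅ then 1 else 0) := by
  have h := congrArg (fun z : ℤ => (z : ℝ)) (Finset.sum_powerset_neg_one_pow_card (x := R))
  push_cast at h
  rw [← h, ← Finset.sum_filter, ← Finset.sum_neg_distrib]
  symm
  have hpR : p ∉ R := fun h => Finset.notMem_erase p P (hR h)
  refine Finset.sum_bij (fun V _ => insert p V) ?_ ?_ ?_ ?_
  · intro V hV
    rw [Finset.mem_powerset] at hV
    have : p ∉ V := fun h => hpR (hV h)
    simp only [Finset.mem_filter, Finset.mem_powerset, Finset.mem_insert_self, true_and,
      Finset.erase_insert this]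
    exact ⟨Finset.insert_subset hp ((hV.trans hR).trans (Finset.erase_subset _ _)), hV⟩
  · intro V hV W hW h
    rw [Finset.mem_powerset] at hV hW
    rw [← Finset.erase_insert (fun h => hpR (hV h) : p ∉ V), h,
      Finset.erase_insert (fun h => hpR (hW h) : p ∉ W)]
  · intro U hU
    rw [Finset.mem_filter] at hU
    exact ⟨U.erase p, Finset.mem_powerset.2 hU.2.2, Finset.insert_erase hU.2.1⟩
  · intro V hV
    rw [Finset.mem_powerset] at hV
    rw [Finset.card_insert_of_notMem (fun h => hpR (hV h)), pow_succ]; ring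


theorem primesOf_eq_empty {a : Ideal (𝓞 K)} (ha : a ≠ ⊥) : primesOf a = ∅ ↔ a = ⊤ := by
  constructor
  · intro h
    by_contra hne
    obtain ⟨p, hp, hle⟩ := Ideal.exists_le_maximal a hne
    have : p ∈ primesOf a := (mem_primesOf' ha).2 ⟨hp.isPrime, hle⟩
    rw [h] at this
    simp at this
  · rintro rfl
    rw [Finset.eq_empty_iff_forall_notMem]
    intro p hp
    have := (mem_primesOf' ha).1 hp
    exact this.1.ne_top (top_le_iff.1 this.2)

theorem sum_divs_mu_one {a : Ideal (𝓞 K)} (ha : a ≠ ⊥) [Decidable (a = ⊤)] :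
    ∑ d ∈ divs a, (muK K d : ℝ) = if a = ⊤ then 1 else 0 := by
  classical
  have h := sum_divs_mu ha (fun _ => 1)
  simp only [mul_one] at h
  rw [h]
  have h := congrArg (fun z : ℤ => (z : ℝ)) (Finset.sum_powerset_neg_one_pow_card (x := primesOf a))
  push_cast at h
  rw [h]
  simp only [primesOf_eq_empty ha]

theorem inD_iff {d : Ideal (𝓞 K)} (hd : d ≠ ⊥) (S : Set (Ideal (𝓞 K))) :
    InD K S d ↔ ∃ p ∈ primesOf d, p ∈ S ∧ ∀ q ∈ primesOf d, q ≠ p → absNorm p < absNorm q := by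
  constructor
  · rintro ⟨p, ⟨h1, h2, h3⟩, hS, hu⟩
    refine ⟨p, (mem_primesOf' hd).2 ⟨h1, h2⟩, hS, fun q hq hne => ?_⟩
    obtain ⟨hq1, hq2⟩ := (mem_primesOf' hd).1 hq
    refine lt_of_le_of_ne (h3 q hq1 hq2) fun he => hne (hu q ⟨hq1, hq2, ?_⟩)
    rw [← he]; exact h3
  · rintro ⟨p, hp, hS, h⟩
    have hp' := (mem_primesOf' hd).1 hp
    refine ⟨p, ⟨hp'.1, hp'.2, fun q hq hq' => ?_⟩, hS, fun q hq => ?_⟩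
    · by_cases hqp : q = p
      · rw [hqp]
      · exact (h q ((mem_primesOf' hd).2 ⟨hq, hq'⟩) hqp).le
    · by_contra hne
      have := h q ((mem_primesOf' hd).2 ⟨hq.1, hq.2.1⟩) hne
      exact absurd (hq.2.2 p hp'.1 hp'.2) (not_le.2 this)

theorem maxNorm_iff {a : Ideal (𝓞 K)} (ha : a ≠ ⊥) {p : Ideal (𝓞 K)} (hp : p ∈ primesOf a) :
    absNorm p = maxNorm K a ↔ ∀ q ∈ primesOf a, absNorm q ≤ absNorm p := by
  have hset : {p : Ideal (𝓞 K) | p.IsPrime ∧ a ≤ p} = (primesOf a : Set (Ideal (𝓞 K))) := by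
    ext q; simp [mem_primesOf' ha]
  have hb : BddAbove (absNorm '' (primesOf a : Set (Ideal (𝓞 K)))) :=
    ((Finset.finite_toSet _).image _).bddAbove
  rw [maxNorm, hset]
  constructor
  · intro h q hq
    rw [h]
    exact le_csSup hb ⟨q, hq, rfl⟩
  · intro h
    refine le_antisymm (le_csSup hb ⟨p, hp, rfl⟩) (csSup_le ⟨_, ⟨p, hp, rfl⟩⟩ ?_)
    rintro _ ⟨q, hq, rfl⟩
    exact h q hq

theorem QS_eq {a : Ideal (𝓞 K)} (ha : a ≠ ⊥) (S : Set (Ideal (𝓞 K)))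
    [DecidablePred fun p : Ideal (𝓞 K) => p ∈ S ∧ ∀ q ∈ primesOf a, absNorm q ≤ absNorm p] :
    QS K S a = ((primesOf a).filter
      (fun p => p ∈ S ∧ ∀ q ∈ primesOf a, absNorm q ≤ absNorm p)).card := by
  refine Nat.subtype_card _ fun p => ?_
  rw [Finset.mem_filter]
  constructor
  · rintro ⟨h1, h2, h3⟩
    have := (mem_primesOf' ha).1 h1
    exact ⟨this.1, this.2, h2, (maxNorm_iff ha h1).2 h3⟩
  · rintro ⟨h1, h2, h3, h4⟩
    have := (mem_primesOf' ha).2 ⟨h1, h2⟩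
    exact ⟨this, h3, (maxNorm_iff ha this).1 h4⟩

open Classical in
theorem sum_divs_mu_D {a : Ideal (𝓞 K)} (ha : a ≠ ⊥) (S : Set (Ideal (𝓞 K))) :
    ∑ d ∈ divs a, (muK K d : ℝ) * (if InD K S d then 1 else 0) = -(QS K S a : ℝ) := by
  rw [sum_divs_mu ha, QS_eq ha]
  have hp : ∀ U ∈ (primesOf a).powerset, ∀ p ∈ U, Prime p := fun U hU p hp =>
    ((mem_primesOf ha).1 (Finset.mem_powerset.1 hU hp)).1
  have h1 : ∀ U ∈ (primesOf a).powerset,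
      (-1 : ℝ) ^ U.card * (if InD K S (∏ p ∈ U, p) then 1 else 0) =
      ∑ p ∈ primesOf a with p ∈ S, (if p ∈ U ∧
        U.erase p ⊆ (primesOf a).filter (fun q => absNorm p < absNorm q)
        then (-1 : ℝ) ^ U.card else 0) := by
    intro U hU
    have hU' := Finset.mem_powerset.1 hU
    have h0 : (∏ p ∈ U, p) ≠ ⊥ := Finset.prod_ne_zero_iff.2 fun p hpU => (hp U hU p hpU).ne_zero
    have hsub : ∀ p, U.erase p ⊆ (primesOf a).filter (fun q => absNorm p < absNorm q) ↔
        ∀ q ∈ U, q ≠ p → absNorm p < absNorm q := by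
      intro p
      constructor
      · intro h q hq hne
        exact (Finset.mem_filter.1 (h (Finset.mem_erase.2 ⟨hne, hq⟩))).2
      · intro h q hq
        rw [Finset.mem_erase] at hq
        exact Finset.mem_filter.2 ⟨hU' hq.2, h q hq.2 hq.1⟩
    simp only [hsub]
    rw [inD_iff h0, primesOf_prod (hp U hU)]
    by_cases hD : ∃ p ∈ U, p ∈ S ∧ ∀ q ∈ U, q ≠ p → absNorm p < absNorm q
    · rw [if_pos hD]
      obtain ⟨p, hpU, hpS, hmin⟩ := hD
      rw [Finset.sum_eq_single p]
      · rw [if_pos ⟨hpU, hmin⟩, mul_one]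
      · intro q hq hne
        refine if_neg ?_
        rintro ⟨hqU, hqm⟩
        have a1 := hqm p hpU hne.symm
        have a2 := hmin q hqU hne
        omega
      · intro h
        exact absurd (Finset.mem_filter.2 ⟨hU' hpU, hpS⟩) h
    · rw [if_neg hD, mul_zero]
      symm
      refine Finset.sum_eq_zero fun p hpS => if_neg ?_
      rintro ⟨h, h'⟩
      exact hD ⟨p, h, (Finset.mem_filter.1 hpS).2, h'⟩
  rw [Finset.sum_congr rfl h1, Finset.sum_comm]
  have h2 : ∀ p ∈ (primesOf a).filter (fun p => p ∈ S), ∑ U ∈ (primesOf a).powerset, (if p ∈ U ∧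
        U.erase p ⊆ (primesOf a).filter (fun q => absNorm p < absNorm q)
        then (-1 : ℝ) ^ U.card else 0) =
      -(if ∀ q ∈ primesOf a, absNorm q ≤ absNorm p then 1 else 0) := by
    intro p hpp
    rw [powerset_aux _ _ p (Finset.mem_filter.1 hpp).1]
    · simp only [Finset.filter_eq_empty_iff, not_lt]
    · intro q hq
      rw [Finset.mem_filter] at hq
      refine Finset.mem_erase.2 ⟨?_, hq.1⟩
      rintro rfl
      exact lt_irrefl _ hq.2
  rw [Finset.sum_congr rfl h2, Finset.sum_neg_distrib, ← Finset.sum_filter, Finset.filter_filter,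
    Finset.sum_const, nsmul_eq_mul, mul_one]

/-- nonnegativity of the von Mangoldt function of `K` -/
theorem sum_divs_mu_log {a : Ideal (𝓞 K)} (ha : a ≠ ⊥) :
    ∑ d ∈ divs a, (muK K d : ℝ) * Real.log (absNorm d) ≤ 0 := by
  classical
  rw [sum_divs_mu ha]
  have hp : ∀ U ∈ (primesOf a).powerset, ∀ p ∈ U, Prime p := fun U hU p hp =>
    ((mem_primesOf ha).1 (Finset.mem_powerset.1 hU hp)).1
  have h1 : ∀ U ∈ (primesOf a).powerset,
      (-1 : ℝ) ^ U.card * Real.log (absNorm (∏ p ∈ U, p)) =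
      ∑ p ∈ primesOf a, Real.log (absNorm p) * (if p ∈ U ∧ U.erase p ⊆ (primesOf a).erase p
        then (-1 : ℝ) ^ U.card else 0) := by
    intro U hU
    have hU' := Finset.mem_powerset.1 hU
    rw [map_prod, Nat.cast_prod, Real.log_prod (fun p hpU =>
      (absNorm_posR (hp U hU p hpU).ne_zero).ne'), Finset.mul_sum]
    rw [← Finset.sum_subset hU']
    · refine Finset.sum_congr rfl fun p hpU => ?_
      rw [if_pos ⟨hpU, Finset.erase_subset_erase _ hU'⟩, mul_comm]
    · intro p _ hpU
      rw [if_neg (fun h => hpU h.1), mul_zero]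
  rw [Finset.sum_congr rfl h1, Finset.sum_comm]
  refine Finset.sum_nonpos fun p hpa => ?_
  rw [← Finset.mul_sum, powerset_aux _ _ p hpa subset_rfl]
  have : 0 ≤ Real.log (absNorm p) := Real.log_nonneg
    (one_le_absNormR ((mem_primesOf ha).1 hpa).1.ne_zero)
  split_ifs <;> simp [this]

theorem abs_muK_le (a : Ideal (𝓞 K)) : |(muK K a : ℝ)| ≤ 1 := by
  rw [muK]
  split_ifs <;> simp

end Comb

section Coef
variable {K}

variable (K) in
/-- ideals of norm `n` -/
def Fib (n : ℕ) : Finset (Ideal (𝓞 K)) := (BK K n).filter (fun a => absNorm a = n)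

theorem mem_Fib {n : ℕ} {a : Ideal (𝓞 K)} : a ∈ Fib K n ↔ a ≠ ⊥ ∧ absNorm a = n := by
  rw [Fib, Finset.mem_filter, mem_BK]
  constructor
  · rintro ⟨⟨h, -⟩, h'⟩; exact ⟨h, h'⟩
  · rintro ⟨h, h'⟩; exact ⟨⟨h, by rw [h']⟩, h'⟩

/-- coefficients of the Dirichlet series attached to `F` -/
def coef (F : Ideal (𝓞 K) → ℝ) (n : ℕ) : ℝ := ∑ a ∈ Fib K n, F a

theorem sum_coef (F : Ideal (𝓞 K) → ℝ) (x : ℝ) :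
    ∑ k ∈ Finset.Icc 1 ⌊x⌋₊, coef F k = ∑ a ∈ BK K x, F a := by
  classical
  rw [← Finset.sum_fiberwise_of_maps_to (s := BK K x) (t := Finset.Icc 1 ⌊x⌋₊)
    (g := fun a => absNorm a)]
  · refine Finset.sum_congr rfl fun k hk => Finset.sum_congr ?_ fun _ _ => rfl
    ext a
    rw [Finset.mem_Icc] at hk
    rw [mem_Fib, Finset.mem_filter, mem_BK]
    constructor
    · rintro ⟨h, h'⟩
      refine ⟨⟨h, ?_⟩, h'⟩
      rw [h']
      exact (Nat.le_floor_iff' (by omega)).1 hk.2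
    · rintro ⟨⟨h, -⟩, h'⟩; exact ⟨h, h'⟩
  · intro a ha
    rw [mem_BK] at ha
    exact Finset.mem_Icc.2 ⟨absNorm_pos' ha.1, Nat.le_floor ha.2⟩

theorem conv_sum (n : ℕ) (H : Ideal (𝓞 K) → Ideal (𝓞 K) → ℝ) :
    ∑ p ∈ n.divisorsAntidiagonal, ∑ d ∈ Fib K p.1, ∑ e ∈ Fib K p.2, H d (d * e) =
      ∑ a ∈ Fib K n, ∑ d ∈ divs a, H d a := by
  classical
  simp_rw [← Finset.sum_product']
  rw [Finset.sum_sigma', Finset.sum_sigma']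
  refine Finset.sum_bij (fun z _ => ⟨z.2.1 * z.2.2, z.2.1⟩) ?_ ?_ ?_ ?_
  · rintro ⟨p, d, e⟩ h
    simp only [Finset.mem_sigma, Nat.mem_divisorsAntidiagonal, Finset.mem_product, mem_Fib] at h ⊢
    obtain ⟨⟨h1, h2⟩, ⟨h3, h4⟩, h5, h6⟩ := h
    have h0 : d * e ≠ ⊥ := mul_ne_zero h3 h5
    refine ⟨⟨h0, ?_⟩, (mem_divs h0).2 (dvd_mul_right _ _)⟩
    rw [map_mul, h4, h6, h1]
  · rintro ⟨p, d, e⟩ h ⟨p', d', e'⟩ h' he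
    simp only [Finset.mem_sigma, Nat.mem_divisorsAntidiagonal, Finset.mem_product, mem_Fib] at h h'
    simp only [Sigma.mk.injEq, heq_eq_eq] at he
    obtain ⟨he1, he2⟩ := he
    subst he2
    have := mul_left_cancel₀ h.2.1.1 he1
    subst this
    have : p = p' := Prod.ext (by rw [← h.2.1.2, ← h'.2.1.2]) (by rw [← h.2.2.2, ← h'.2.2.2])
    subst this
    rfl
  · rintro ⟨a, d⟩ h
    simp only [Finset.mem_sigma, mem_Fib] at h
    obtain ⟨⟨h1, h2⟩, h3⟩ := h
    obtain ⟨e, rfl⟩ := (mem_divs h1).1 h3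
    refine ⟨⟨(absNorm d, absNorm e), d, e⟩, ?_, rfl⟩
    simp only [Finset.mem_sigma, Nat.mem_divisorsAntidiagonal, Finset.mem_product, mem_Fib]
    refine ⟨⟨by rw [← map_mul, h2], ?_⟩, ⟨left_ne_zero_of_mul h1, trivial⟩, right_ne_zero_of_mul h1, trivial⟩
    rw [← h2]; exact (absNorm_pos' h1).ne'
  · intros; rfl

theorem absNorm_top' : absNorm (⊤ : Ideal (𝓞 K)) = 1 := by simp

theorem coef_conv_one (n : ℕ) :
    ∑ p ∈ n.divisorsAntidiagonal, coef (fun a => (muK K a : ℝ)) p.1 * coef (K := K) (fun _ => 1) p.2 =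
      if n = 1 then 1 else 0 := by
  classical
  have h := conv_sum (K := K) n (fun d _ => (muK K d : ℝ))
  rw [Finset.sum_congr rfl (fun a ha => sum_divs_mu_one (mem_Fib.1 ha).1)] at h
  have e : ∀ p : ℕ × ℕ, coef (fun a => (muK K a : ℝ)) p.1 * coef (K := K) (fun _ => 1) p.2 =
    ∑ d ∈ Fib K p.1, ∑ e ∈ Fib K p.2, (muK K d : ℝ) := by
    intro p
    rw [coef, coef, Finset.sum_mul_sum]; simp
  rw [Finset.sum_congr rfl (fun p _ => e p), h]
  split_ifs with h1
  · subst h1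
    rw [Finset.sum_eq_single ⊤]
    · simp
    · intro a _ h; simp [h]
    · intro h
      exact absurd (mem_Fib.2 ⟨top_ne_bot, by simp⟩) h
  · refine Finset.sum_eq_zero fun a ha => if_neg ?_
    rintro rfl
    have := (mem_Fib.1 ha).2
    simp at this
    omega

theorem coef_conv_log (n : ℕ) :
    0 ≤ ∑ p ∈ n.divisorsAntidiagonal, coef (fun a => (muK K a : ℝ)) p.1 *
      (Real.log p.2 * coef (K := K) (fun _ => 1) p.2) := by
  classical
  have h := conv_sum (K := K) n (fun d a => (muK K d : ℝ) * (Real.log (absNorm a) - Real.log (absNorm d)))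
  have e : ∀ p ∈ n.divisorsAntidiagonal, coef (fun a => (muK K a : ℝ)) p.1 *
      (Real.log p.2 * coef (K := K) (fun _ => 1) p.2) =
    ∑ d ∈ Fib K p.1, ∑ e ∈ Fib K p.2,
      (muK K d : ℝ) * (Real.log (absNorm (d * e)) - Real.log (absNorm d)) := by
    intro p _
    rw [coef, coef, Finset.mul_sum, Finset.sum_mul_sum]
    refine Finset.sum_congr rfl fun d hd => Finset.sum_congr rfl fun e he => ?_
    rw [mem_Fib] at hd he
    rw [map_mul, Nat.cast_mul, Real.log_mul (absNorm_posR hd.1).ne' (absNorm_posR he.1).ne', he.2]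
    ring
  rw [Finset.sum_congr rfl e, h]
  refine Finset.sum_nonneg fun a ha => ?_
  rw [mem_Fib] at ha
  simp_rw [mul_sub]
  rw [Finset.sum_sub_distrib, ← Finset.sum_mul, sum_divs_mu_one ha.1]
  have h1 := sum_divs_mu_log ha.1
  have h2 : (if a = ⊤ then (1:ℝ) else 0) * Real.log (absNorm a) = 0 := by
    split_ifs with h
    · subst h; simp
    · simp
  rw [h2]; linarith

end Coef

section Analytic
open LSeries Complex MeasureTheory Asymptotics
variable {K}

theorem cK_pos : 0 < cK K := NumberField.dedekindZeta_residue_pos K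

theorem BK_card_zero {x : ℝ} (hx : x < 1) : BK K x = ∅ := by
  rw [Finset.eq_empty_iff_forall_notMem]
  intro a ha
  rw [mem_BK] at ha
  have := one_le_absNormR ha.1
  linarith [ha.2]

variable (K) in
theorem count_le : ∃ B : ℝ, 0 < B ∧ ∀ x : ℝ, 0 ≤ x → ((BK K x).card : ℝ) ≤ B * x := by
  obtain ⟨η, C, h0, h1, hC, h⟩ := idealCount_saving K
  refine ⟨cK K + C, by linarith [cK_pos (K := K)], fun x hx => ?_⟩
  rcases lt_or_ge x 1 with h' | h'
  · rw [BK_card_zero h']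
    have := cK_pos (K := K)
    simp only [Finset.card_empty, Nat.cast_zero]
    positivity
  · have h2 := h x h'
    rw [← card_BK] at h2
    have h3 : x ^ (1 - η) ≤ x := by
      calc x ^ (1 - η) ≤ x ^ (1:ℝ) := Real.rpow_le_rpow_of_exponent_le h' (by linarith)
        _ = x := Real.rpow_one x
    have := (abs_le.1 h2).2
    nlinarith

theorem coef_abs_le {F : Ideal (𝓞 K) → ℝ} (hF : ∀ a, |F a| ≤ 1) (n : ℕ) :
    |coef F n| ≤ coef (K := K) (fun _ => 1) n := by
  rw [coef, coef]
  exact (Finset.abs_sum_le_sum_abs _ _).trans (Finset.sum_le_sum fun a _ => hF a)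

theorem coef_bigO {F : Ideal (𝓞 K) → ℝ} (hF : ∀ a, |F a| ≤ 1) :
    (fun n : ℕ ↦ ∑ k ∈ Finset.Icc 1 n, ‖((coef F k : ℝ) : ℂ)‖) =O[atTop] fun n ↦ (n : ℝ) ^ (1:ℝ) := by
  obtain ⟨B, hB, h⟩ := count_le K
  refine IsBigO.of_bound B (Eventually.of_forall fun n => ?_)
  have h1 : ∑ k ∈ Finset.Icc 1 n, ‖((coef F k : ℝ) : ℂ)‖ ≤ ∑ k ∈ Finset.Icc 1 ⌊(n:ℝ)⌋₊, coef (K := K) (fun _ => 1) k := by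
    rw [Nat.floor_natCast]
    refine Finset.sum_le_sum fun k _ => ?_
    rw [Complex.norm_real]
    exact coef_abs_le hF k
  rw [sum_coef] at h1
  simp only [Finset.sum_const, nsmul_eq_mul, mul_one] at h1
  rw [Real.rpow_one, Real.norm_of_nonneg (by positivity), Real.norm_of_nonneg (by positivity)]
  exact h1.trans (h n (by positivity))

variable (K) in
def rC (n : ℕ) : ℂ := ((coef (K := K) (fun _ => 1) n : ℝ) : ℂ)
variable (K) in
def mC (n : ℕ) : ℂ := ((coef (K := K) (fun a => (muK K a : ℝ)) n : ℝ) : ℂ)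

theorem rC_summable {s : ℂ} (hs : 1 < s.re) : LSeriesSummable (rC K) s :=
  LSeriesSummable_of_sum_norm_bigO (coef_bigO (fun _ => by simp)) zero_le_one hs

theorem mC_summable {s : ℂ} (hs : 1 < s.re) : LSeriesSummable (mC K) s :=
  LSeriesSummable_of_sum_norm_bigO (coef_bigO abs_muK_le) zero_le_one hs

theorem rC_abscissa : abscissaOfAbsConv (rC K) ≤ 1 := by
  refine abscissaOfAbsConv_le_of_forall_lt_LSeriesSummable fun y hy => rC_summable ?_
  simpa using hy

theorem rC_lt {s : ℂ} (hs : 1 < s.re) : abscissaOfAbsConv (rC K) < s.re :=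
  lt_of_le_of_lt rC_abscissa (by exact_mod_cast hs)

theorem zeta_mul_m {s : ℂ} (hs : 1 < s.re) : LSeries (mC K) s * LSeries (rC K) s = 1 := by
  rw [← LSeries_convolution' (mC_summable hs) (rC_summable hs)]
  have : LSeries.convolution (mC K) (rC K) = LSeries.delta := by
    rw [LSeries.convolution_def]
    ext n
    have := coef_conv_one (K := K) n
    simp only [mC, rC, ← Complex.ofReal_mul, ← Complex.ofReal_sum]
    rw [this]
    simp only [LSeries.delta]
    split_ifs <;> simp
  rw [this, LSeries_delta]
  rfl

variable (K) in
def LamC : ℕ → ℂ := LSeries.convolution (mC K) (logMul (rC K))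

theorem LamC_nonneg (n : ℕ) : ∃ l : ℝ, 0 ≤ l ∧ LamC K n = l := by
  refine ⟨_, coef_conv_log (K := K) n, ?_⟩
  rw [LamC, LSeries.convolution_def]
  simp only [mC, rC, logMul]
  push_cast
  refine Finset.sum_congr rfl fun p _ => ?_
  rw [← Complex.natCast_log]

theorem LamC_summable {s : ℂ} (hs : 1 < s.re) : LSeriesSummable (LamC K) s :=
  (mC_summable hs).convolution (LSeriesSummable_logMul_of_lt_re (rC_lt hs))

theorem LamC_eq {s : ℂ} (hs : 1 < s.re) :
    LSeries (LamC K) s = - deriv (LSeries (rC K)) s / LSeries (rC K) s := by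
  have h := zeta_mul_m (K := K) hs
  rw [LamC, LSeries_convolution' (mC_summable hs) (LSeriesSummable_logMul_of_lt_re (rC_lt hs)),
    LSeries_deriv (rC_lt hs), neg_neg, eq_div_iff (right_ne_zero_of_mul_eq_one h)]
  linear_combination (LSeries (logMul (rC K)) s) * h

theorem three_four_one {x : ℝ} (hx : 1 < x) (t : ℝ) :
    0 ≤ (3 * LSeries (LamC K) x + 4 * LSeries (LamC K) (x + I * t) +
      LSeries (LamC K) (x + I * (2 * t))).re := by
  have h0 : 1 < (x : ℂ).re := by simpa using hx
  have h1 : 1 < (x + I * t : ℂ).re := by simpa using hx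
  have h2 : 1 < (x + I * (2 * t) : ℂ).re := by simpa using hx
  have s0 := LamC_summable (K := K) h0
  have s1 := LamC_summable (K := K) h1
  have s2 := LamC_summable (K := K) h2
  simp only [LSeries]
  rw [LSeriesSummable] at s0 s1 s2
  rw [← tsum_mul_left, ← tsum_mul_left, ← (s0.mul_left 3).tsum_add (s1.mul_left 4),
    ← ((s0.mul_left 3).add (s1.mul_left 4)).tsum_add s2,
    Complex.re_tsum (((s0.mul_left 3).add (s1.mul_left 4)).add s2)]
  refine tsum_nonneg fun n => ?_
  rcases Nat.eq_zero_or_pos n with rfl | hn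
  · simp
  obtain ⟨l, hl, hle⟩ := LamC_nonneg (K := K) n
  have hn0 : (n : ℂ) ≠ 0 := by exact_mod_cast hn.ne'
  rw [LSeries.term_of_ne_zero hn.ne', LSeries.term_of_ne_zero hn.ne', LSeries.term_of_ne_zero hn.ne',
    hle, Complex.cpow_add _ _ hn0, Complex.cpow_add _ _ hn0]
  have hnx : ((n : ℂ) ^ (x : ℂ)) = ((n : ℝ) ^ x : ℝ) := by
    rw [Complex.ofReal_cpow (by positivity)]; simp
  set θ := t * Real.log n with hθ
  have e1 : (n : ℂ) ^ (I * t) = exp (θ * I) := by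
    rw [Complex.cpow_def_of_ne_zero hn0, ← Complex.natCast_log, hθ]; push_cast; ring_nf
  have e2 : (n : ℂ) ^ (I * (2 * t)) = exp ((2 * θ : ℝ) * I) := by
    rw [Complex.cpow_def_of_ne_zero hn0, ← Complex.natCast_log, hθ]; push_cast; ring_nf
  have hpos : 0 < (n : ℝ) ^ x := by positivity
  rw [hnx, e1, e2]
  have e3 : 3 * ((l : ℂ) / ((n : ℝ) ^ x : ℝ)) + 4 * ((l : ℂ) / (((n : ℝ) ^ x : ℝ) * exp (θ * I))) +
      (l : ℂ) / (((n : ℝ) ^ x : ℝ) * exp ((2 * θ : ℝ) * I)) =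
      ((l / (n : ℝ) ^ x : ℝ) : ℂ) * (3 + 4 * exp ((-θ : ℝ) * I) + exp ((-(2 * θ) : ℝ) * I)) := by
    have := Complex.exp_ne_zero (θ * I)
    have := Complex.exp_ne_zero ((2 * θ : ℝ) * I)
    have : (((n : ℝ) ^ x : ℝ) : ℂ) ≠ 0 := by exact_mod_cast hpos.ne'
    push_cast
    rw [neg_mul, neg_mul, Complex.exp_neg, Complex.exp_neg]
    push_cast at *
    field_simp
  rw [e3, Complex.re_ofReal_mul]
  refine mul_nonneg (by positivity) ?_
  simp only [add_re, Complex.exp_ofReal_mul_I_re]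
  have : ((4 : ℂ) * exp ((-θ : ℝ) * I)).re = 4 * Real.cos (-θ) := by
    have : (4 : ℂ) = ((4 : ℝ) : ℂ) := by norm_num
    rw [this, Complex.re_ofReal_mul, Complex.exp_ofReal_mul_I_re]
  rw [this, Real.cos_neg, Real.cos_neg, Real.cos_two_mul]
  norm_num
  nlinarith [sq_nonneg (Real.cos θ + 1)]

end Analytic

section ZFun
open LSeries Complex MeasureTheory Asymptotics
variable {K}

theorem BK_mono {x y : ℝ} (h : x ≤ y) : BK K x ⊆ BK K y := by
  intro a ha
  rw [mem_BK] at ha ⊢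
  exact ⟨ha.1, ha.2.trans h⟩

variable (K) in
def AK (x : ℝ) : ℝ := ((BK K x).card : ℝ)

theorem AK_mono : Monotone (AK K) := fun x y h => by
  unfold AK
  exact_mod_cast Finset.card_le_card (BK_mono h)

variable (K) in
def EK (x : ℝ) : ℝ := AK K x - cK K * x

variable (K) in
def fE : ℝ → ℂ := (Set.Ioi (1:ℝ)).indicator (fun x => (EK K x : ℂ))

variable (K) in
theorem EK_bound : ∃ η C : ℝ, 0 < η ∧ η < 1 ∧ 0 ≤ C ∧ ∀ x, 1 ≤ x → |EK K x| ≤ C * x ^ (1 - η) := by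
  obtain ⟨η, C, h0, h1, hC, h⟩ := idealCount_saving K
  refine ⟨η, C, h0, h1, hC, fun x hx => ?_⟩
  rw [EK, AK, card_BK]
  exact h x hx

variable (K) in
def etaK : ℝ := (EK_bound K).choose
variable (K) in
theorem etaK_pos : 0 < etaK K := (EK_bound K).choose_spec.choose_spec.1
variable (K) in
theorem etaK_lt : etaK K < 1 := (EK_bound K).choose_spec.choose_spec.2.1
variable (K) in
theorem EK_bd : ∃ C : ℝ, 0 ≤ C ∧ ∀ x, 1 ≤ x → |EK K x| ≤ C * x ^ (1 - etaK K) :=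
  ⟨_, (EK_bound K).choose_spec.choose_spec.2.2⟩

theorem fE_loc : LocallyIntegrable (fE K) := by
  have h1 : LocallyIntegrable (AK K) := AK_mono.locallyIntegrable
  have h2 : LocallyIntegrable (fun x : ℝ => cK K * x) := (by fun_prop : Continuous _).locallyIntegrable
  have h3 : LocallyIntegrable (fun x : ℝ => (EK K x : ℂ)) := fun x => by
    obtain ⟨s, hs, h⟩ := (h1.sub h2) x
    exact ⟨s, hs, h.ofReal⟩
  exact fun x => by
    obtain ⟨s, hs, h⟩ := h3 x
    exact ⟨s, hs, h.indicator measurableSet_Ioi⟩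

theorem fE_top : fE K =O[atTop] (fun x : ℝ => x ^ (-(-(1 - etaK K)))) := by
  obtain ⟨C, hC, h⟩ := EK_bd K
  refine IsBigO.of_bound C ?_
  filter_upwards [eventually_gt_atTop 1] with x hx
  rw [fE, Set.indicator_of_mem (by exact hx), Complex.norm_real, neg_neg,
    Real.norm_of_nonneg (by positivity : (0:ℝ) ≤ x ^ (1 - etaK K))]
  exact h x hx.le

theorem fE_bot (b : ℝ) : fE K =O[nhdsWithin 0 (Set.Ioi 0)] (fun x : ℝ => x ^ (-b)) := by
  refine IsBigO.of_bound 1 ?_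
  have : Set.Iio (1:ℝ) ∈ nhdsWithin (0:ℝ) (Set.Ioi 0) :=
    mem_nhdsWithin_of_mem_nhds (Iio_mem_nhds one_pos)
  filter_upwards [this] with x hx
  rw [fE, Set.indicator_of_notMem (by simpa using (le_of_lt hx))]
  simp

variable (K) in
def HK (s : ℂ) : ℂ := mellin (fE K) (-s)

theorem HK_diff {s : ℂ} (hs : 1 - etaK K < s.re) : DifferentiableAt ℂ (HK K) s := by
  have : DifferentiableAt ℂ (mellin (fE K)) (-s) :=
    mellin_differentiableAt_of_isBigO_rpow (fE_loc.locallyIntegrableOn _) fE_top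
      (by simp only [neg_re]; linarith) (fE_bot ((-s).re - 1)) (by linarith)
  exact this.comp s differentiableAt_id.neg

theorem HK_conv {s : ℂ} (hs : 1 - etaK K < s.re) : MellinConvergent (fE K) (-s) :=
  mellinConvergent_of_isBigO_rpow (fE_loc.locallyIntegrableOn _) fE_top
      (by simp only [neg_re]; linarith) (fE_bot ((-s).re - 1)) (by linarith)

variable (K) in
def ZK (s : ℂ) : ℂ := cK K * s + (s - 1) * s * HK K s

theorem ZK_diff {s : ℂ} (hs : 1 - etaK K < s.re) : DifferentiableAt ℂ (ZK K) s := by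
  have := HK_diff hs
  unfold ZK
  fun_prop

theorem ZK_one : ZK K 1 = cK K := by simp [ZK]

theorem zeta_eq {s : ℂ} (hs : 1 < s.re) : (s - 1) * LSeries (rC K) s = ZK K s := by
  have hs1 : s - 1 ≠ 0 := by
    intro h
    have : s.re = 1 := by rw [sub_eq_zero.1 h]; simp
    linarith
  have hL := LSeries_eq_mul_integral' (rC K) (r := 1) zero_le_one hs (coef_bigO (fun _ => by simp))
  have hsum : ∀ t : ℝ, ∑ k ∈ Finset.Icc 1 ⌊t⌋₊, rC K k = (AK K t : ℂ) := by
    intro t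
    simp only [rC]
    rw [← Complex.ofReal_sum, sum_coef]
    simp [AK]
  have hs' : 1 - etaK K < s.re := by linarith [etaK_pos K]
  have hc := HK_conv hs'
  rw [MellinConvergent] at hc
  have hc2 : IntegrableOn (fun t : ℝ => (t : ℂ) ^ (-s - 1) • (EK K t : ℂ)) (Set.Ioi 1) := by
    refine (hc.mono_set (Set.Ioi_subset_Ioi zero_le_one)).congr_fun ?_ measurableSet_Ioi
    intro t ht
    simp only [fE, Set.indicator_of_mem ht]
  have hH : HK K s = ∫ t in Set.Ioi (1:ℝ), (t : ℂ) ^ (-s - 1) • (EK K t : ℂ) := by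
    rw [HK, mellin]
    have : ∀ t : ℝ, (t : ℂ) ^ (-s - 1) • fE K t =
        (Set.Ioi (1:ℝ)).indicator (fun t : ℝ => (t : ℂ) ^ (-s - 1) • (EK K t : ℂ)) t := by
      intro t
      by_cases h : t ∈ Set.Ioi (1:ℝ) <;> simp [fE, h]
    simp_rw [this]
    rw [setIntegral_indicator measurableSet_Ioi, Set.inter_eq_right.2 (Set.Ioi_subset_Ioi zero_le_one)]
  have hi := integrableOn_Ioi_cpow_of_lt (a := -s) (by simpa using hs) one_pos
  have hi2 := integral_Ioi_cpow_of_lt (a := -s) (by simpa using hs) one_pos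
  have hsplit : ∫ t in Set.Ioi (1:ℝ), (∑ k ∈ Finset.Icc 1 ⌊t⌋₊, rC K k) * (t : ℂ) ^ (-(s + 1)) =
      (∫ t in Set.Ioi (1:ℝ), (cK K : ℂ) * (t : ℂ) ^ (-s)) + HK K s := by
    rw [hH, ← integral_add (hi.const_mul _) hc2]
    refine setIntegral_congr_fun measurableSet_Ioi fun t ht => ?_
    have ht0 : (t : ℂ) ≠ 0 := by
      have : (0:ℝ) < t := one_pos.trans ht
      exact_mod_cast this.ne'
    have e1 : (t : ℂ) ^ (-s) = t * (t : ℂ) ^ (-s - 1) := by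
      rw [Complex.cpow_sub _ _ ht0, Complex.cpow_one]; field_simp
    simp only [hsum, EK]
    rw [e1, show -(s + 1) = -s - 1 by ring, smul_eq_mul]
    push_cast
    ring
  rw [hL, hsplit, integral_const_mul, hi2, ZK]
  have h3 : -s + 1 ≠ 0 := by
    intro h; apply hs1; linear_combination -h
  simp only [ofReal_one, one_cpow]
  field_simp
  ring

end ZFun

section NonVan
open LSeries Complex MeasureTheory Asymptotics Topology
variable {K}

theorem logderiv_limit {f : ℂ → ℂ} {z₀ : ℂ} (hf : AnalyticAt ℂ f z₀) (hn : analyticOrderAt f z₀ ≠ ⊤) :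
    Tendsto (fun z => (z - z₀) * (deriv f z / f z)) (𝓝[≠] z₀) (𝓝 (analyticOrderNatAt f z₀ : ℂ)) := by
  obtain ⟨g, hg, hg0, hfg⟩ := (hf.analyticOrderAt_ne_top).1 hn
  set n := analyticOrderNatAt f z₀
  have h1 : Tendsto (fun z => (n : ℂ) + (z - z₀) * (deriv g z / g z)) (𝓝[≠] z₀) (𝓝 (n : ℂ)) := by
    have : Tendsto (fun z => (n : ℂ) + (z - z₀) * (deriv g z / g z)) (𝓝 z₀)
        (𝓝 ((n : ℂ) + (z₀ - z₀) * (deriv g z₀ / g z₀))) := by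
      refine tendsto_const_nhds.add (Tendsto.mul (tendsto_id.sub_const _) ?_)
      exact (hg.deriv.continuousAt.tendsto).div (hg.continuousAt.tendsto) hg0
    simp only [sub_self, zero_mul, add_zero] at this
    exact this.mono_left nhdsWithin_le_nhds
  refine h1.congr' ?_
  have hg' : ∀ᶠ z in 𝓝 z₀, g z ≠ 0 := hg.continuousAt.eventually_ne hg0
  have hga : ∀ᶠ z in 𝓝 z₀, AnalyticAt ℂ g z := hg.eventually_analyticAt
  filter_upwards [self_mem_nhdsWithin, nhdsWithin_le_nhds hg', nhdsWithin_le_nhds hga,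
    nhdsWithin_le_nhds hfg.eventually_nhds] with z hz hgz hgaz hfz0
  have hfz : f =ᶠ[𝓝 z] fun z => (z - z₀) ^ n • g z := hfz0
  have hz' : z - z₀ ≠ 0 := sub_ne_zero.2 hz
  rw [hfz.deriv_eq, hfz.eq_of_nhds]
  have hd : HasDerivAt (fun z => (z - z₀) ^ n • g z)
      ((n * (z - z₀) ^ (n - 1) * 1) * g z + (z - z₀) ^ n * deriv g z) z :=
    (((hasDerivAt_id z).sub_const z₀).pow n).mul hgaz.differentiableAt.hasDerivAt
  rw [hd.deriv]
  simp only [smul_eq_mul]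
  rcases Nat.eq_zero_or_pos n with h0 | h0
  · rw [h0]; simp
  · have : (z - z₀) ^ n = (z - z₀) * (z - z₀) ^ (n - 1) := by
      rw [← pow_succ', Nat.sub_add_cancel h0]
    rw [this]
    have := pow_ne_zero (n - 1) hz'
    field_simp

theorem ZK_ne_of_gt {s : ℂ} (hs : 1 < s.re) : ZK K s ≠ 0 := by
  rw [← zeta_eq hs]
  refine mul_ne_zero ?_ (right_ne_zero_of_mul_eq_one (zeta_mul_m hs))
  intro h
  have : s.re = 1 := by rw [sub_eq_zero.1 h]; simp
  linarith

theorem ZK_analytic {s : ℂ} (hs : 1 - etaK K < s.re) : AnalyticAt ℂ (ZK K) s := by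
  have ho : IsOpen {z : ℂ | 1 - etaK K < z.re} := isOpen_lt continuous_const Complex.continuous_re
  have : DifferentiableOn ℂ (ZK K) {z : ℂ | 1 - etaK K < z.re} :=
    fun z hz => (ZK_diff hz).differentiableWithinAt
  exact this.analyticAt (ho.mem_nhds hs)

theorem path_tendsto (τ : ℝ) :
    Tendsto (fun ε : ℝ => ((1 + ε : ℝ) : ℂ) + I * τ) (𝓝[>] 0) (𝓝[≠] (1 + I * τ)) := by
  refine tendsto_nhdsWithin_iff.2 ⟨?_, ?_⟩
  · have : Continuous (fun ε : ℝ => ((1 + ε : ℝ) : ℂ) + I * τ) := by fun_prop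
    have h := this.tendsto 0
    simp only [add_zero, ofReal_one] at h
    exact h.mono_left nhdsWithin_le_nhds
  · filter_upwards [self_mem_nhdsWithin] with ε hε h
    have := congrArg Complex.re h
    simp at this
    exact (ne_of_gt hε) this

theorem ZK_order_ne_top (τ : ℝ) : analyticOrderAt (ZK K) (1 + I * τ) ≠ ⊤ := by
  intro h
  rw [analyticOrderAt_eq_top] at h
  have h2 := ((path_tendsto τ).mono_right nhdsWithin_le_nhds).eventually h
  obtain ⟨ε, h3, h4⟩ := (h2.and self_mem_nhdsWithin).exists
  have h4' : (0:ℝ) < ε := h4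
  exact ZK_ne_of_gt (by simp; exact h4') h3

theorem LamC_limit (τ : ℝ) :
    Tendsto (fun ε : ℝ => (ε : ℂ) * LSeries (LamC K) (((1 + ε : ℝ) : ℂ) + I * τ)) (𝓝[>] 0)
      (𝓝 ((if τ = 0 then 1 else 0) - (analyticOrderNatAt (ZK K) (1 + I * τ) : ℂ))) := by
  have ha : AnalyticAt ℂ (ZK K) (1 + I * τ) := ZK_analytic (by simp [etaK_pos K])
  have h1 := (logderiv_limit ha (ZK_order_ne_top τ)).comp (path_tendsto τ)
  have h2 : Tendsto (fun ε : ℝ => (ε : ℂ) / (ε + I * τ)) (𝓝[>] 0) (𝓝 (if τ = 0 then 1 else 0)) := by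
    split_ifs with h
    · subst h
      refine tendsto_const_nhds.congr' ?_
      filter_upwards [self_mem_nhdsWithin] with ε hε
      have : (ε : ℂ) ≠ 0 := by exact_mod_cast (ne_of_gt hε)
      simp [this]
    · have hc : ContinuousAt (fun ε : ℝ => (ε : ℂ) / (ε + I * τ)) 0 := by
        refine ContinuousAt.div (by fun_prop) (by fun_prop) ?_
        simp [h]
      have := hc.tendsto
      simp only [ofReal_zero, zero_div] at this
      exact this.mono_left nhdsWithin_le_nhds
  refine (h2.sub h1).congr' ?_
  filter_upwards [self_mem_nhdsWithin] with ε hε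
  have hε' : (0:ℝ) < ε := hε
  simp only [Function.comp]
  set s : ℂ := ((1 + ε : ℝ) : ℂ) + I * τ with hsdef
  have hs : 1 < s.re := by simp [hsdef]; exact hε'
  have hs1 : s - 1 = ε + I * τ := by rw [hsdef]; push_cast; ring
  have hs2 : s - (1 + I * τ) = ε := by rw [hsdef]; push_cast; ring
  have hs10 : s - 1 ≠ 0 := by
    intro h
    have : s.re = 1 := by rw [sub_eq_zero.1 h]; simp
    linarith
  have hd : deriv (ZK K) s = LSeries (rC K) s + (s - 1) * deriv (LSeries (rC K)) s := by
    have hev : ZK K =ᶠ[𝓝 s] fun z => (z - 1) * LSeries (rC K) z := by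
      have ho : IsOpen {z : ℂ | 1 < z.re} := isOpen_lt continuous_const Complex.continuous_re
      filter_upwards [ho.mem_nhds hs] with z hz
      exact (zeta_eq hz).symm
    rw [hev.deriv_eq]
    have := ((hasDerivAt_id s).sub_const 1).mul
      (LSeries_hasDerivAt (rC_lt (K := K) hs)).differentiableAt.hasDerivAt
    refine (HasDerivAt.deriv (f := fun z => (z - 1) * LSeries (rC K) z) this).trans ?_
    simp
  have hz0 : LSeries (rC K) s ≠ 0 := right_ne_zero_of_mul_eq_one (zeta_mul_m hs)
  rw [hs2, LamC_eq hs, hd, ← zeta_eq hs, ← hs1]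
  field_simp
  ring

theorem ZK_ne_zero (t : ℝ) : ZK K (1 + I * t) ≠ 0 := by
  have hc : ZK K 1 ≠ 0 := by
    rw [ZK_one]; exact_mod_cast (cK_pos (K := K)).ne'
  by_cases ht : t = 0
  · subst ht; simpa using hc
  have ha : AnalyticAt ℂ (ZK K) (1 + I * t) := ZK_analytic (by simp [etaK_pos K])
  have ha1 : AnalyticAt ℂ (ZK K) (1 + I * (0:ℝ)) := ZK_analytic (by simp [etaK_pos K])
  have h0 := LamC_limit (K := K) 0
  have h1 := LamC_limit (K := K) t
  have h2 := LamC_limit (K := K) (2 * t)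
  have hn0 : analyticOrderNatAt (ZK K) (1 + I * (0:ℝ)) = 0 := by
    rw [analyticOrderNatAt, ha1.analyticOrderAt_eq_zero.2 (by simpa using hc)]; rfl
  have hsum := ((h0.const_mul 3).add (h1.const_mul 4)).add h2
  rw [hn0, if_pos rfl, if_neg ht, if_neg (by simpa using ht)] at hsum
  have hre := (Complex.continuous_re.tendsto _).comp hsum
  have hnn : 0 ≤ (3 * ((1:ℂ) - ((0:ℕ):ℂ)) + 4 * (0 - (analyticOrderNatAt (ZK K) (1 + I * t) : ℂ)) +
      (0 - (analyticOrderNatAt (ZK K) (1 + I * (2 * t : ℝ)) : ℂ))).re := by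
    refine ge_of_tendsto hre ?_
    filter_upwards [self_mem_nhdsWithin] with ε hε
    have hε' : (0:ℝ) < ε := hε
    have h := three_four_one (K := K) (x := 1 + ε) (by linarith) t
    have e : 3 * ((ε : ℂ) * LSeries (LamC K) (((1 + ε : ℝ) : ℂ) + I * (0:ℝ))) +
        4 * ((ε : ℂ) * LSeries (LamC K) (((1 + ε : ℝ) : ℂ) + I * t)) +
        (ε : ℂ) * LSeries (LamC K) (((1 + ε : ℝ) : ℂ) + I * (2 * t : ℝ)) =
        (ε : ℂ) * (3 * LSeries (LamC K) ((1 + ε : ℝ) : ℂ) + 4 * LSeries (LamC K) (((1 + ε : ℝ) : ℂ) + I * t) +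
      LSeries (LamC K) (((1 + ε : ℝ) : ℂ) + I * (2 * t))) := by
      push_cast
      rw [mul_zero, add_zero]; ring
    simp only [Function.comp]
    rw [e, Complex.re_ofReal_mul]
    exact mul_nonneg hε'.le h
  have hcast : (3 - 4 * (analyticOrderNatAt (ZK K) (1 + I * t) : ℝ) -
      (analyticOrderNatAt (ZK K) (1 + I * (2 * t : ℝ)) : ℝ)) =
      (3 * ((1:ℂ) - ((0:ℕ):ℂ)) + 4 * (0 - (analyticOrderNatAt (ZK K) (1 + I * t) : ℂ)) +
      (0 - (analyticOrderNatAt (ZK K) (1 + I * (2 * t : ℝ)) : ℂ))).re := by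
    simp
    ring
  rw [← hcast] at hnn
  have h4 : analyticOrderNatAt (ZK K) (1 + I * t) = 0 := by
    by_contra h
    have h5 : (1:ℝ) ≤ analyticOrderNatAt (ZK K) (1 + I * t) := by
      exact_mod_cast Nat.one_le_iff_ne_zero.2 h
    have h6 : (0:ℝ) ≤ analyticOrderNatAt (ZK K) (1 + I * (2 * t : ℝ)) := by positivity
    linarith
  rw [← ha.analyticOrderAt_eq_zero]
  rw [← Nat.cast_analyticOrderNatAt (ZK_order_ne_top t), h4]
  rfl

theorem ZK_ne_zero' {s : ℂ} (hs : 1 ≤ s.re) : ZK K s ≠ 0 := by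
  rcases hs.lt_or_eq with h | h
  · exact ZK_ne_of_gt h
  · have : s = 1 + I * s.im := by
      apply Complex.ext <;> simp [← h]
    rw [this]
    exact ZK_ne_zero _

end NonVan

section Taub
open Complex MeasureTheory Topology FourierTransform

theorem kernel_exists : ∃ φ : ℝ → ℂ, Continuous φ ∧ HasCompactSupport φ ∧
    Continuous (𝓕 φ) ∧ Integrable (𝓕 φ) ∧ ∫ u, 𝓕 φ u = 1 := by
  let b : ContDiffBump (0:ℝ) := ⟨1, 2, by norm_num, by norm_num⟩
  let φ : ℝ → ℂ := fun x => (b x : ℂ)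
  have h1 : HasCompactSupport φ := b.hasCompactSupport.comp_left (g := fun x : ℝ => (x : ℂ)) (by simp)
  have h2 : ContDiff ℝ (↑(⊤ : ℕ∞)) φ := Complex.ofRealCLM.contDiff.comp b.contDiff
  let ψ := h1.toSchwartzMap h2
  have hψ : (ψ : ℝ → ℂ) = φ := rfl
  have hF : 𝓕 φ = (𝓕 ψ : SchwartzMap ℝ ℂ) := by rw [SchwartzMap.fourier_coe, hψ]
  have hc : Continuous (𝓕 φ) := by rw [hF]; exact SchwartzMap.continuous _
  have hi : Integrable (𝓕 φ) := by rw [hF]; exact SchwartzMap.integrable _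
  refine ⟨φ, h2.continuous, h1, hc, hi, ?_⟩
  have h3 := congrFun (h2.continuous.fourierInv_fourier_eq
    (h2.continuous.integrable_of_hasCompactSupport h1) hi) 0
  rw [Real.fourierInv_eq] at h3
  simp only [inner_zero_right, AddChar.map_zero_eq_one, one_smul] at h3
  rw [h3]
  simp only [φ]
  rw [b.one_of_mem_closedBall (by simp; norm_num)]
  simp

theorem fourier_shift (φ : ℝ → ℂ) (x t : ℝ) :
    𝓕 (fun ξ : ℝ => exp (((2 * Real.pi * ξ * x : ℝ) : ℂ) * I) * φ ξ) t = 𝓕 φ (t - x) := by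
  rw [Real.fourier_real_eq_integral_exp_smul, Real.fourier_real_eq_integral_exp_smul]
  congr 1
  ext ξ
  rw [smul_eq_mul, smul_eq_mul, ← mul_assoc, ← Complex.exp_add]
  congr 2
  push_cast
  ring

theorem lemmaA (f : ℝ → ℂ) (hm : Measurable f) (B : ℝ) (hB : ∀ t, ‖f t‖ ≤ B)
    (h0 : ∀ t < 0, f t = 0) (G : ℂ → ℂ) (hG : ContinuousOn G {w | 0 ≤ w.re})
    (hL : ∀ w : ℂ, 0 < w.re → ∫ t in Set.Ioi (0:ℝ), f t * exp (-w * t) = G w)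
    (φ : ℝ → ℂ) (hφ : Continuous φ) (hφc : HasCompactSupport φ) (hWc : Continuous (𝓕 φ))
    (hWi : Integrable (𝓕 φ)) :
    Tendsto (fun x : ℝ => ∫ t, 𝓕 φ (t - x) * f t) atTop (𝓝 0) := by
  have hB0 : 0 ≤ B := (norm_nonneg _).trans (hB 0)
  have hφi : Integrable φ := hφ.integrable_of_hasCompactSupport hφc
  -- identity for σ > 0
  have key : ∀ x : ℝ, ∀ σ : ℝ, 0 < σ → ∫ t, 𝓕 φ (t - x) * (f t * exp (-(σ:ℂ) * t)) =
      ∫ ξ : ℝ, (exp (((2 * Real.pi * ξ * x : ℝ) : ℂ) * I) * φ ξ) * G (σ + 2 * Real.pi * I * ξ) := by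
    intro x σ hσ
    have hgi : Integrable (fun t : ℝ => f t * exp (-(σ:ℂ) * t)) := by
      have h1 : IntegrableOn (fun t : ℝ => f t * exp (-(σ:ℂ) * t)) (Set.Ioi 0) := by
        have he : IntegrableOn (fun t : ℝ => B * Real.exp (-σ * t)) (Set.Ioi 0) :=
          (integrableOn_exp_mul_Ioi (by linarith : -σ < 0) 0).const_mul B
        refine Integrable.mono' he ?_ (ae_of_all _ fun t => ?_)
        · exact (hm.mul (by fun_prop)).aestronglyMeasurable
        · rw [norm_mul, Complex.norm_exp]
          simp only [neg_mul, neg_re, mul_re, ofReal_re, ofReal_im, mul_zero, sub_zero]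
          exact mul_le_mul_of_nonneg_right (hB t) (Real.exp_nonneg _)
      have h2 : IntegrableOn (fun t : ℝ => f t * exp (-(σ:ℂ) * t)) (Set.Iio 0) := by
        refine integrableOn_zero.congr_fun ?_ measurableSet_Iio
        intro t ht
        simp [h0 t ht]
      have := IntegrableOn.union ((integrableOn_Ici_iff_integrableOn_Ioi (by simp)).2 h1) h2
      rw [Set.union_comm, Set.Iio_union_Ici] at this
      exact integrableOn_univ.1 this
    have hpi : Integrable (fun ξ : ℝ => exp (((2 * Real.pi * ξ * x : ℝ) : ℂ) * I) * φ ξ) := by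
      refine (Continuous.mul (by fun_prop) hφ).integrable_of_hasCompactSupport ?_
      exact hφc.mul_left
    have hflip := VectorFourier.integral_fourierIntegral_smul_eq_flip (L := innerₗ ℝ)
      Real.continuous_fourierChar continuous_inner hpi hgi
    have hflip2 : ∫ t, 𝓕 (fun ξ : ℝ => exp (((2 * Real.pi * ξ * x : ℝ) : ℂ) * I) * φ ξ) t * (f t * exp (-(σ:ℂ) * t)) =
       ∫ ξ : ℝ, (exp (((2 * Real.pi * ξ * x : ℝ) : ℂ) * I) * φ ξ) * 𝓕 (fun t : ℝ => f t * exp (-(σ:ℂ) * t)) ξ := by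
      simpa using! hflip
    simp_rw [fourier_shift] at hflip2
    rw [hflip2]
    congr 1
    ext ξ
    congr 1
    rw [← hL _ (by simp [hσ]), Real.fourier_real_eq_integral_exp_smul]
    rw [← setIntegral_eq_integral_of_forall_compl_eq_zero (s := Set.Ici (0:ℝ)),
      integral_Ici_eq_integral_Ioi]
    · congr 1
      ext t
      rw [smul_eq_mul, mul_left_comm, ← Complex.exp_add]
      congr 2
      push_cast
      ring
    · intro t ht
      rw [h0 t (by simpa using ht)]
      simp
  -- limit σ → 0
  have key0 : ∀ x : ℝ, ∫ t, 𝓕 φ (t - x) * f t =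
      ∫ ξ : ℝ, (exp (((2 * Real.pi * ξ * x : ℝ) : ℂ) * I) * φ ξ) * G (2 * Real.pi * I * ξ) := by
    intro x
    have hl : Tendsto (fun σ : ℝ => ∫ t, 𝓕 φ (t - x) * (f t * exp (-(σ:ℂ) * t))) (𝓝[>] 0)
        (𝓝 (∫ t, 𝓕 φ (t - x) * f t)) := by
      refine tendsto_integral_filter_of_dominated_convergence (fun t => ‖𝓕 φ (t - x)‖ * B) ?_ ?_ ?_ ?_
      · refine Eventually.of_forall fun σ => ?_
        exact (((hWc.comp (continuous_id.sub continuous_const)).measurable).mul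
          (hm.mul (by fun_prop))).aestronglyMeasurable
      · filter_upwards [self_mem_nhdsWithin] with σ hσ
        have hσ' : (0:ℝ) < σ := hσ
        refine ae_of_all _ fun t => ?_
        rw [norm_mul]
        refine mul_le_mul_of_nonneg_left ?_ (norm_nonneg _)
        rcases lt_or_ge t 0 with ht | ht
        · rw [h0 t ht]; simpa using hB0
        · rw [norm_mul, Complex.norm_exp]
          simp only [neg_mul, neg_re, mul_re, ofReal_re, ofReal_im, mul_zero, sub_zero]
          have : Real.exp (-(σ * t)) ≤ 1 := Real.exp_le_one_iff.2 (by nlinarith)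
          calc ‖f t‖ * Real.exp (-(σ * t)) ≤ ‖f t‖ * 1 := by gcongr
            _ ≤ B := by rw [mul_one]; exact hB t
      · exact ((hWi.comp_sub_right x).norm).mul_const B
      · refine ae_of_all _ fun t => ?_
        have : Continuous (fun σ : ℝ => 𝓕 φ (t - x) * (f t * exp (-(σ:ℂ) * t))) := by fun_prop
        have h := this.tendsto 0
        simp only [ofReal_zero, neg_zero, zero_mul, Complex.exp_zero, mul_one] at h
        exact h.mono_left nhdsWithin_le_nhds
    have hr : Tendsto (fun σ : ℝ => ∫ ξ : ℝ, (exp (((2 * Real.pi * ξ * x : ℝ) : ℂ) * I) * φ ξ) * G (σ + 2 * Real.pi * I * ξ))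
        (𝓝[>] 0)
        (𝓝 (∫ ξ : ℝ, (exp (((2 * Real.pi * ξ * x : ℝ) : ℂ) * I) * φ ξ) * G (2 * Real.pi * I * ξ))) := by
      -- bound for G
      have hcont : ContinuousOn (fun p : ℝ × ℝ => G ((p.1 : ℂ) + 2 * Real.pi * I * p.2)) (Set.Ici 0 ×ˢ Set.univ) := by
        refine hG.comp (by fun_prop) ?_
        rintro ⟨a, b⟩ ⟨ha, -⟩
        simpa using ha
      have hK : IsCompact (Set.Icc (0:ℝ) 1 ×ˢ tsupport φ) := isCompact_Icc.prod hφc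
      obtain ⟨M, hM⟩ := hK.exists_bound_of_continuousOn (hcont.mono (Set.prod_mono
        (fun a ha => ha.1) (Set.subset_univ _)))
      refine tendsto_integral_filter_of_dominated_convergence (fun ξ => ‖φ ξ‖ * M) ?_ ?_ ?_ ?_
      · filter_upwards [self_mem_nhdsWithin] with σ hσ
        have hσ' : (0:ℝ) < σ := hσ
        refine Continuous.aestronglyMeasurable ?_
        refine Continuous.mul (Continuous.mul (by fun_prop) hφ) ?_
        refine hG.comp_continuous (by fun_prop) fun ξ => ?_
        simpa using hσ'.le
      · filter_upwards [Ioc_mem_nhdsGT (zero_lt_one : (0:ℝ) < 1)] with σ hσ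
        refine ae_of_all _ fun ξ => ?_
        rw [norm_mul, norm_mul, Complex.norm_exp_ofReal_mul_I, one_mul]
        by_cases hξ : φ ξ = 0
        · simp [hξ]
        · refine mul_le_mul_of_nonneg_left ?_ (norm_nonneg _)
          exact hM (σ, ξ) ⟨⟨hσ.1.le, hσ.2⟩, subset_tsupport φ hξ⟩
      · exact hφi.norm.mul_const M
      · refine ae_of_all _ fun ξ => ?_
        refine Tendsto.mul tendsto_const_nhds ?_
        have hw := hcont (0, ξ) ⟨Set.self_mem_Ici, trivial⟩
        have hp : Tendsto (fun σ : ℝ => (σ, ξ)) (𝓝[>] 0) (𝓝[Set.Ici 0 ×ˢ Set.univ] (0, ξ)) := by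
          refine tendsto_nhdsWithin_iff.2 ⟨?_, ?_⟩
          · have : Continuous (fun σ : ℝ => (σ, ξ)) := by fun_prop
            exact (this.tendsto 0).mono_left nhdsWithin_le_nhds
          · filter_upwards [self_mem_nhdsWithin] with σ hσ
            exact ⟨Set.mem_Ici.2 (le_of_lt hσ), trivial⟩
        have := hw.tendsto.comp hp
        simpa [Function.comp_def] using this
    refine tendsto_nhds_unique hl (hr.congr' ?_)
    filter_upwards [self_mem_nhdsWithin] with σ hσ
    exact (key x σ hσ).symm
  -- Riemann-Lebesgue
  have hRL := Real.zero_at_infty_fourier (fun ξ : ℝ => φ ξ * G (2 * Real.pi * I * ξ))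
  have hneg : Tendsto (fun x : ℝ => -x) atTop (cocompact ℝ) :=
    tendsto_neg_atTop_atBot.mono_right atBot_le_cocompact
  refine (hRL.comp hneg).congr fun x => ?_
  rw [key0 x]
  simp only [Function.comp]
  rw [Real.fourier_real_eq_integral_exp_smul]
  congr 1
  ext ξ
  rw [smul_eq_mul, ← mul_assoc]
  congr 3
  push_cast
  ring

theorem tauberian (f : ℝ → ℂ) (hm : Measurable f) (B : ℝ) (hB : ∀ t, ‖f t‖ ≤ B)
    (h0 : ∀ t < 0, f t = 0) (G : ℂ → ℂ) (hG : ContinuousOn G {w | 0 ≤ w.re})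
    (hL : ∀ w : ℂ, 0 < w.re → ∫ t in Set.Ioi (0:ℝ), f t * exp (-w * t) = G w)
    (hosc : ∀ ε > 0, ∃ δ > 0, ∀ᶠ x in atTop, ∀ h : ℝ, |h| ≤ δ → ‖f (x + h) - f x‖ ≤ ε) :
    Tendsto f atTop (𝓝 0) := by
  have hB0 : 0 ≤ B := (norm_nonneg _).trans (hB 0)
  obtain ⟨φ, hφ, hφc, hWc, hWi, hW1⟩ := kernel_exists
  set W := 𝓕 φ with hW
  -- scaled version
  have hscaled : ∀ l : ℝ, 0 < l → Tendsto (fun x : ℝ => ∫ u, W u * f (x + u / l)) atTop (𝓝 0) := by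
    intro l hl
    have hA := lemmaA (fun t => f (t / l)) (hm.comp (measurable_id.div_const l)) B (fun t => hB _)
      (fun t ht => h0 _ (div_neg_of_neg_of_pos ht hl)) (fun w => l * G (l * w))
      (continuousOn_const.mul (hG.comp (by fun_prop) (fun w hw => by
        simp only [Set.mem_ofPred_eq, re_ofReal_mul]; exact mul_nonneg hl.le hw)))
      (fun w hw => by
        have h1 := hL (l * w) (by rw [re_ofReal_mul]; positivity)
        have h2 := integral_comp_mul_left_Ioi (fun t : ℝ => f (t / l) * exp (-w * t)) 0 hl
        rw [mul_zero] at h2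
        rw [← h1]
        have h3 : (fun x : ℝ => f (l * x / l) * exp (-w * ((l * x : ℝ) : ℂ))) =
            fun t : ℝ => f t * exp (-(l * w) * t) := by
          ext t
          rw [mul_div_cancel_left₀ _ hl.ne']
          congr 2
          push_cast; ring
        rw [h3] at h2
        rw [h2, Complex.real_smul, ← mul_assoc]
        have : (l : ℂ) ≠ 0 := by exact_mod_cast hl.ne'
        push_cast
        rw [mul_inv_cancel₀ this, one_mul])
      φ hφ hφc hWc hWi
    have hl' : Tendsto (fun x : ℝ => l * x) atTop atTop := tendsto_id.const_mul_atTop hl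
    refine (hA.comp hl').congr fun x => ?_
    simp only [Function.comp]
    rw [← integral_add_right_eq_self (fun t => 𝓕 φ (t - l * x) * f (t / l)) (l * x)]
    congr 1
    ext u
    rw [add_sub_cancel_right, add_div, mul_div_cancel_left₀ _ hl.ne', add_comm]
  set N := ∫ u, ‖W u‖ with hN
  have hN0 : 0 ≤ N := integral_nonneg fun _ => norm_nonneg _
  rw [Metric.tendsto_nhds]
  intro ε hε
  set ε1 := ε / (2 * (N + 2 * B + 1)) with hε1
  have hden : 0 < N + 2 * B + 1 := by positivity
  have hε1p : 0 < ε1 := by positivity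
  obtain ⟨δ, hδ, hosc1⟩ := hosc ε1 hε1p
  -- tail
  obtain ⟨R, hR, htail⟩ : ∃ R : ℝ, 0 < R ∧ ∫ u in (Set.Icc (-R) R)ᶜ, ‖W u‖ < ε1 := by
    have ht : Tendsto (fun R : ℝ => ∫ u in Set.Icc (-R) R, ‖W u‖) atTop (𝓝 N) := by
      have := (aecover_Icc (μ := volume) (l := atTop) (a := fun R : ℝ => -R) (b := fun R : ℝ => R)
        tendsto_neg_atTop_atBot tendsto_id).integral_tendsto_of_countably_generated hWi.norm
      exact this
    have h1 := (Metric.tendsto_nhds.1 ht ε1 hε1p).and (eventually_gt_atTop 0)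
    obtain ⟨R, hR1, hR2⟩ := h1.exists
    refine ⟨R, hR2, ?_⟩
    have h2 := integral_add_compl (measurableSet_Icc (a := -R) (b := R)) hWi.norm
    rw [Real.dist_eq] at hR1
    have := (abs_lt.1 hR1).1
    linarith
  set l := R / δ with hl
  have hlp : 0 < l := by positivity
  have hs := Metric.tendsto_nhds.1 (hscaled l hlp) (ε / 2) (by positivity)
  filter_upwards [hs, hosc1] with x hx1 hx2
  rw [dist_zero_right] at hx1 ⊢
  have hfW : Integrable (fun u => W u * f (x + u / l)) := by
    refine hWi.mul_bdd (c := B) ?_ (ae_of_all _ fun u => hB _)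
    exact (hm.comp (by fun_prop)).aestronglyMeasurable
  have e1 : f x = (∫ u, W u * f (x + u / l)) + ∫ u, W u * (f x - f (x + u / l)) := by
    rw [← integral_add hfW]
    · have : ∀ u, W u * f (x + u / l) + W u * (f x - f (x + u / l)) = W u * f x := fun u => by ring
      simp_rw [this]
      rw [integral_mul_const, hW1, one_mul]
    · have := (hWi.mul_const (f x)).sub hfW
      refine this.congr (ae_of_all _ fun u => ?_)
      simp only [Pi.sub_apply]; ring
  have hgi : Integrable (fun u => ‖W u‖ * ‖f x - f (x + u / l)‖) := by
    refine hWi.norm.mul_bdd (c := 2 * B) ?_ (ae_of_all _ fun u => ?_)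
    · exact ((measurable_const.sub (hm.comp (by fun_prop))).norm).aestronglyMeasurable
    · rw [norm_norm]
      exact (norm_sub_le _ _).trans (by linarith [hB x, hB (x + u / l)])
  have e2 : ‖∫ u, W u * (f x - f (x + u / l))‖ ≤ ε1 * N + 2 * B * ε1 := by
    calc ‖∫ u, W u * (f x - f (x + u / l))‖ ≤ ∫ u, ‖W u‖ * ‖f x - f (x + u / l)‖ := by
          refine (norm_integral_le_integral_norm _).trans (le_of_eq ?_)
          simp_rw [norm_mul]
      _ = (∫ u in Set.Icc (-R) R, ‖W u‖ * ‖f x - f (x + u / l)‖) +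
          ∫ u in (Set.Icc (-R) R)ᶜ, ‖W u‖ * ‖f x - f (x + u / l)‖ :=
          (integral_add_compl measurableSet_Icc hgi).symm
      _ ≤ (∫ u in Set.Icc (-R) R, ‖W u‖ * ε1) + ∫ u in (Set.Icc (-R) R)ᶜ, ‖W u‖ * (2 * B) := by
          refine add_le_add ?_ ?_
          · refine setIntegral_mono_on hgi.integrableOn (hWi.norm.mul_const _).integrableOn
              measurableSet_Icc fun u hu => ?_
            refine mul_le_mul_of_nonneg_left ?_ (norm_nonneg _)
            rw [norm_sub_rev]
            refine hx2 _ ?_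
            rw [abs_div, abs_of_pos hlp, div_le_iff₀ hlp, hl, mul_div_cancel₀ _ hδ.ne']
            exact abs_le.2 hu
          · refine setIntegral_mono_on hgi.integrableOn (hWi.norm.mul_const _).integrableOn
              measurableSet_Icc.compl fun u hu => ?_
            refine mul_le_mul_of_nonneg_left ?_ (norm_nonneg _)
            exact (norm_sub_le _ _).trans (by linarith [hB x, hB (x + u / l)])
      _ ≤ ε1 * N + 2 * B * ε1 := by
          rw [integral_mul_const, integral_mul_const]
          have h1 : ∫ u in Set.Icc (-R) R, ‖W u‖ ≤ N :=
            setIntegral_le_integral hWi.norm (ae_of_all _ fun _ => norm_nonneg _)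
          have h2 := mul_le_mul_of_nonneg_right h1 hε1p.le
          have h3 := mul_le_mul_of_nonneg_right htail.le (by positivity : 0 ≤ 2 * B)
          linarith
  have e3 : ε1 * N + 2 * B * ε1 < ε / 2 := by
    have : ε1 * (N + 2 * B + 1) = ε / 2 := by rw [hε1]; field_simp
    nlinarith
  calc ‖f x‖ ≤ ‖∫ u, W u * f (x + u / l)‖ + ‖∫ u, W u * (f x - f (x + u / l))‖ := by
        conv_lhs => rw [e1]
        exact norm_add_le _ _
    _ < ε := by linarith

end Taub

section MBound
open LSeries Complex MeasureTheory Asymptotics Topology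
variable {K}

theorem AK_asymp : Tendsto (fun x : ℝ => AK K x / x) atTop (𝓝 (cK K)) := by
  obtain ⟨C, hC, h⟩ := EK_bd K
  have h1 : Tendsto (fun x : ℝ => C * x ^ (-etaK K)) atTop (𝓝 0) := by
    simpa using (tendsto_rpow_neg_atTop (etaK_pos K)).const_mul C
  rw [tendsto_iff_norm_sub_tendsto_zero]
  refine squeeze_zero' (Eventually.of_forall fun _ => norm_nonneg _) ?_ h1
  filter_upwards [eventually_ge_atTop 1] with x hx
  have hx0 : 0 < x := by linarith
  have h2 := h x hx
  have e : AK K x / x - cK K = EK K x / x := by rw [EK]; field_simp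
  rw [e, Real.norm_eq_abs, abs_div, abs_of_pos hx0, div_le_iff₀ hx0]
  refine h2.trans (le_of_eq ?_)
  rw [mul_assoc, ← Real.rpow_add_one hx0.ne']
  ring_nf

theorem AK_nonneg (x : ℝ) : 0 ≤ AK K x := by unfold AK; positivity

variable (K) in
def MK (x : ℝ) : ℝ := ∑ a ∈ BK K x, (muK K a : ℝ)

theorem MK_diff {x y : ℝ} (h : x ≤ y) : |MK K y - MK K x| ≤ AK K y - AK K x := by
  classical
  rw [MK, MK, ← Finset.sum_sdiff (BK_mono h), add_sub_cancel_right]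
  refine (Finset.abs_sum_le_sum_abs _ _).trans ?_
  refine (Finset.sum_le_sum fun a _ => abs_muK_le a).trans (le_of_eq ?_)
  rw [AK, AK, ← Finset.card_sdiff_add_card_eq_card (BK_mono h)]
  simp

theorem MK_le (x : ℝ) : |MK K x| ≤ AK K x := by
  rw [MK]
  refine (Finset.abs_sum_le_sum_abs _ _).trans ?_
  refine (Finset.sum_le_sum fun a _ => abs_muK_le a).trans (le_of_eq ?_)
  simp [AK]

theorem MK_measurable : Measurable (MK K) := by
  have : MK K = fun x => (fun n : ℕ => ∑ k ∈ Finset.Icc 1 n, coef (fun a => (muK K a : ℝ)) k) ⌊x⌋₊ := by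
    ext x
    exact (sum_coef _ _).symm
  rw [this]
  exact (measurable_from_nat (f := fun n : ℕ => ∑ k ∈ Finset.Icc 1 n, coef (fun a => (muK K a : ℝ)) k)).comp
    (Nat.measurable_floor (R := ℝ))

variable (K) in
def fM (t : ℝ) : ℝ := MK K (Real.exp t) * Real.exp (-t)

theorem fM_step {B : ℝ} (hB : ∀ x : ℝ, 0 ≤ x → AK K x ≤ B * x) {a b : ℝ} (hab : a ≤ b) :
    |fM K b - fM K a| ≤ |AK K (Real.exp b) / Real.exp b - AK K (Real.exp a) / Real.exp a|
      + 2 * B * (b - a) := by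
  have hea := Real.exp_pos a
  have heb := Real.exp_pos b
  have hle := Real.exp_le_exp.2 hab
  have h1 := MK_diff (K := K) hle
  have h2 := MK_le (K := K) (Real.exp a)
  have h3 := hB (Real.exp a) hea.le
  have h4 : 0 ≤ AK K (Real.exp a) := AK_nonneg _
  have hinv : Real.exp (-b) ≤ Real.exp (-a) := Real.exp_le_exp.2 (by linarith)
  have e : fM K b - fM K a = (MK K (Real.exp b) - MK K (Real.exp a)) * Real.exp (-b) +
      MK K (Real.exp a) * (Real.exp (-b) - Real.exp (-a)) := by
    rw [fM, fM]; ring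
  have h5 : |fM K b - fM K a| ≤ (AK K (Real.exp b) - AK K (Real.exp a)) * Real.exp (-b) +
      AK K (Real.exp a) * (Real.exp (-a) - Real.exp (-b)) := by
    rw [e]
    refine (abs_add_le _ _).trans (add_le_add ?_ ?_)
    · rw [abs_mul, abs_of_pos (Real.exp_pos (-b))]
      exact mul_le_mul_of_nonneg_right h1 (Real.exp_nonneg _)
    · rw [abs_mul, abs_sub_comm, abs_of_nonneg (sub_nonneg.2 hinv)]
      exact mul_le_mul_of_nonneg_right h2 (sub_nonneg.2 hinv)
  have h6 : Real.exp (-a) - Real.exp (-b) ≤ Real.exp (-a) * (b - a) := by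
    have : Real.exp (-b) = Real.exp (-a) * Real.exp (-(b - a)) := by
      rw [← Real.exp_add]; ring_nf
    rw [this]
    have := Real.add_one_le_exp (-(b - a))
    nlinarith [Real.exp_pos (-a)]
  have h7 : AK K (Real.exp a) * (Real.exp (-a) - Real.exp (-b)) ≤ B * (b - a) := by
    calc AK K (Real.exp a) * (Real.exp (-a) - Real.exp (-b))
        ≤ AK K (Real.exp a) * (Real.exp (-a) * (b - a)) := mul_le_mul_of_nonneg_left h6 h4
      _ ≤ (B * Real.exp a) * (Real.exp (-a) * (b - a)) :=
          mul_le_mul_of_nonneg_right h3 (mul_nonneg (Real.exp_nonneg _) (by linarith))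
      _ = B * (b - a) * (Real.exp a * Real.exp (-a)) := by ring
      _ = B * (b - a) := by rw [← Real.exp_add]; simp
  have h8 := le_abs_self (AK K (Real.exp b) / Real.exp b - AK K (Real.exp a) / Real.exp a)
  rw [div_eq_mul_inv, div_eq_mul_inv, ← Real.exp_neg, ← Real.exp_neg] at h8 ⊢
  nlinarith

theorem fM_laplace {w : ℂ} (hw : 0 < w.re) :
    ∫ t in Set.Ioi (0:ℝ), (fM K t : ℂ) * exp (-w * t) = w / ((1 + w) * ZK K (1 + w)) := by
  have hs : 1 < (1 + w).re := by simpa using hw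
  have hL := LSeries_eq_mul_integral' (mC K) (r := 1) zero_le_one hs (coef_bigO abs_muK_le)
  have hsum : ∀ t : ℝ, ∑ k ∈ Finset.Icc 1 ⌊t⌋₊, mC K k = (MK K t : ℂ) := by
    intro t
    simp only [mC]
    rw [← Complex.ofReal_sum, sum_coef, MK]
  simp_rw [hsum] at hL
  have him : Real.exp '' (Set.Ioi 0) = Set.Ioi (1:ℝ) := by
    ext y
    constructor
    · rintro ⟨t, ht, rfl⟩; exact Real.one_lt_exp_iff.2 ht
    · intro hy
      exact ⟨Real.log y, Real.log_pos hy, Real.exp_log (one_pos.trans hy)⟩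
  have hcv := integral_image_eq_integral_abs_deriv_smul (s := Set.Ioi (0:ℝ)) (f := Real.exp)
    (f' := Real.exp) measurableSet_Ioi (fun x _ => (Real.hasDerivAt_exp x).hasDerivWithinAt)
    (Real.exp_injective.injOn) (fun t : ℝ => (MK K t : ℂ) * (t : ℂ) ^ (-(1 + w + 1)))
  rw [him] at hcv
  rw [hcv] at hL
  have e : ∀ t : ℝ, |Real.exp t| • ((MK K (Real.exp t) : ℂ) * ((Real.exp t : ℝ) : ℂ) ^ (-(1 + w + 1))) =
      (fM K t : ℂ) * exp (-w * t) := by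
    intro t
    rw [abs_of_pos (Real.exp_pos t), Complex.real_smul, fM]
    have h0 : ((Real.exp t : ℝ) : ℂ) ≠ 0 := by exact_mod_cast (Real.exp_pos t).ne'
    rw [Complex.cpow_def_of_ne_zero h0, ← Complex.ofReal_log (Real.exp_pos t).le, Real.log_exp]
    push_cast
    rw [mul_left_comm, ← Complex.exp_add, mul_assoc, ← Complex.exp_add]
    ring_nf
  simp_rw [e] at hL
  have hz := zeta_eq (K := K) hs
  have hm := zeta_mul_m (K := K) hs
  have hr : LSeries (rC K) (1 + w) ≠ 0 := right_ne_zero_of_mul_eq_one hm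
  rw [add_sub_cancel_left] at hz
  have hw0 : w ≠ 0 := by rintro rfl; simp at hw
  have hw1 : 1 + w ≠ 0 := by
    intro h
    rw [h] at hs
    simp at hs
    linarith
  rw [← hz]
  rw [hL] at hm
  generalize (∫ t in Set.Ioi (0:ℝ), (fM K t : ℂ) * exp (-w * t)) = J at hm ⊢
  field_simp
  linear_combination hm

theorem MK_littleo : Tendsto (fun x : ℝ => MK K x / x) atTop (𝓝 0) := by
  obtain ⟨B, hB0, hB⟩ := count_le K
  have hB' : ∀ x : ℝ, 0 ≤ x → AK K x ≤ B * x := hB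
  have hT : Tendsto (fun t => (fM K t : ℂ)) atTop (𝓝 0) := by
    refine tauberian (fun t => (fM K t : ℂ)) ?_ B ?_ ?_ (fun w => w / ((1 + w) * ZK K (1 + w))) ?_
      (fun w hw => fM_laplace hw) ?_
    · have : Measurable (fM K) :=
        (MK_measurable.comp Real.measurable_exp).mul (Real.measurable_exp.comp measurable_neg)
      exact Complex.measurable_ofReal.comp this
    · intro t
      rw [Complex.norm_real, Real.norm_eq_abs, fM, abs_mul, abs_of_pos (Real.exp_pos _)]
      calc |MK K (Real.exp t)| * Real.exp (-t) ≤ (B * Real.exp t) * Real.exp (-t) :=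
            mul_le_mul_of_nonneg_right ((MK_le _).trans (hB' _ (Real.exp_nonneg _))) (Real.exp_nonneg _)
        _ = B := by rw [mul_assoc, ← Real.exp_add]; simp
    · intro t ht
      rw [fM, MK, BK_card_zero (Real.exp_lt_one_iff.2 ht)]
      simp
    · intro w hw
      have hw' : 0 ≤ w.re := hw
      refine ContinuousAt.continuousWithinAt ?_
      have h1 : (1:ℝ) ≤ (1 + w).re := by simpa using hw'
      have hz := ZK_ne_zero' (K := K) h1
      have hzc : ContinuousAt (fun w => ZK K (1 + w)) w :=
        ContinuousAt.comp (g := ZK K) (ZK_diff (by linarith [etaK_pos K])).continuousAt (by fun_prop)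
      refine continuousAt_id.div (ContinuousAt.mul (by fun_prop) hzc) (mul_ne_zero ?_ hz)
      intro h
      rw [h] at h1
      simp at h1
      linarith
    · intro ε hε
      have hρ := Metric.tendsto_atTop.1 (AK_asymp (K := K)) (ε / 4) (by positivity)
      obtain ⟨T, hT⟩ := hρ
      refine ⟨ε / (4 * B), by positivity, ?_⟩
      have hev : ∀ᶠ x : ℝ in atTop, T ≤ Real.exp (x - ε / (4 * B)) :=
        (Real.tendsto_exp_atTop.comp (tendsto_atTop_add_const_right _ _ tendsto_id)).eventually_ge_atTop T
      filter_upwards [hev] with x hx h hh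
      have hh' := abs_le.1 hh
      have key : ∀ a b : ℝ, a ≤ b → x - ε / (4 * B) ≤ a → b - a ≤ ε / (4 * B) → |fM K b - fM K a| ≤ ε := by
        intro a b hab ha hba
        refine (fM_step hB' hab).trans ?_
        have h1 := hT (Real.exp a) (hx.trans (Real.exp_le_exp.2 ha))
        have h2 := hT (Real.exp b) (hx.trans (Real.exp_le_exp.2 (ha.trans hab)))
        rw [Real.dist_eq] at h1 h2
        have h3 : |AK K (Real.exp b) / Real.exp b - AK K (Real.exp a) / Real.exp a| ≤ ε / 2 := by
          rw [abs_lt] at h1 h2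
          rw [abs_le]
          constructor <;> linarith [h1.1, h1.2, h2.1, h2.2]
        have h4 : 2 * B * (b - a) ≤ 2 * B * (ε / (4 * B)) := by gcongr
        have h5 : 2 * B * (ε / (4 * B)) = ε / 2 := by field_simp; ring
        linarith
      rw [← Complex.ofReal_sub, Complex.norm_real, Real.norm_eq_abs]
      rcases le_total 0 h with h0 | h0
      · exact key x (x + h) (by linarith) (by linarith [hh'.2]) (by linarith [hh'.2])
      · rw [abs_sub_comm]
        exact key (x + h) x (by linarith) (by linarith [hh'.1]) (by linarith [hh'.1])
  have hT' : Tendsto (fM K) atTop (𝓝 0) := by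
    have := (Complex.continuous_re.tendsto _).comp hT
    simpa [Function.comp_def] using this
  refine (hT'.comp Real.tendsto_log_atTop).congr' ?_
  filter_upwards [eventually_gt_atTop 0] with x hx
  simp only [Function.comp, fM]
  rw [Real.exp_log hx, Real.exp_neg, Real.exp_log hx]
  rfl

end MBound

section Sieve
open Topology
variable {K}

theorem two_le_absNorm {p : Ideal (𝓞 K)} (hp : Prime p) : (2:ℝ) ≤ absNorm p := by
  have h0 := absNorm_pos' hp.ne_zero
  have h1 : absNorm p ≠ 1 := by
    rw [Ne, Ideal.absNorm_eq_one_iff]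
    intro h
    exact hp.not_isUnit (by rw [h, ← Ideal.one_eq_top]; exact isUnit_one)
  have : 2 ≤ absNorm p := by omega
  exact_mod_cast this

theorem prime_dvd_prime {p q : Ideal (𝓞 K)} (hp : Prime p) (hq : Prime q) (h : p ∣ q) : p = q :=
  associated_iff_eq.1 (hp.associated_of_dvd hq h)

open Classical in
theorem muK_mul_prime {p e : Ideal (𝓞 K)} (hp : Prime p) (he : e ≠ ⊥) :
    muK K (p * e) = if p ∣ e then 0 else -muK K e := by
  have hpe : p * e ≠ ⊥ := mul_ne_zero hp.ne_zero he
  split_ifs with h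
  · rw [muK_eq hpe, if_neg]
    intro hs
    exact hp.not_isUnit (hs p (mul_dvd_mul_left p h))
  · by_cases hs : Squarefree e
    · have hU : ∀ q ∈ insert p (primesOf e), Prime q := by
        intro q hq
        rcases Finset.mem_insert.1 hq with rfl | hq
        · exact hp
        · exact ((mem_primesOf he).1 hq).1
      have hn : p ∉ primesOf e := fun h' => h ((mem_primesOf he).1 h').2
      have e1 : ∏ q ∈ insert p (primesOf e), q = p * e := by
        rw [Finset.prod_insert hn, prod_primesOf he hs]
      rw [← e1, muK_prod hU, Finset.card_insert_of_notMem hn, muK_eq he, if_pos hs, pow_succ]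
      ring
    · rw [muK_eq he, if_neg hs, muK_eq hpe, if_neg]
      · simp
      · intro h'
        exact hs (h'.squarefree_of_dvd (Dvd.intro_left p rfl))

/-- coprimality to a set of primes -/
def cop (P : Finset (Ideal (𝓞 K))) (a : Ideal (𝓞 K)) : Prop := ∀ p ∈ P, ¬ p ∣ a

theorem cop_insert [DecidableEq (Ideal (𝓞 K))] {P : Finset (Ideal (𝓞 K))} {p a : Ideal (𝓞 K)} :
    cop (insert p P) a ↔ ¬ p ∣ a ∧ cop P a := by
  simp [cop]

theorem cop_mul {P : Finset (Ideal (𝓞 K))} (hP : ∀ q ∈ P, Prime q) {p e : Ideal (𝓞 K)}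
    (hp : Prime p) (hn : p ∉ P) : cop P (p * e) ↔ cop P e := by
  unfold cop
  refine forall₂_congr fun q hq => not_congr ?_
  constructor
  · intro h
    rcases (hP q hq).dvd_or_dvd h with h | h
    · exact absurd (prime_dvd_prime (hP q hq) hp h ▸ hq) hn
    · exact h
  · intro h; exact h.mul_left p

open Classical in
/-- sum over ideals coprime to `P` -/
def SP (f : Ideal (𝓞 K) → ℝ) (P : Finset (Ideal (𝓞 K))) (x : ℝ) : ℝ :=
  ∑ a ∈ BK K x, if cop P a then f a else 0

open Classical in
theorem SP_step (f : Ideal (𝓞 K) → ℝ) {P : Finset (Ideal (𝓞 K))} (hP : ∀ q ∈ P, Prime q)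
    {p : Ideal (𝓞 K)} (hp : Prime p) (hn : p ∉ P) (x : ℝ) :
    SP f P x = SP f (insert p P) x + SP (fun e => f (p * e)) P (x / absNorm p) := by
  unfold SP
  rw [← Finset.sum_filter_not_add_sum_filter (BK K x) (fun a => p ∣ a)]
  congr 1
  · rw [Finset.sum_filter]
    refine Finset.sum_congr rfl fun a _ => ?_
    rw [← ite_and]
    simp only [cop_insert]
  · rw [sum_BK_dvd hp.ne_zero]
    refine Finset.sum_congr rfl fun a _ => ?_
    simp only [cop_mul hP hp hn]

variable (K) in
def MP (P : Finset (Ideal (𝓞 K))) (x : ℝ) : ℝ := SP (fun a => (muK K a : ℝ)) P x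
variable (K) in
def AP (P : Finset (Ideal (𝓞 K))) (x : ℝ) : ℝ := SP (fun _ => (1:ℝ)) P x

open Classical in
theorem AP_step {P : Finset (Ideal (𝓞 K))} (hP : ∀ q ∈ P, Prime q)
    {p : Ideal (𝓞 K)} (hp : Prime p) (hn : p ∉ P) (x : ℝ) :
    AP K (insert p P) x = AP K P x - AP K P (x / absNorm p) := by
  have := SP_step (fun _ => (1:ℝ)) hP hp hn x
  unfold AP
  linarith

open Classical in
theorem MP_step {P : Finset (Ideal (𝓞 K))} (hP : ∀ q ∈ P, Prime q)
    {p : Ideal (𝓞 K)} (hp : Prime p) (hn : p ∉ P) (x : ℝ) :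
    MP K (insert p P) x = MP K P x + MP K (insert p P) (x / absNorm p) := by
  have h := SP_step (fun a => (muK K a : ℝ)) hP hp hn x
  have h2 : SP (fun e => (muK K (p * e) : ℝ)) P (x / absNorm p) = - MP K (insert p P) (x / absNorm p) := by
    unfold MP SP
    rw [← Finset.sum_neg_distrib]
    refine Finset.sum_congr rfl fun a ha => ?_
    beta_reduce
    rw [muK_mul_prime hp (mem_BK.1 ha).1]
    by_cases h1 : p ∣ a <;> by_cases h2 : cop P a <;> simp [h1, h2, cop_insert]
  unfold MP at *
  linarith

theorem SP_abs_le {f : Ideal (𝓞 K) → ℝ} (hf : ∀ a, |f a| ≤ 1) (P : Finset (Ideal (𝓞 K))) (x : ℝ) :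
    |SP f P x| ≤ AP K P x := by
  unfold AP SP
  refine (Finset.abs_sum_le_sum_abs _ _).trans (Finset.sum_le_sum fun a _ => ?_)
  split_ifs
  · exact hf a
  · simp

theorem AP_le (P : Finset (Ideal (𝓞 K))) (x : ℝ) : AP K P x ≤ AK K x := by
  have : AK K x = ∑ a ∈ BK K x, (1:ℝ) := by simp [AK]
  rw [this]
  unfold AP SP
  refine Finset.sum_le_sum fun a _ => ?_
  split_ifs <;> simp

theorem AP_empty (x : ℝ) : AP K ∅ x = AK K x := by
  simp [AP, SP, cop, AK]

theorem MP_empty (x : ℝ) : MP K ∅ x = MK K x := by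
  simp [MP, SP, cop, MK]

theorem AP_nonneg (P : Finset (Ideal (𝓞 K))) (x : ℝ) : 0 ≤ AP K P x :=
  (abs_nonneg _).trans (SP_abs_le (f := fun _ => (1:ℝ)) (fun _ => by simp) P x)

theorem tendsto_comp_div {f : ℝ → ℝ} {n L : ℝ} (hn : 0 < n)
    (h : Tendsto (fun x : ℝ => f x / x) atTop (𝓝 L)) :
    Tendsto (fun x : ℝ => f (x / n) / x) atTop (𝓝 (L / n)) := by
  have h1 := (h.comp (tendsto_id.atTop_div_const hn)).div_const n
  refine h1.congr fun x => ?_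
  simp only [Function.comp, id]
  rcases eq_or_ne x 0 with rfl | hx
  · simp
  · field_simp

theorem AP_lim (P : Finset (Ideal (𝓞 K))) (hP : ∀ q ∈ P, Prime q) :
    ∃ d : ℝ, Tendsto (fun x : ℝ => AP K P x / x) atTop (𝓝 d) := by
  classical
  induction P using Finset.induction_on with
  | empty => exact ⟨cK K, by simpa only [AP_empty] using AK_asymp⟩
  | insert p P hn ih =>
    have hP' : ∀ q ∈ P, Prime q := fun q hq => hP q (Finset.mem_insert_of_mem hq)
    have hp := hP p (Finset.mem_insert_self _ _)
    obtain ⟨d, hd⟩ := ih hP'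
    refine ⟨d - d / absNorm p, ?_⟩
    refine (hd.sub (tendsto_comp_div (absNorm_posR hp.ne_zero) hd)).congr fun x => ?_
    rw [AP_step hP' hp hn, sub_div]

theorem littleo_rec {f g : ℝ → ℝ} {n B : ℝ} (hn : 2 ≤ n) (hB : 0 ≤ B)
    (hf : ∀ x, 0 ≤ x → |f x| ≤ B * x)
    (hfg : ∀ x, f x = g x + f (x / n)) (hg : Tendsto (fun x : ℝ => g x / x) atTop (𝓝 0)) :
    Tendsto (fun x : ℝ => f x / x) atTop (𝓝 0) := by
  have key : ∀ k : ℕ, ∀ ε > 0, ∀ᶠ x : ℝ in atTop, |f x| ≤ (B / 2 ^ k + ε) * x := by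
    intro k
    induction k with
    | zero =>
      intro ε hε
      filter_upwards [eventually_ge_atTop 0] with x hx
      have := hf x hx
      simp only [pow_zero, div_one]
      nlinarith
    | succ k ih =>
      intro ε hε
      have hn0 : 0 < n := by linarith
      have h1 := (tendsto_id.atTop_div_const hn0).eventually (ih ε hε)
      have h2 := (Metric.tendsto_nhds.1 hg) (ε / 2) (by positivity)
      filter_upwards [h1, h2, eventually_gt_atTop 0] with x h1 h2 hx
      simp only [id] at h1
      rw [Real.dist_eq, sub_zero, abs_div, abs_of_pos hx, div_lt_iff₀ hx] at h2
      rw [hfg]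
      have h3 : x / n ≤ x / 2 := by gcongr
      have h4 : (B / 2 ^ k + ε) * (x / n) ≤ (B / 2 ^ k + ε) * (x / 2) := by gcongr
      have e : B / 2 ^ (k+1) = B / 2 ^ k / 2 := by rw [pow_succ, div_div]
      rw [e]
      refine (abs_add_le _ _).trans ?_
      linarith
  rw [Metric.tendsto_nhds]
  intro ε hε
  have : Tendsto (fun k : ℕ => B / 2 ^ k) atTop (𝓝 0) :=
    tendsto_const_nhds.div_atTop (tendsto_pow_atTop_atTop_of_one_lt (by norm_num))
  obtain ⟨k, hk⟩ := (this.eventually_lt_const (show (0:ℝ) < ε / 2 by positivity)).exists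
  filter_upwards [key k (ε / 2) (by positivity), eventually_gt_atTop 0] with x h hx
  rw [Real.dist_eq, sub_zero, abs_div, abs_of_pos hx, div_lt_iff₀ hx]
  refine h.trans_lt ?_
  gcongr
  linarith

theorem MP_lim (P : Finset (Ideal (𝓞 K))) (hP : ∀ q ∈ P, Prime q) :
    Tendsto (fun x : ℝ => MP K P x / x) atTop (𝓝 0) := by
  classical
  obtain ⟨B, hB0, hB⟩ := count_le K
  induction P using Finset.induction_on with
  | empty => simpa only [MP_empty] using MK_littleo
  | insert p P hn ih =>
    have hP' : ∀ q ∈ P, Prime q := fun q hq => hP q (Finset.mem_insert_of_mem hq)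
    have hp := hP p (Finset.mem_insert_self _ _)
    refine littleo_rec (two_le_absNorm hp) hB0.le (fun x hx => ?_) (MP_step hP' hp hn) (ih hP')
    exact (SP_abs_le abs_muK_le _ _).trans ((AP_le _ _).trans (hB x hx))

open Classical in
variable (K) in
/-- primes of norm at most `y` -/
def PP (y : ℝ) : Finset (Ideal (𝓞 K)) := (BK K y).filter Prime

theorem mem_PP {y : ℝ} {p : Ideal (𝓞 K)} : p ∈ PP K y ↔ Prime p ∧ (absNorm p : ℝ) ≤ y := by
  classical
  simp only [PP, Finset.mem_filter, mem_BK]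
  exact ⟨fun h => ⟨h.2, h.1.2⟩, fun h => ⟨⟨h.1.ne_zero, h.2⟩, h.1⟩⟩

theorem norm_le_of_dvd {a b : Ideal (𝓞 K)} (hb : b ≠ ⊥) (h : a ∣ b) : (absNorm a : ℝ) ≤ absNorm b := by
  have : absNorm a ∣ absNorm b := by
    obtain ⟨c, rfl⟩ := h
    rw [map_mul]; exact dvd_mul_right _ _
  exact_mod_cast Nat.le_of_dvd (absNorm_pos' hb) this

theorem isCoprime_cop {y : ℝ} {s e : Ideal (𝓞 K)} (hs : s ∈ BK K y) (he : cop (PP K y) e) :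
    IsRelPrime s e := by
  rw [mem_BK] at hs
  intro d hd1 hd2
  by_contra hu
  have hd0 : d ≠ 0 := ne_zero_of_dvd_ne_zero hs.1 hd1
  obtain ⟨p, hp, hpd⟩ := WfDvdMonoid.exists_irreducible_factor hu hd0
  refine he p (mem_PP.2 ⟨hp.prime, ?_⟩) (hpd.trans hd2)
  exact (norm_le_of_dvd hs.1 (hpd.trans hd1)).trans hs.2

theorem AP_sum_le (x y : ℝ) : ∑ s ∈ BK K y, AP K (PP K y) (x / absNorm s) ≤ AK K x := by
  classical
  have e : ∀ s : Ideal (𝓞 K), AP K (PP K y) (x / absNorm s) =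
      (((BK K (x / absNorm s)).filter (cop (PP K y))).card : ℝ) := by
    intro s
    rw [AP, SP, Finset.card_filter]
    push_cast
    rfl
  simp_rw [e]
  rw [← Nat.cast_sum, ← Finset.card_sigma, AK, Nat.cast_le]
  refine Finset.card_le_card_of_injOn (fun z => z.1 * z.2) ?_ ?_
  · rintro ⟨s, e⟩ h
    simp only [Finset.coe_sigma, Set.mem_sigma_iff, Finset.mem_coe, Finset.mem_filter, mem_BK] at h ⊢
    refine ⟨mul_ne_zero h.1.1 h.2.1.1, ?_⟩
    have := h.2.1.2
    rw [le_div_iff₀ (absNorm_posR h.1.1)] at this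
    rw [map_mul]
    push_cast
    linarith
  · rintro ⟨s, e⟩ h ⟨s', e'⟩ h' heq
    simp only [Finset.coe_sigma, Set.mem_sigma_iff, Finset.mem_coe, Finset.mem_filter] at h h'
    simp only at heq
    have h1 : s ∣ s' := (isCoprime_cop h.1 h'.2.2).dvd_of_dvd_mul_right (heq ▸ dvd_mul_right s e)
    have h2 : s' ∣ s := (isCoprime_cop h'.1 h.2.2).dvd_of_dvd_mul_right (heq ▸ dvd_mul_right s' e')
    have h3 : s = s' := dvd_antisymm h1 h2
    subst h3
    have h4 : e = e' := mul_left_cancel₀ (mem_BK.1 h.1).1 heq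
    subst h4
    rfl

theorem AP_dens_mul {y d : ℝ} (h : Tendsto (fun x : ℝ => AP K (PP K y) x / x) atTop (𝓝 d)) :
    d * ∑ s ∈ BK K y, (1:ℝ) / absNorm s ≤ cK K := by
  have h1 : Tendsto (fun x : ℝ => (∑ s ∈ BK K y, AP K (PP K y) (x / absNorm s)) / x) atTop
      (𝓝 (∑ s ∈ BK K y, d / absNorm s)) := by
    simp_rw [Finset.sum_div]
    exact tendsto_finsetSum _ fun s hs => tendsto_comp_div (absNorm_posR (mem_BK.1 hs).1) h
  have h2 := le_of_tendsto_of_tendsto h1 AK_asymp (by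
    filter_upwards [eventually_gt_atTop 0] with x hx
    exact div_le_div_of_nonneg_right (AP_sum_le x y) hx.le)
  rw [Finset.mul_sum]
  simpa [div_eq_mul_inv] using h2

theorem sum_inv_unbounded (R : ℝ) : ∃ y : ℝ, R ≤ ∑ s ∈ BK K y, (1:ℝ) / absNorm s := by
  classical
  have hc := cK_pos (K := K)
  have hstep : ∀ᶠ x : ℝ in atTop, ∑ s ∈ BK K x, (1:ℝ) / absNorm s + cK K / 4 ≤
      ∑ s ∈ BK K (2 * x), (1:ℝ) / absNorm s := by
    have h := Metric.tendsto_nhds.1 (AK_asymp (K := K)) (cK K / 6) (by positivity)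
    have h2 := (tendsto_id.const_mul_atTop (show (0:ℝ) < 2 by norm_num)).eventually h
    filter_upwards [h, h2, eventually_gt_atTop 0] with x h1 h2 hx
    simp only [id] at h2
    rw [Real.dist_eq, abs_lt] at h1 h2
    have a1 : AK K x ≤ (cK K + cK K / 6) * x := by
      rw [← div_le_iff₀ hx]; linarith
    have a2 : (cK K - cK K / 6) * (2 * x) ≤ AK K (2 * x) := by
      rw [← le_div_iff₀ (by positivity)]; linarith
    have hsub : BK K x ⊆ BK K (2 * x) := BK_mono (by linarith)
    rw [← Finset.sum_sdiff hsub, add_comm]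
    gcongr
    have h3 : ∑ s ∈ BK K (2 * x) \ BK K x, (1:ℝ) / (2 * x) ≤
        ∑ s ∈ BK K (2 * x) \ BK K x, (1:ℝ) / absNorm s := by
      refine Finset.sum_le_sum fun s hs => ?_
      have hs' := mem_BK.1 (Finset.mem_sdiff.1 hs).1
      exact one_div_le_one_div_of_le (absNorm_posR hs'.1) hs'.2
    refine le_trans ?_ h3
    rw [Finset.sum_const, nsmul_eq_mul, Finset.card_sdiff_of_subset hsub,
      Nat.cast_sub (Finset.card_le_card hsub)]
    change _ ≤ (AK K (2 * x) - AK K x) * _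
    rw [mul_one_div, le_div_iff₀ (by positivity)]
    nlinarith
  obtain ⟨T, hT⟩ := eventually_atTop.1 hstep
  set T' := max T 1
  have hk : ∀ k : ℕ, k * (cK K / 4) ≤ ∑ s ∈ BK K (2 ^ k * T'), (1:ℝ) / absNorm s := by
    intro k
    induction k with
    | zero => simp; exact Finset.sum_nonneg fun _ _ => by positivity
    | succ k ih =>
      have h1 : T ≤ 2 ^ k * T' := by
        have : (1:ℝ) ≤ 2 ^ k := one_le_pow₀ (by norm_num)
        have h2 : T ≤ T' := le_max_left _ _
        have h3 : 1 ≤ T' := le_max_right _ _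
        nlinarith
      have := hT _ h1
      rw [← mul_assoc, ← pow_succ'] at this
      push_cast
      linarith
  obtain ⟨k, hk'⟩ := exists_nat_ge (R / (cK K / 4))
  refine ⟨2 ^ k * T', le_trans ?_ (hk k)⟩
  rwa [div_le_iff₀ (by positivity)] at hk'

theorem AP_dens_small {ε : ℝ} (hε : 0 < ε) : ∃ y : ℝ, ∀ᶠ x : ℝ in atTop, AP K (PP K y) x ≤ ε * x := by
  have hc := cK_pos (K := K)
  obtain ⟨y, hy⟩ := sum_inv_unbounded (K := K) (2 * cK K / ε)
  refine ⟨y, ?_⟩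
  obtain ⟨d, hd⟩ := AP_lim (PP K y) (fun q hq => (mem_PP.1 hq).1)
  have h1 := AP_dens_mul hd
  have hd0 : 0 ≤ d := ge_of_tendsto hd (by
    filter_upwards [eventually_gt_atTop 0] with x hx
    exact div_nonneg (AP_nonneg _ _) hx.le)
  have h2 : d < ε := by
    by_contra hge
    push Not at hge
    have h3 : ε * (2 * cK K / ε) ≤ d * ∑ s ∈ BK K y, (1:ℝ) / absNorm s :=
      mul_le_mul hge hy (by positivity) hd0
    rw [mul_div_cancel₀ _ hε.ne'] at h3
    linarith
  filter_upwards [hd.eventually_lt_const h2, eventually_gt_atTop 0] with x h hx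
  rw [div_lt_iff₀ hx] at h
  exact h.le

open Classical in
def gD (S : Set (Ideal (𝓞 K))) (d : Ideal (𝓞 K)) : ℝ := (muK K d : ℝ) * (if InD K S d then 1 else 0)

def GK (S : Set (Ideal (𝓞 K))) (x : ℝ) : ℝ := ∑ d ∈ BK K x, gD S d

theorem abs_gD_le (S : Set (Ideal (𝓞 K))) (d : Ideal (𝓞 K)) : |gD S d| ≤ 1 := by
  unfold gD
  split_ifs
  · simpa using abs_muK_le d
  · simp

open Classical in
theorem gD_split (S : Set (Ideal (𝓞 K))) (y : ℝ) {d : Ideal (𝓞 K)} (hd : d ≠ ⊥) :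
    gD S d = (if cop (PP K y) d then gD S d else 0) +
      ∑ p ∈ (PP K y).filter (· ∈ S), (if p ∣ d then
        (if ∀ q ∈ primesOf d, q ≠ p → absNorm p < absNorm q then (muK K d : ℝ) else 0) else 0) := by
  by_cases hc : cop (PP K y) d
  · rw [if_pos hc, Finset.sum_eq_zero, add_zero]
    intro p hp
    rw [if_neg (hc p (Finset.mem_filter.1 hp).1)]
  · rw [if_neg hc, zero_add]
    by_cases hD : InD K S d
    · rw [gD, if_pos hD, mul_one]
      obtain ⟨p, hp, hpS, hmin⟩ := (inD_iff hd S).1 hD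
      have hp' := (mem_primesOf hd).1 hp
      have hpy : p ∈ (PP K y).filter (· ∈ S) := by
        refine Finset.mem_filter.2 ⟨mem_PP.2 ⟨hp'.1, ?_⟩, hpS⟩
        unfold cop at hc
        push Not at hc
        obtain ⟨q, hq, hqd⟩ := hc
        have hq' := mem_PP.1 hq
        rcases eq_or_ne q p with rfl | hne
        · exact hq'.2
        · have := hmin q ((mem_primesOf hd).2 ⟨hq'.1, hqd⟩) hne
          have h3 : (absNorm p : ℝ) < absNorm q := by exact_mod_cast this
          linarith [hq'.2]
      rw [Finset.sum_eq_single_of_mem p hpy, if_pos hp'.2, if_pos hmin]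
      intro q hq hqp
      split_ifs with h1 h2
      · exfalso
        have hq1 := mem_PP.1 (Finset.mem_filter.1 hq).1
        have a1 := hmin q ((mem_primesOf hd).2 ⟨hq1.1, h1⟩) hqp
        have a2 := h2 p hp hqp.symm
        omega
      · rfl
      · rfl
    · rw [gD, if_neg hD, mul_zero, eq_comm]
      refine Finset.sum_eq_zero fun p hp => ?_
      split_ifs with h1 h2
      · exfalso
        have hq1 := Finset.mem_filter.1 hp
        exact hD ((inD_iff hd S).2 ⟨p, (mem_primesOf hd).2 ⟨(mem_PP.1 hq1.1).1, h1⟩, hq1.2, h2⟩)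
      · rfl
      · rfl

open Classical in
theorem GK_decomp (S : Set (Ideal (𝓞 K))) (x y : ℝ) :
    GK S x = SP (gD S) (PP K y) x -
      ∑ p ∈ (PP K y).filter (· ∈ S), MP K (PP K (absNorm p)) (x / absNorm p) := by
  unfold GK
  rw [Finset.sum_congr rfl fun d hd => gD_split S y (mem_BK.1 hd).1, Finset.sum_add_distrib,
    Finset.sum_comm, sub_eq_add_neg, ← Finset.sum_neg_distrib]
  congr 1
  refine Finset.sum_congr rfl fun p hp => ?_
  have hp1 : Prime p := (mem_PP.1 (Finset.mem_filter.1 hp).1).1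
  rw [← Finset.sum_filter, sum_BK_dvd hp1.ne_zero, MP, SP, ← Finset.sum_neg_distrib]
  refine Finset.sum_congr rfl fun e he => ?_
  have he0 := (mem_BK.1 he).1
  have hpe : p * e ≠ ⊥ := mul_ne_zero hp1.ne_zero he0
  rw [muK_mul_prime hp1 he0]
  by_cases hpd : p ∣ e
  · have : ¬ cop (PP K (absNorm p)) e := fun h => h p (mem_PP.2 ⟨hp1, le_rfl⟩) hpd
    simp [hpd, this]
  · have hiff : (∀ q ∈ primesOf (p * e), q ≠ p → absNorm p < absNorm q) ↔
        cop (PP K (absNorm p)) e := by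
      constructor
      · intro h q hq hqe
        have hq' := mem_PP.1 hq
        have hne : q ≠ p := by rintro rfl; exact hpd hqe
        have := h q ((mem_primesOf hpe).2 ⟨hq'.1, hqe.mul_left p⟩) hne
        have h3 : (absNorm p : ℝ) < absNorm q := by exact_mod_cast this
        linarith [hq'.2]
      · intro h q hq hne
        have hq' := (mem_primesOf hpe).1 hq
        by_contra hlt
        push Not at hlt
        refine h q (mem_PP.2 ⟨hq'.1, by exact_mod_cast hlt⟩) ?_
        rcases hq'.1.dvd_or_dvd hq'.2 with h1 | h1
        · exact absurd (prime_dvd_prime hq'.1 hp1 h1) hne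
        · exact h1
    simp only [hiff, hpd, if_false]
    split_ifs <;> simp

theorem GK_littleo (S : Set (Ideal (𝓞 K))) : Tendsto (fun x : ℝ => GK S x / x) atTop (𝓝 0) := by
  classical
  rw [Metric.tendsto_nhds]
  intro ε hε
  obtain ⟨y, hy⟩ := AP_dens_small (K := K) (show 0 < ε / 2 by positivity)
  have h1 : Tendsto (fun x : ℝ => (∑ p ∈ (PP K y).filter (· ∈ S),
      MP K (PP K (absNorm p)) (x / absNorm p)) / x) atTop (𝓝 0) := by
    simp_rw [Finset.sum_div]
    rw [← Finset.sum_const_zero (s := (PP K y).filter (· ∈ S))]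
    refine tendsto_finsetSum _ fun p hp => ?_
    have hp1 : Prime p := (mem_PP.1 (Finset.mem_filter.1 hp).1).1
    simpa using tendsto_comp_div (absNorm_posR hp1.ne_zero)
      (MP_lim (PP K (absNorm p)) (fun q hq => (mem_PP.1 hq).1))
  filter_upwards [hy, Metric.tendsto_nhds.1 h1 (ε / 2) (by positivity), eventually_gt_atTop 0]
    with x a1 a2 hx
  rw [Real.dist_eq, sub_zero, abs_div, abs_of_pos hx, div_lt_iff₀ hx] at a2 ⊢
  rw [GK_decomp S x y]
  have a3 := SP_abs_le (abs_gD_le S) (PP K y) x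
  refine (abs_sub _ _).trans_lt ?_
  linarith

end Sieve

section Axer
open Topology
variable {K}

def LG (S : Set (Ideal (𝓞 K))) (x : ℝ) : ℝ := ∑ d ∈ BK K x, gD S d / absNorm d

theorem LG_floor (S : Set (Ideal (𝓞 K))) (x : ℝ) : LG S x = LG S (⌊x⌋₊ : ℝ) := by
  unfold LG
  rw [← sum_coef, ← sum_coef (x := ((⌊x⌋₊ : ℕ) : ℝ)), Nat.floor_natCast]

theorem LG_succ (S : Set (Ideal (𝓞 K))) (n : ℕ) :
    LG S ((n + 1 : ℕ) : ℝ) - LG S (n : ℝ) =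
      (GK S ((n + 1 : ℕ) : ℝ) - GK S (n : ℝ)) / ((n : ℝ) + 1) := by
  unfold LG GK
  rw [← sum_coef, ← sum_coef, ← sum_coef, ← sum_coef, Nat.floor_natCast, Nat.floor_natCast,
    Finset.sum_Icc_succ_top (by omega), Finset.sum_Icc_succ_top (by omega), add_sub_cancel_left,
    add_sub_cancel_left, coef, coef, Finset.sum_div]
  refine Finset.sum_congr rfl fun a ha => ?_
  rw [(mem_Fib.1 ha).2]
  push_cast
  rfl

theorem LG_abel (S : Set (Ideal (𝓞 K))) (m k : ℕ) :
    LG S ((m + k : ℕ) : ℝ) - LG S (m : ℝ) =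
      GK S ((m + k : ℕ) : ℝ) / (((m + k : ℕ) : ℝ) + 1) - GK S (m : ℝ) / ((m : ℝ) + 1) +
      ∑ j ∈ Finset.range k, GK S ((m + j + 1 : ℕ) : ℝ) /
        (((m + j + 1 : ℕ) : ℝ) * (((m + j + 1 : ℕ) : ℝ) + 1)) := by
  induction k with
  | zero => simp
  | succ k ih =>
    rw [Finset.sum_range_succ]
    have h := LG_succ S (m + k)
    have e : m + (k + 1) = m + k + 1 := rfl
    rw [e]
    have h1 : (((m + k : ℕ) : ℝ) + 1) ≠ 0 := by positivity
    have h2 : (((m + k + 1 : ℕ) : ℝ) + 1) ≠ 0 := by positivity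
    have h3 : ((m + k + 1 : ℕ) : ℝ) = ((m + k : ℕ) : ℝ) + 1 := by push_cast; ring
    have h4 : GK S ((m + k + 1 : ℕ) : ℝ) / (((m + k : ℕ) : ℝ) + 1) =
      GK S ((m + k + 1 : ℕ) : ℝ) / (((m + k + 1 : ℕ) : ℝ) + 1) + GK S ((m + k + 1 : ℕ) : ℝ) /
        (((m + k + 1 : ℕ) : ℝ) * (((m + k + 1 : ℕ) : ℝ) + 1)) := by
      generalize GK S ((m + k + 1 : ℕ) : ℝ) = g
      rw [h3] at h2 ⊢
      field_simp
    rw [sub_div] at h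
    linarith

theorem LG_diff (S : Set (Ideal (𝓞 K))) {T : ℝ} (hT : 1 ≤ T) :
    Tendsto (fun x : ℝ => LG S x - LG S (x / T)) atTop (𝓝 0) := by
  have hT0 : 0 < T := by linarith
  rw [Metric.tendsto_nhds]
  intro ε hε
  set η := ε / (T + 3) with hη
  have hη0 : 0 < η := by positivity
  obtain ⟨N₀, hN₀⟩ := eventually_atTop.1 (Metric.tendsto_nhds.1 (GK_littleo S) η hη0)
  have hG : ∀ x : ℝ, N₀ ≤ x → 0 < x → |GK S x| ≤ η * x := by
    intro x hx hx0
    have := hN₀ x hx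
    rw [Real.dist_eq, sub_zero, abs_div, abs_of_pos hx0, div_lt_iff₀ hx0] at this
    exact this.le
  filter_upwards [eventually_ge_atTop (T * (|N₀| + 2))] with x hx
  have hxT : |N₀| + 2 ≤ x / T := by rw [le_div_iff₀ hT0]; linarith
  have hx0 : 0 < x := lt_of_lt_of_le (by positivity) hx
  have hle : x / T ≤ x := div_le_self hx0.le hT
  rw [Real.dist_eq, sub_zero, LG_floor, LG_floor S (x / T)]
  obtain ⟨k, hk⟩ := Nat.exists_eq_add_of_le (Nat.floor_le_floor hle)
  set m := ⌊x / T⌋₊ with hm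
  have hm1 : x / T < m + 1 := Nat.lt_floor_add_one _
  have hkx : ((m + k : ℕ) : ℝ) ≤ x := by rw [← hk]; exact Nat.floor_le hx0.le
  have hmN : N₀ ≤ m ∧ (0:ℝ) < m := by
    have := le_abs_self N₀
    have := abs_nonneg N₀
    constructor <;> linarith
  rw [hk, LG_abel]
  have b : ∀ j : ℕ, |GK S ((m + j : ℕ) : ℝ)| ≤ η * ((m + j : ℕ) : ℝ) := by
    intro j
    have hj : (0:ℝ) ≤ j := Nat.cast_nonneg j
    apply hG <;> push_cast <;> linarith
  have b1 : |GK S ((m + k : ℕ) : ℝ) / (((m + k : ℕ) : ℝ) + 1)| ≤ η := by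
    rw [abs_div, abs_of_pos (show (0:ℝ) < ((m + k : ℕ) : ℝ) + 1 by positivity),
      div_le_iff₀ (by positivity)]
    nlinarith [b k]
  have b2 : |GK S (m : ℝ) / ((m : ℝ) + 1)| ≤ η := by
    rw [abs_div, abs_of_pos (show (0:ℝ) < (m : ℝ) + 1 by positivity), div_le_iff₀ (by positivity)]
    have := b 0
    rw [add_zero] at this
    nlinarith
  have b3 : |∑ j ∈ Finset.range k, GK S ((m + j + 1 : ℕ) : ℝ) /
        (((m + j + 1 : ℕ) : ℝ) * (((m + j + 1 : ℕ) : ℝ) + 1))| ≤ η * T := by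
    refine (Finset.abs_sum_le_sum_abs _ _).trans ?_
    have : ∀ j ∈ Finset.range k, |GK S ((m + j + 1 : ℕ) : ℝ) /
        (((m + j + 1 : ℕ) : ℝ) * (((m + j + 1 : ℕ) : ℝ) + 1))| ≤ η / (x / T) := by
      intro j _
      have hj : (0:ℝ) ≤ j := Nat.cast_nonneg j
      have hp : (0:ℝ) < ((m + j + 1 : ℕ) : ℝ) := by positivity
      rw [abs_div, abs_of_pos (show (0:ℝ) < ((m + j + 1 : ℕ) : ℝ) * (((m + j + 1 : ℕ) : ℝ) + 1) by positivity),
        div_le_div_iff₀ (by positivity) (by positivity)]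
      have b' := b (j + 1)
      rw [← add_assoc] at b'
      have h2 : x / T ≤ ((m + j + 1 : ℕ) : ℝ) + 1 := by push_cast; linarith
      calc _ ≤ η * ((m + j + 1 : ℕ) : ℝ) * (((m + j + 1 : ℕ) : ℝ) + 1) :=
            mul_le_mul b' h2 (by positivity) (by positivity)
        _ = _ := by ring
    refine (Finset.sum_le_sum this).trans ?_
    rw [Finset.sum_const, Finset.card_range, nsmul_eq_mul]
    have hkx' : (k:ℝ) ≤ x := by push_cast at hkx; linarith
    calc (k:ℝ) * (η / (x / T)) ≤ x * (η / (x / T)) := by gcongr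
      _ = η * T := by field_simp
  have : |GK S ((m + k : ℕ) : ℝ) / (((m + k : ℕ) : ℝ) + 1) - GK S (m : ℝ) / ((m : ℝ) + 1) +
      ∑ j ∈ Finset.range k, GK S ((m + j + 1 : ℕ) : ℝ) /
        (((m + j + 1 : ℕ) : ℝ) * (((m + j + 1 : ℕ) : ℝ) + 1))| ≤ η + η + η * T :=
    (abs_add_le _ _).trans (add_le_add ((abs_sub _ _).trans (add_le_add b1 b2)) b3)
  refine this.trans_lt ?_
  have : η * (T + 3) = ε := by rw [hη]; field_simp
  nlinarith

variable (K) in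
theorem sum_pow_le : ∃ C : ℝ, 0 ≤ C ∧ ∀ z : ℝ, 0 ≤ z →
    ∑ d ∈ BK K z, (absNorm d : ℝ) ^ (etaK K - 1) ≤ C * z ^ (etaK K) := by
  classical
  obtain ⟨B, hB0, hB⟩ := count_le K
  have hη := etaK_pos K
  have hη1 := etaK_lt K
  set η := etaK K
  set θ : ℝ := (2:ℝ)⁻¹ ^ η with hθ
  have hθ1 : θ < 1 := Real.rpow_lt_one (by norm_num) (by norm_num) hη
  have hθ0 : 0 < θ := by positivity
  set D : ℝ := (2:ℝ)⁻¹ ^ (η - 1) * B with hD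
  have hD0 : 0 < D := by positivity
  have h1θ : 0 < 1 - θ := by linarith
  refine ⟨D / (1 - θ), by positivity, ?_⟩
  have key : ∀ k : ℕ, ∀ z : ℝ, 0 ≤ z → z < 2 ^ k →
      ∑ d ∈ BK K z, (absNorm d : ℝ) ^ (η - 1) ≤ D / (1 - θ) * z ^ η := by
    intro k
    induction k with
    | zero =>
      intro z hz0 hz
      rw [BK_card_zero (by simpa using hz)]
      simp only [Finset.sum_empty]
      positivity
    | succ k ih =>
      intro z hz0 hz
      rcases hz0.eq_or_lt with h0 | hz1
      · rw [BK_card_zero (by linarith)]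
        simp only [Finset.sum_empty]
        positivity
      have hsub : BK K (z / 2) ⊆ BK K z := BK_mono (by linarith)
      rw [← Finset.sum_sdiff hsub]
      have i1 := ih (z / 2) (by positivity) (by rw [pow_succ] at hz; linarith)
      have i2 : ∑ d ∈ BK K z \ BK K (z / 2), (absNorm d : ℝ) ^ (η - 1) ≤ D * z ^ η := by
        have : ∀ d ∈ BK K z \ BK K (z / 2), (absNorm d : ℝ) ^ (η - 1) ≤ (z / 2) ^ (η - 1) := by
          intro d hd
          rw [Finset.mem_sdiff, mem_BK, mem_BK] at hd
          have : z / 2 ≤ absNorm d := by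
            by_contra h
            exact hd.2 ⟨hd.1.1, by linarith⟩
          exact Real.rpow_le_rpow_of_nonpos (by positivity) this (by linarith)
        refine (Finset.sum_le_sum this).trans ?_
        rw [Finset.sum_const, nsmul_eq_mul]
        have hc : ((BK K z \ BK K (z / 2)).card : ℝ) ≤ B * z :=
          le_trans (by exact_mod_cast Finset.card_le_card Finset.sdiff_subset) (hB z hz0)
        refine (mul_le_mul_of_nonneg_right hc (by positivity)).trans (le_of_eq ?_)
        rw [div_eq_mul_inv, Real.mul_rpow hz0 (by norm_num), hD]
        have : z ^ η = z ^ (η - 1) * z := by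
          rw [← Real.rpow_add_one hz1.ne']; ring_nf
        rw [this]
        ring
      rw [div_eq_mul_inv z, Real.mul_rpow hz0 (by norm_num), ← hθ] at i1
      refine (add_le_add i2 i1).trans (le_of_eq ?_)
      field_simp
      ring
  intro z hz
  obtain ⟨k, hk⟩ := pow_unbounded_of_one_lt z (show (1:ℝ) < 2 by norm_num)
  exact key k z hz hk

def RK (S : Set (Ideal (𝓞 K))) (x : ℝ) : ℝ := ∑ d ∈ BK K x, gD S d * EK K (x / absNorm d)

variable (K) in
theorem RK_part1 : ∃ C : ℝ, 0 ≤ C ∧ ∀ S : Set (Ideal (𝓞 K)), ∀ T x : ℝ, 1 ≤ T → 0 < x →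
    |∑ d ∈ BK K (x / T), gD S d * EK K (x / absNorm d)| ≤ C * T ^ (-etaK K) * x := by
  obtain ⟨C, hC, hE⟩ := EK_bd K
  obtain ⟨C', hC', hP⟩ := sum_pow_le K
  refine ⟨C * C', by positivity, fun S T x hT hx => ?_⟩
  have hT0 : 0 < T := by linarith
  refine (Finset.abs_sum_le_sum_abs _ _).trans ?_
  have : ∀ d ∈ BK K (x / T), |gD S d * EK K (x / absNorm d)| ≤
      C * x ^ (1 - etaK K) * (absNorm d : ℝ) ^ (etaK K - 1) := by
    intro d hd
    rw [mem_BK] at hd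
    have hN := absNorm_posR hd.1
    have h1 : 1 ≤ x / absNorm d := by
      rw [one_le_div hN]
      exact hd.2.trans (div_le_self hx.le hT)
    rw [abs_mul]
    have h2 := hE _ h1
    have h3 : (x / absNorm d) ^ (1 - etaK K) = x ^ (1 - etaK K) * (absNorm d : ℝ) ^ (etaK K - 1) := by
      rw [Real.div_rpow hx.le hN.le, div_eq_mul_inv, ← Real.rpow_neg hN.le, neg_sub]
    rw [h3, ← mul_assoc] at h2
    calc _ ≤ 1 * |EK K (x / absNorm d)| := mul_le_mul_of_nonneg_right (abs_gD_le S d) (abs_nonneg _)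
      _ ≤ _ := by rw [one_mul]; exact h2
  refine (Finset.sum_le_sum this).trans ?_
  rw [← Finset.mul_sum]
  refine (mul_le_mul_of_nonneg_left (hP (x / T) (by positivity)) (by positivity)).trans (le_of_eq ?_)
  rw [Real.div_rpow hx.le hT0.le, Real.rpow_neg hT0.le]
  have : x ^ (1 - etaK K) * x ^ (etaK K) = x := by
    rw [← Real.rpow_add hx]; simp
  rw [div_eq_mul_inv]
  linear_combination C * C' * (T ^ etaK K)⁻¹ * this

theorem RK_part2 (S : Set (Ideal (𝓞 K))) {T x : ℝ} (hT : 1 ≤ T) (hx : 0 < x) :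
    RK S x = ∑ d ∈ BK K (x / T), gD S d * EK K (x / absNorm d) +
      (∑ e ∈ BK K T, (GK S (x / absNorm e) - GK S (x / T)) - cK K * x * (LG S x - LG S (x / T))) := by
  classical
  have hT0 : 0 < T := by linarith
  have hsub : BK K (x / T) ⊆ BK K x := BK_mono (div_le_self hx.le hT)
  rw [RK, ← Finset.sum_sdiff hsub, add_comm]
  congr 1
  have hH : LG S x - LG S (x / T) = ∑ d ∈ BK K x \ BK K (x / T), gD S d / absNorm d := by
    rw [LG, LG, ← Finset.sum_sdiff hsub, add_sub_cancel_right]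
  rw [hH, Finset.mul_sum]
  have hG : ∀ e ∈ BK K T, GK S (x / absNorm e) - GK S (x / T) =
      ∑ d ∈ BK K x \ BK K (x / T), if (absNorm e : ℝ) ≤ x / absNorm d then gD S d else 0 := by
    intro e he
    rw [mem_BK] at he
    have hN := absNorm_posR he.1
    have hs2 : BK K (x / T) ⊆ BK K (x / absNorm e) := BK_mono (by gcongr; exact he.2)
    rw [GK, GK, ← Finset.sum_sdiff hs2, add_sub_cancel_right, ← Finset.sum_filter]
    refine Finset.sum_congr ?_ fun _ _ => rfl
    ext d
    simp only [Finset.mem_sdiff, Finset.mem_filter, mem_BK]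
    constructor
    · rintro ⟨⟨h1, h2⟩, h3⟩
      have hd := absNorm_posR h1
      refine ⟨⟨⟨h1, h2.trans (div_le_self hx.le (one_le_absNormR he.1))⟩, h3⟩, ?_⟩
      rw [le_div_iff₀ hN] at h2
      rw [le_div_iff₀ hd]
      linarith
    · rintro ⟨⟨⟨h1, h2⟩, h3⟩, h4⟩
      have hd := absNorm_posR h1
      refine ⟨⟨h1, ?_⟩, h3⟩
      rw [le_div_iff₀ hd] at h4
      rw [le_div_iff₀ hN]
      linarith
  rw [Finset.sum_congr rfl hG, Finset.sum_comm, ← Finset.sum_sub_distrib]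
  refine Finset.sum_congr rfl fun d hd => ?_
  simp only [Finset.mem_sdiff, mem_BK] at hd
  have hd0 := absNorm_posR hd.1.1
  have hlt : x / absNorm d < T := by
    by_contra h
    push Not at h
    refine hd.2 ⟨hd.1.1, ?_⟩
    rw [le_div_iff₀ hd0] at h
    rw [le_div_iff₀ hT0]
    linarith
  have hA : ∑ e ∈ BK K T, (if (absNorm e : ℝ) ≤ x / absNorm d then gD S d else 0) =
      gD S d * AK K (x / absNorm d) := by
    rw [← Finset.sum_filter, Finset.sum_const, nsmul_eq_mul, mul_comm, AK]
    congr 3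
    ext e
    simp only [Finset.mem_filter, mem_BK]
    constructor
    · rintro ⟨⟨h1, _⟩, h2⟩; exact ⟨h1, h2⟩
    · rintro ⟨h1, h2⟩; exact ⟨⟨h1, by linarith⟩, h2⟩
  rw [hA, EK]
  field_simp

theorem RK_littleo (S : Set (Ideal (𝓞 K))) : Tendsto (fun x : ℝ => RK S x / x) atTop (𝓝 0) := by
  obtain ⟨C, hC, h1⟩ := RK_part1 K
  rw [Metric.tendsto_nhds]
  intro ε hε
  have ht : Tendsto (fun T : ℝ => C * T ^ (-etaK K)) atTop (𝓝 0) := by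
    simpa using (tendsto_rpow_neg_atTop (etaK_pos K)).const_mul C
  obtain ⟨T, hT, hTε⟩ := ((eventually_ge_atTop 1).and
    (ht.eventually_lt_const (show 0 < ε / 2 by positivity))).exists
  have hT0 : (0:ℝ) < T := by linarith
  have h2 : Tendsto (fun x : ℝ => (∑ e ∈ BK K T, (GK S (x / absNorm e) - GK S (x / T))) / x -
      cK K * (LG S x - LG S (x / T))) atTop (𝓝 0) := by
    have a1 : Tendsto (fun x : ℝ => (∑ e ∈ BK K T, (GK S (x / absNorm e) - GK S (x / T))) / x) atTop (𝓝 0) := by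
      simp_rw [Finset.sum_div]
      rw [← Finset.sum_const_zero (s := BK K T)]
      refine tendsto_finsetSum _ fun e he => ?_
      have := (tendsto_comp_div (absNorm_posR (mem_BK.1 he).1) (GK_littleo S)).sub
        (tendsto_comp_div hT0 (GK_littleo S))
      simpa [sub_div] using this
    simpa using a1.sub ((LG_diff S hT).const_mul (cK K))
  filter_upwards [Metric.tendsto_nhds.1 h2 (ε / 2) (by positivity), eventually_gt_atTop 0] with x b hx
  rw [Real.dist_eq, sub_zero] at b ⊢
  rw [RK_part2 S hT hx, add_div]
  refine (abs_add_le _ _).trans_lt ?_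
  have c1 := h1 S T x hT hx
  have c2 : |(∑ d ∈ BK K (x / T), gD S d * EK K (x / absNorm d)) / x| ≤ C * T ^ (-etaK K) := by
    rw [abs_div, abs_of_pos hx, div_le_iff₀ hx]
    exact c1
  have c3 : (∑ e ∈ BK K T, (GK S (x / absNorm e) - GK S (x / T)) -
      cK K * x * (LG S x - LG S (x / T))) / x = (∑ e ∈ BK K T, (GK S (x / absNorm e) - GK S (x / T))) / x -
      cK K * (LG S x - LG S (x / T)) := by
    rw [sub_div]
    congr 1
    field_simp
  rw [c3]
  linarith

theorem gD_conv (S : Set (Ideal (𝓞 K))) (x : ℝ) :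
    ∑ d ∈ BK K x, gD S d * AK K (x / absNorm d) = -∑ a ∈ BK K x, (QS K S a : ℝ) := by
  have h := sum_sum_divs (K := K) x (fun d _ => gD S d)
  rw [← Finset.sum_neg_distrib]
  rw [← Finset.sum_congr rfl fun a ha => sum_divs_mu_D (mem_BK.1 ha).1 S]
  refine Eq.trans ?_ h
  refine Finset.sum_congr rfl fun d _ => ?_
  rw [Finset.sum_const, nsmul_eq_mul, mul_comm, AK]

theorem LG_eq (S : Set (Ideal (𝓞 K))) (x : ℝ) :
    cK K * x * LG S x = -∑ a ∈ BK K x, (QS K S a : ℝ) - RK S x := by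
  rw [← gD_conv, RK, ← Finset.sum_sub_distrib, LG, Finset.mul_sum]
  refine Finset.sum_congr rfl fun d _ => ?_
  rw [EK]
  ring

theorem LG_lim (S : Set (Ideal (𝓞 K))) {δ : ℝ}
    (h : Tendsto (fun x : ℝ => (∑ a ∈ BK K x, (QS K S a : ℝ) - cK K * δ * x) / x) atTop (𝓝 0)) :
    Tendsto (LG S) atTop (𝓝 (-δ)) := by
  have hc := cK_pos (K := K)
  have h1 := ((h.add (RK_littleo S)).div_const (cK K)).const_sub (-δ)
  simp only [add_zero, zero_div, sub_zero] at h1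
  refine h1.congr' ?_
  filter_upwards [eventually_gt_atTop 0] with x hx
  have := LG_eq S x
  have e : LG S x = (-∑ a ∈ BK K x, (QS K S a : ℝ) - RK S x) / (cK K * x) := by
    rw [eq_div_iff (by positivity)]
    linarith
  rw [e]
  field_simp
  ring

theorem tsum_subtype_finset {α : Type*} {P : α → Prop} (s : Finset α) (h : ∀ a, a ∈ s ↔ P a) (f : α → ℝ) :
    ∑' a : {a // P a}, f a.1 = ∑ a ∈ s, f a := by
  obtain rfl : P = (· ∈ s) := funext fun a => propext (h a).symm
  exact Finset.tsum_subtype s f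

theorem eq_top_of_not_two_le {a : Ideal (𝓞 K)} (ha : a ≠ ⊥) (h : ¬ 2 ≤ absNorm a) : a = ⊤ := by
  have := absNorm_pos' ha
  exact Ideal.absNorm_eq_one_iff.1 (by omega)

theorem ne_bot_of_two_le {a : Ideal (𝓞 K)} (h : 2 ≤ absNorm a) : a ≠ ⊥ := by
  rintro rfl
  simp at h

theorem QS_tsum (S : Set (Ideal (𝓞 K))) (X : ℝ) :
    ∑' a : {a : Ideal (𝓞 K) // 2 ≤ absNorm a ∧ (absNorm a : ℝ) ≤ X}, (QS K S a.1 : ℝ) =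
      ∑ a ∈ BK K X, (QS K S a : ℝ) := by
  classical
  rw [tsum_subtype_finset ((BK K X).filter (fun a => 2 ≤ absNorm a)) _ (fun a => (QS K S a : ℝ)),
    Finset.sum_filter_of_ne]
  · intro a ha hne
    by_contra h
    have ha0 := (mem_BK.1 ha).1
    have ht := eq_top_of_not_two_le ha0 h
    apply hne
    rw [QS_eq ha0, (primesOf_eq_empty ha0).2 ht]
    simp
  · intro a
    rw [Finset.mem_filter, mem_BK]
    exact ⟨fun h => ⟨h.2, h.1.2⟩, fun h => ⟨⟨ne_bot_of_two_le h.1, h.2⟩, h.1⟩⟩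

theorem LG_tsum (S : Set (Ideal (𝓞 K))) (X : ℝ) :
    ∑' a : {a : Ideal (𝓞 K) // 2 ≤ absNorm a ∧ (absNorm a : ℝ) ≤ X ∧ InD K S a},
      (muK K a.1 : ℝ) / (absNorm a.1 : ℝ) = LG S X := by
  classical
  rw [tsum_subtype_finset ((BK K X).filter (fun a => InD K S a)) _
    (fun a => (muK K a : ℝ) / (absNorm a : ℝ)), Finset.sum_filter, LG]
  · refine Finset.sum_congr rfl fun a _ => ?_
    rw [gD]
    split_ifs <;> simp
  · intro a
    rw [Finset.mem_filter, mem_BK]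
    refine ⟨fun h => ⟨?_, h.1.2, h.2⟩, fun h => ⟨⟨ne_bot_of_two_le h.1, h.2.1⟩, h.2.2⟩⟩
    by_contra h2
    have ht := eq_top_of_not_two_le h.1.1 h2
    obtain ⟨p, hp, -⟩ := (inD_iff h.1.1 S).1 h.2
    rw [(primesOf_eq_empty h.1.1).2 ht] at hp
    simp at hp

end Axer

/-- Conversion lemma: the `Q_S` asymptotic implies the Möbius sum identity. -/
theorem qs_asymptotic_implies_mobius_sum (S : Set (Ideal (𝓞 K)))
    (hS : ∀ p ∈ S, p.IsPrime) (δ : ℝ) (hδ : HasPrimeDensity K S δ)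
    (hQ : Tendsto (fun X : ℝ =>
        ((∑' a : {a : Ideal (𝓞 K) // 2 ≤ absNorm a ∧ (absNorm a : ℝ) ≤ X},
          (QS K S a.1 : ℝ)) - cK K * δ * X) / X)
      atTop (nhds 0)) :
    Tendsto (fun X : ℝ =>
        ∑' a : {a : Ideal (𝓞 K) // 2 ≤ absNorm a ∧ (absNorm a : ℝ) ≤ X ∧ InD K S a},
          (muK K a.1 : ℝ) / (absNorm a.1 : ℝ))
      atTop (nhds (-δ)) := by
  have h1 : Tendsto (fun X : ℝ => (∑ a ∈ BK K X, (QS K S a : ℝ) - cK K * δ * X) / X) atTop (nhds 0) := by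
    simpa only [QS_tsum] using hQ
  simpa only [LG_tsum] using LG_lim S h1

end AlladiGen
end
end

section
/- Let K be a number field and S a set of prime ideals of K. For all X ≥ 2, Σ_{2 ≤ N(a) ≤ X} Q_S(a) = Σ_{p ∈ S, N(p) ≤ X} Ψ(X/N(p), N(p)), where the right-hand sum runs over prime ideals p ∈ S of norm at most X. -/
open NumberField Ideal Filter

noncomputable section

namespace AlladiGen

variable (K : Type*) [Field K] [NumberField K]

/-- Finiteness of sets of ideals of bounded norm. -/
lemma finite_sub (P : Ideal (𝓞 K) → Prop) (X : ℝ) (h : ∀ a, P a → (absNorm a : ℝ) ≤ X) :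
    Finite {a : Ideal (𝓞 K) // P a} := by
  have h1 : {I : Ideal (𝓞 K) | absNorm I ≤ ⌊X⌋₊}.Finite := Ideal.finite_setOfPred_absNorm_le _
  exact (h1.subset (t := {a | P a}) fun a ha => Nat.le_floor (h a ha)).to_subtype

/-- Dependent pairs of subtypes as a subtype of pairs. -/
def sigmaEquivPairs {α β : Type*} (P : α → Prop) (Q : α → β → Prop) :
    (Σ a : {a // P a}, {b // Q a.1 b}) ≃ {x : α × β // P x.1 ∧ Q x.1 x.2} where
  toFun x := ⟨(x.1.1, x.2.1), x.1.2, x.2.2⟩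
  invFun x := ⟨⟨x.1.1, x.2.1⟩, ⟨x.1.2, x.2.2⟩⟩
  left_inv _ := rfl
  right_inv _ := rfl

lemma tsum_card {α β : Type*} (P : α → Prop) (Q : α → β → Prop) (hP : Finite {a // P a})
    (hQ : ∀ a, P a → Finite {b // Q a b}) :
    ∑' a : {a // P a}, (Nat.card {b // Q a.1 b} : ℝ) =
      Nat.card {x : α × β // P x.1 ∧ Q x.1 x.2} := by
  have := Fintype.ofFinite {a // P a}
  have (a : {a // P a}) : Finite {b // Q a.1 b} := hQ _ a.2
  rw [tsum_fintype, ← Nat.card_congr (sigmaEquivPairs P Q), Nat.card_sigma]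
  push_cast
  rfl

lemma norm_le_of_le {a p : Ideal (𝓞 K)} (ha : a ≠ ⊥) (h : a ≤ p) : absNorm p ≤ absNorm a :=
  Nat.le_of_dvd (Nat.pos_of_ne_zero (by simpa [absNorm_eq_zero_iff] using ha))
    (absNorm_dvd_absNorm_of_le h)

lemma eq_maxNorm_iff {a p : Ideal (𝓞 K)} (ha : a ≠ ⊥) (hp : p.IsPrime) (hap : a ≤ p) :
    absNorm p = maxNorm K a ↔ ∀ q : Ideal (𝓞 K), q.IsPrime → a ≤ q → absNorm q ≤ absNorm p := by
  have hb : BddAbove (absNorm '' {p : Ideal (𝓞 K) | p.IsPrime ∧ a ≤ p}) := by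
    refine ⟨absNorm a, ?_⟩
    rintro _ ⟨q, hq, rfl⟩
    exact norm_le_of_le K ha hq.2
  constructor
  · intro h q hq haq
    rw [h]
    exact le_csSup hb ⟨q, ⟨hq, haq⟩, rfl⟩
  · intro h
    refine le_antisymm (le_csSup hb ⟨p, ⟨hp, hap⟩, rfl⟩) (csSup_le ⟨_, p, ⟨hp, hap⟩, rfl⟩ ?_)
    rintro _ ⟨q, hq, rfl⟩
    exact h q hq.1 hq.2

/-- `∑_{2 ≤ N(a) ≤ X} Q_S(a) = ∑_{p ∈ S, N(p) ≤ X} Ψ(X/N(p), N(p))`. -/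
theorem qs_sum_eq_psi_sum (S : Set (Ideal (𝓞 K))) (hS : ∀ p ∈ S, p.IsPrime)
    (X : ℝ) (hX : 2 ≤ X) :
    ∑' a : {a : Ideal (𝓞 K) // 2 ≤ absNorm a ∧ (absNorm a : ℝ) ≤ X},
        (QS K S a.1 : ℝ) =
      ∑' p : {p : Ideal (𝓞 K) // p.IsPrime ∧ p ∈ S ∧ (absNorm p : ℝ) ≤ X},
        (Psi K (X / (absNorm p.1 : ℝ)) (absNorm p.1 : ℝ) : ℝ) := by
  unfold QS Psi
  rw [tsum_card (fun a : Ideal (𝓞 K) => 2 ≤ absNorm a ∧ (absNorm a : ℝ) ≤ X)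
      (fun a p : Ideal (𝓞 K) => p.IsPrime ∧ a ≤ p ∧ p ∈ S ∧ absNorm p = maxNorm K a)
      (finite_sub K _ X fun a h => h.2) ?_,
    tsum_card (fun p : Ideal (𝓞 K) => p.IsPrime ∧ p ∈ S ∧ (absNorm p : ℝ) ≤ X)
      (fun p a : Ideal (𝓞 K) => a ≠ ⊥ ∧ (absNorm a : ℝ) ≤ X / (absNorm p : ℝ) ∧
        ∀ q : Ideal (𝓞 K), q.IsPrime → a ≤ q → (absNorm q : ℝ) ≤ (absNorm p : ℝ))
      (finite_sub K _ X fun a h => h.2.2)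
      (fun p _ => finite_sub K _ (X / (absNorm p : ℝ)) fun a h => h.2.1)]
  · congr 1
    symm
    refine Nat.card_eq_of_bijective (fun x => ⟨(x.1.1 * x.1.2, x.1.1), ?_⟩) ⟨?_, ?_⟩
    · obtain ⟨⟨p, b⟩, ⟨hp, hpS, hpX⟩, hb, hbX, hq⟩ := x
      dsimp only at *
      have hp0 : p ≠ ⊥ := by
        rintro rfl
        simp only [absNorm_bot, Nat.cast_zero, div_zero] at hbX
        have : absNorm b = 0 := by exact_mod_cast le_antisymm hbX (Nat.cast_nonneg _)
        exact hb (absNorm_eq_zero_iff.1 this)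
      have hne : p * b ≠ ⊥ := mul_ne_zero hp0 hb
      have hnp : 0 < absNorm p :=
        Nat.pos_of_ne_zero (by simpa [absNorm_eq_zero_iff] using hp0)
      have hnp1 : absNorm p ≠ 1 := by
        rw [Ne, absNorm_eq_one_iff]; exact hp.ne_top
      have hle : absNorm p ≤ absNorm (p * b) := norm_le_of_le K hne Ideal.mul_le_left
      refine ⟨⟨by omega, ?_⟩, hp, Ideal.mul_le_left, hpS, ?_⟩
      · rw [le_div_iff₀ (by exact_mod_cast hnp)] at hbX
        rw [map_mul, Nat.cast_mul, mul_comm]; exact hbX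
      · rw [eq_maxNorm_iff K hne hp Ideal.mul_le_left]
        intro q hqp hle
        rcases hqp.mul_le.1 hle with h | h
        · exact norm_le_of_le K hp0 h
        · exact_mod_cast hq q hqp h
    · rintro ⟨⟨p, b⟩, ⟨hp, hpS, hpX⟩, hb, hbX, hq⟩ ⟨⟨p2, b2⟩, ⟨hp2, hpS2, hpX2⟩, hb2, hbX2, hq2⟩ h
      simp only [Subtype.mk.injEq, Prod.mk.injEq] at h ⊢
      obtain ⟨h1, rfl⟩ := h
      dsimp only at *
      have hp0 : p ≠ ⊥ := by
        rintro rfl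
        simp only [absNorm_bot, Nat.cast_zero, div_zero] at hbX
        have : absNorm b = 0 := by exact_mod_cast le_antisymm hbX (Nat.cast_nonneg _)
        exact hb (absNorm_eq_zero_iff.1 this)
      exact ⟨rfl, mul_left_cancel₀ hp0 h1⟩
    · rintro ⟨⟨a, p⟩, ⟨ha2, haX⟩, hp, hap, hpS, hm⟩
      dsimp only at *
      have ha : a ≠ ⊥ := by
        rintro rfl
        simp at ha2
      rw [eq_maxNorm_iff K ha hp hap] at hm
      obtain ⟨b, hab⟩ : p ∣ a := Ideal.dvd_iff_le.2 hap
      subst hab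
      have hp0 : p ≠ ⊥ := left_ne_zero_of_mul ha
      have hb0 : b ≠ ⊥ := right_ne_zero_of_mul ha
      have hnp : 0 < absNorm p :=
        Nat.pos_of_ne_zero (by simpa [absNorm_eq_zero_iff] using hp0)
      refine ⟨⟨(p, b), ⟨hp, hpS, ?_⟩, hb0, ?_, ?_⟩, rfl⟩
      · refine le_trans ?_ haX
        exact_mod_cast norm_le_of_le K ha hap
      · rw [le_div_iff₀ (by exact_mod_cast hnp)]
        rw [map_mul, Nat.cast_mul, mul_comm] at haX; exact haX
      · intro q hq hbq
        exact_mod_cast hm q hq (Ideal.mul_le_right.trans hbq)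
  · intro a h
    have ha : a ≠ ⊥ := by
      rintro rfl
      simp at h
    exact finite_sub K _ (absNorm a : ℝ) fun p hp => by exact_mod_cast norm_le_of_le K ha hp.2.1

end AlladiGen
end
end
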